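/- arXiv:2601.15850 — 2 statements merged into one kernel-verified Lean document; each statement's English description precedes it below -/
import Mathlib

section
/- Let n ≥ 1 and Q = 2n+2, and let μ be an upper Ahlfors regular probability measure on the Heisenberg group ℍⁿ. Then there exist a constant C > 0 and N₀ ∈ ℕ such that for every N ≥ N₀ and every finite sequence of points (ζ₁,τ₁),…,(ζ_N,τ_N) ∈ ℍⁿ one has ∫₀¹ ∫_{ℍⁿ} |D_N(z,t;ρ)|² dz dt dρ ≥ C · N^{1 − 1/(Q−2)}. -/
open MeasureTheory Complex

noncomputable section

/-- The Heisenberg group `ℍⁿ` as a set: `ℂⁿ × ℝ`. -/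
abbrev Heis (n : ℕ) : Type := (Fin n → ℂ) × ℝ

/-- Euclidean norm of a point of `ℂⁿ`. -/
def znorm {n : ℕ} (z : Fin n → ℂ) : ℝ := Real.sqrt (∑ j, ‖z j‖ ^ 2)

/-- The Heisenberg group operation
`(z,t)∘(w,s) = (z+w, t+s+(1/2)·Im(z·w̄))`. -/
def Hmul {n : ℕ} (p q : Heis n) : Heis n :=
  (p.1 + q.1, p.2 + q.2 + (1 / 2) * (∑ j, p.1 j * (starRingEnd ℂ) (q.1 j)).im)

/-- The Heisenberg group inverse `(z,t)⁻¹ = (−z,−t)`. -/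
def Hinv {n : ℕ} (p : Heis n) : Heis n := (-p.1, -p.2)

/-- The Korányi norm `‖(z,t)‖ = (|z|⁴+t²)^{1/4}`. -/
def koranyi {n : ℕ} (p : Heis n) : ℝ := (znorm p.1 ^ 4 + p.2 ^ 2) ^ ((1 : ℝ) / 4)

/-- The Korányi distance `dist((z,t),(w,s)) = ‖(z,t)⁻¹∘(w,s)‖`. -/
def Hdist {n : ℕ} (p q : Heis n) : ℝ := koranyi (Hmul (Hinv p) q)

/-- The Heisenberg ball `𝔅_r(p)` of radius `r` centered at `p`. -/
def Hball {n : ℕ} (p : Heis n) (r : ℝ) : Set (Heis n) := {q | Hdist p q < r}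

/-- The set `B_ρ = {(z,t) : |z| ≤ ρ, |t| ≤ ρ²}`. -/
def Hbox (n : ℕ) (ρ : ℝ) : Set (Heis n) := {p | znorm p.1 ≤ ρ ∧ |p.2| ≤ ρ ^ 2}

/-- Left translate of a set: `p ∘ S = {q : p⁻¹∘q ∈ S}`. -/
def Htranslate {n : ℕ} (p : Heis n) (S : Set (Heis n)) : Set (Heis n) :=
  {q | Hmul (Hinv p) q ∈ S}

/-- The discrepancy
`D_N(z,t;ρ) = Σ_{j=1}^N χ_{(z,t)∘B_ρ}(ζⱼ,τⱼ) − N·μ((z,t)∘B_ρ)`. -/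
def disc {n : ℕ} (μ : Measure (Heis n)) {N : ℕ} (pts : Fin N → Heis n)
    (p : Heis n) (ρ : ℝ) : ℝ :=
  (∑ j, (Htranslate p (Hbox n ρ)).indicator (fun _ => (1 : ℝ)) (pts j))
    - N * (μ (Htranslate p (Hbox n ρ))).toReal

/-! ### Gaussian integrals over `ℂⁿ` -/

lemma integral_cexp_complex_gaussian {b : ℂ} (hb : 0 < b.re) (P Q : ℂ) :
    ∫ z : ℂ, cexp (-b * (z * (starRingEnd ℂ) z) + P * z + Q * (starRingEnd ℂ) z) =
      (Real.pi / b) * cexp (P * Q / b) := by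
  have hb0 : b ≠ 0 := by rintro rfl; simp at hb
  have hb' : (-b).re < 0 := by simpa using hb
  rw [← (Complex.volume_preserving_equiv_real_prod.symm).integral_comp
    (Complex.measurableEquivRealProd.symm.measurableEmbedding)]
  have h : ∀ p : ℝ × ℝ, cexp (-b * (Complex.measurableEquivRealProd.symm p *
      (starRingEnd ℂ) (Complex.measurableEquivRealProd.symm p)) +
      P * Complex.measurableEquivRealProd.symm p +
      Q * (starRingEnd ℂ) (Complex.measurableEquivRealProd.symm p)) =
      cexp (-b * (p.1 : ℂ) ^ 2 + (P + Q) * p.1 + 0) *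
        cexp (-b * (p.2 : ℂ) ^ 2 + (I * (P - Q)) * p.2 + 0) := by
    intro p
    have h1 : Complex.measurableEquivRealProd.symm p = (p.1 : ℂ) + p.2 * I := by
      apply Complex.ext <;> simp [Complex.measurableEquivRealProd_symm_apply]
    have h2 : (starRingEnd ℂ) (Complex.measurableEquivRealProd.symm p) = (p.1 : ℂ) - p.2 * I := by
      rw [h1]; simp [sub_eq_add_neg]
    rw [h2, h1, ← Complex.exp_add]
    congr 1
    linear_combination (b * (p.2 : ℂ) ^ 2) * I_sq
  simp_rw [h]
  rw [Measure.volume_eq_prod, integral_prod_mul (fun x : ℝ => cexp (-b * (x : ℂ) ^ 2 + (P + Q) * x + 0))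
    (fun x : ℝ => cexp (-b * (x : ℂ) ^ 2 + (I * (P - Q)) * x + 0)),
    integral_cexp_quadratic hb', integral_cexp_quadratic hb', mul_mul_mul_comm, ← Complex.exp_add,
    neg_neg]
  congr 1
  · rw [← Complex.cpow_add _ _ (div_ne_zero (by exact_mod_cast Real.pi_ne_zero) hb0)]
    norm_num
  · congr 1
    field_simp
    ring_nf
    rw [I_sq]
    ring

lemma integral_cexp_complex_gaussian_pi {n : ℕ} {b : ℂ} (hb : 0 < b.re) (P Q : Fin n → ℂ) :
    ∫ z : Fin n → ℂ, cexp (∑ j, (-b * (z j * (starRingEnd ℂ) (z j)) + P j * z j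
        + Q j * (starRingEnd ℂ) (z j))) =
      (Real.pi / b) ^ n * cexp (∑ j, P j * Q j / b) := by
  simp_rw [Complex.exp_sum]
  rw [integral_fintype_prod_volume_eq_prod (fun (j : Fin n) (w : ℂ) =>
    cexp (-b * (w * (starRingEnd ℂ) w) + P j * w + Q j * (starRingEnd ℂ) w))]
  simp_rw [integral_cexp_complex_gaussian hb]
  rw [Finset.prod_mul_distrib]
  simp [div_pow]

/-- The squared Euclidean norm on `ℂⁿ`. -/
def nsq {n : ℕ} (z : Fin n → ℂ) : ℝ := ∑ j, ‖z j‖ ^ 2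

/-- The standard symplectic form `Im (z·w̄)` on `ℂⁿ`. -/
def symp {n : ℕ} (z w : Fin n → ℂ) : ℝ := (∑ j, z j * (starRingEnd ℂ) (w j)).im

/-- The twisting phase of frequency `l`. -/
def phase {n : ℕ} (l : ℝ) (z w : Fin n → ℂ) : ℂ := cexp ((-(l / 2) * symp z w : ℝ) * I)

lemma nsq_nonneg {n : ℕ} (z : Fin n → ℂ) : 0 ≤ nsq z :=
  Finset.sum_nonneg fun _ _ => by positivity

lemma nsq_sub_comm {n : ℕ} (z w : Fin n → ℂ) : nsq (z - w) = nsq (w - z) := by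
  simp [nsq, norm_sub_rev]

@[fun_prop]
lemma continuous_nsq {n : ℕ} : Continuous (nsq (n := n)) := by
  unfold nsq; fun_prop

@[fun_prop]
lemma continuous_symp {n : ℕ} : Continuous fun p : (Fin n → ℂ) × (Fin n → ℂ) => symp p.1 p.2 := by
  unfold symp; fun_prop

lemma ofReal_nsq {n : ℕ} (z w : Fin n → ℂ) :
    (nsq (z - w) : ℂ) = ∑ j, (z j - w j) * ((starRingEnd ℂ) (z j) - (starRingEnd ℂ) (w j)) := by
  simp only [nsq, Complex.ofReal_sum]
  refine Finset.sum_congr rfl fun j _ => ?_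
  rw [← map_sub, Complex.mul_conj, Complex.normSq_eq_norm_sq]
  simp

lemma symp_antisymm {n : ℕ} (z w : Fin n → ℂ) : symp w z = -symp z w := by
  simp only [symp, Complex.im_sum, ← Finset.sum_neg_distrib]
  refine Finset.sum_congr rfl fun j _ => ?_
  simp; ring

lemma phase_eq {n : ℕ} (l : ℝ) (z w : Fin n → ℂ) :
    phase l z w = cexp (∑ j, -(l / 4 : ℂ) *
      (z j * (starRingEnd ℂ) (w j) - (starRingEnd ℂ) (z j) * w j)) := by
  rw [phase, symp, ← Finset.mul_sum]
  congr 1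
  have : ∑ j, (z j * (starRingEnd ℂ) (w j) - (starRingEnd ℂ) (z j) * w j) =
      (2 * (∑ j, z j * (starRingEnd ℂ) (w j)).im : ℝ) * I := by
    rw [← Complex.sub_conj, map_sum, ← Finset.sum_sub_distrib]
    simp
  rw [this]
  push_cast
  ring

lemma norm_phase {n : ℕ} (l : ℝ) (z w : Fin n → ℂ) : ‖phase l z w‖ = 1 :=
  Complex.norm_exp_ofReal_mul_I _

lemma conj_phase {n : ℕ} (l : ℝ) (z w : Fin n → ℂ) :
    (starRingEnd ℂ) (phase l z w) = phase l w z := by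
  simp only [phase, ← Complex.exp_conj, symp_antisymm z w]
  congr 1
  rw [map_mul, Complex.conj_ofReal, Complex.conj_I]
  push_cast
  ring

lemma integral_gaussian_pair {n : ℕ} (l : ℝ) {α : ℂ} (hα : 0 < α.re) (w w' : Fin n → ℂ) :
    ∫ z, (phase l z w * cexp (-α * nsq (z - w))) *
        (starRingEnd ℂ) (phase l z w' * cexp (-α * nsq (z - w'))) =
      (Real.pi / (2 * α.re : ℝ)) ^ n * (phase l w' w *
        cexp (-((‖α‖ ^ 2 + (l / 4) ^ 2) / (2 * α.re) : ℝ) * nsq (w - w'))) := by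
  have hre : (α + (starRingEnd ℂ) α) = (2 * α.re : ℝ) := Complex.add_conj α
  have hb : 0 < (α + (starRingEnd ℂ) α).re := by rw [hre, Complex.ofReal_re]; positivity
  have hb0 : α + (starRingEnd ℂ) α ≠ 0 := by intro h; rw [h] at hb; simp at hb
  have hn : ((‖α‖ ^ 2 : ℝ) : ℂ) = α * (starRingEnd ℂ) α := by
    rw [Complex.mul_conj, Complex.normSq_eq_norm_sq]
  let P : Fin n → ℂ := fun j => (α - l / 4) * (starRingEnd ℂ) (w j) +
    ((starRingEnd ℂ) α + l / 4) * (starRingEnd ℂ) (w' j)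
  let R : Fin n → ℂ := fun j => (α + l / 4) * w j + ((starRingEnd ℂ) α - l / 4) * w' j
  let K : ℂ := cexp (∑ j, (-α * (w j * (starRingEnd ℂ) (w j)) -
    (starRingEnd ℂ) α * (w' j * (starRingEnd ℂ) (w' j))))
  have h : ∀ z : Fin n → ℂ, (phase l z w * cexp (-α * nsq (z - w))) *
      (starRingEnd ℂ) (phase l z w' * cexp (-α * nsq (z - w'))) =
      K * cexp (∑ j, (-(α + (starRingEnd ℂ) α) * (z j * (starRingEnd ℂ) (z j)) + P j * z j
        + R j * (starRingEnd ℂ) (z j))) := by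
    intro z
    rw [map_mul, conj_phase, ← Complex.exp_conj, map_mul, map_neg, Complex.conj_ofReal,
      phase_eq, phase_eq, ofReal_nsq, ofReal_nsq, Finset.mul_sum, Finset.mul_sum]
    simp only [K, P, R, ← Complex.exp_add, ← Finset.sum_add_distrib]
    congr 1
    refine Finset.sum_congr rfl fun j _ => ?_
    ring
  simp_rw [h]
  rw [integral_const_mul, integral_cexp_complex_gaussian_pi hb, hre, phase_eq, ofReal_nsq,
    Finset.mul_sum, mul_left_comm]
  simp only [K, ← Complex.exp_add, ← Finset.sum_add_distrib]
  congr 2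
  refine Finset.sum_congr rfl fun j _ => ?_
  simp only [P, R]
  rw [Complex.ofReal_div, Complex.ofReal_add, hn, ← hre]
  push_cast
  field_simp
  ring

lemma integral_gaussian_twisted_conv {n : ℕ} (l : ℝ) {c γ c₁ : ℝ} (hc : 0 < c) (hγ : 0 < γ)
    (hc₁ : c₁ * (c + γ) = c * γ + (l / 4) ^ 2) (w ζ : Fin n → ℂ) :
    ∫ z, (phase l w z * cexp (-γ * nsq (w - z))) * (phase l z ζ * cexp (-c * nsq (z - ζ))) =
      (Real.pi / (c + γ : ℝ)) ^ n * (phase l w ζ * cexp (-c₁ * nsq (w - ζ))) := by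
  have hb : 0 < ((c + γ : ℝ) : ℂ).re := by rw [Complex.ofReal_re]; positivity
  have hb0 : (c : ℂ) + γ ≠ 0 := by
    have : c + γ ≠ 0 := by positivity
    exact_mod_cast this
  have hcc : (c₁ : ℂ) = (c * γ + (l / 4) ^ 2) / (c + γ) := by
    rw [eq_div_iff hb0]; exact_mod_cast hc₁
  let P : Fin n → ℂ := fun j => (γ + l / 4) * (starRingEnd ℂ) (w j) +
    (c - l / 4) * (starRingEnd ℂ) (ζ j)
  let R : Fin n → ℂ := fun j => (γ - l / 4) * w j + (c + l / 4) * ζ j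
  let K : ℂ := cexp (∑ j, (-γ * (w j * (starRingEnd ℂ) (w j)) -
    c * (ζ j * (starRingEnd ℂ) (ζ j))))
  have h : ∀ z : Fin n → ℂ, (phase l w z * cexp (-γ * nsq (w - z))) *
      (phase l z ζ * cexp (-c * nsq (z - ζ))) =
      K * cexp (∑ j, (-((c + γ : ℝ) : ℂ) * (z j * (starRingEnd ℂ) (z j)) + P j * z j
        + R j * (starRingEnd ℂ) (z j))) := by
    intro z
    rw [phase_eq, phase_eq, ofReal_nsq, ofReal_nsq, Finset.mul_sum, Finset.mul_sum]
    simp only [K, P, R, ← Complex.exp_add, ← Finset.sum_add_distrib]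
    congr 1
    refine Finset.sum_congr rfl fun j _ => ?_
    push_cast
    ring
  simp_rw [h]
  rw [integral_const_mul, integral_cexp_complex_gaussian_pi hb, phase_eq, ofReal_nsq,
    Finset.mul_sum, mul_left_comm]
  simp only [K, ← Complex.exp_add, ← Finset.sum_add_distrib]
  congr 2
  refine Finset.sum_congr rfl fun j _ => ?_
  simp only [P, R]
  rw [hcc]
  push_cast
  field_simp
  ring

lemma integral_exp_neg_nsq {n : ℕ} {a : ℝ} (ha : 0 < a) (w : Fin n → ℂ) :
    ∫ z, Real.exp (-a * nsq (z - w)) = (Real.pi / a) ^ n := by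
  have h := integral_gaussian_twisted_conv 0 (c := a / 2) (γ := a / 2) (c₁ := a / 4)
    (by positivity) (by positivity) (by ring) w w
  have h2 : ∀ z : Fin n → ℂ, (phase 0 w z * cexp (-(a / 2 : ℝ) * nsq (w - z))) *
      (phase 0 z w * cexp (-(a / 2 : ℝ) * nsq (z - w))) =
      ((Real.exp (-a * nsq (z - w)) : ℝ) : ℂ) := by
    intro z
    simp only [phase, nsq_sub_comm w z, ← Complex.exp_add, Complex.ofReal_exp]
    congr 1
    push_cast
    ring
  simp_rw [h2] at h
  rw [integral_complex_ofReal] at h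
  have h3 : nsq (w - w) = 0 := by simp [nsq]
  rw [h3] at h
  simp only [phase, ← Complex.exp_add] at h
  norm_num at h
  simp only [neg_mul]
  exact_mod_cast h

lemma integrable_exp_neg_nsq {n : ℕ} {a : ℝ} (ha : 0 < a) (w : Fin n → ℂ) :
    Integrable fun z => Real.exp (-a * nsq (z - w)) := by
  by_contra h
  have h1 := integral_exp_neg_nsq ha w
  rw [integral_undef h] at h1
  have : 0 < (Real.pi / a) ^ n := by positivity
  linarith

lemma lintegral_exp_neg_nsq {n : ℕ} {a : ℝ} (ha : 0 < a) (w : Fin n → ℂ) :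
    ∫⁻ z, ENNReal.ofReal (Real.exp (-a * nsq (z - w))) = ENNReal.ofReal ((Real.pi / a) ^ n) := by
  rw [← integral_exp_neg_nsq ha w,
    ofReal_integral_eq_lintegral_ofReal (integrable_exp_neg_nsq ha w)
      (Filter.Eventually.of_forall fun z => (Real.exp_pos _).le)]

/-! ### Squares of superpositions and the Laplace–Plancherel identity -/

lemma lintegral_sq_enorm_integral {Ω Z : Type*} [MeasurableSpace Ω] [MeasurableSpace Z]
    (P : Measure Ω) (ν : Measure Z) [SFinite P] [SFinite ν] (k : Ω → Z → ℂ)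
    (h : Integrable (fun x : (Ω × Ω) × Z => k x.1.1 x.2 * (starRingEnd ℂ) (k x.1.2 x.2))
      ((P.prod P).prod ν)) :
    ∫⁻ z, ‖∫ ω, k ω z ∂P‖ₑ ^ 2 ∂ν =
      ENNReal.ofReal (∫ p : Ω × Ω, ∫ z, k p.1 z * (starRingEnd ℂ) (k p.2 z) ∂ν ∂(P.prod P)).re := by
  have hz : ∀ z, ∫ p : Ω × Ω, k p.1 z * (starRingEnd ℂ) (k p.2 z) ∂(P.prod P) =
      ((‖∫ ω, k ω z ∂P‖ ^ 2 : ℝ) : ℂ) := by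
    intro z
    rw [integral_prod_mul (fun ω => k ω z) (fun ω => (starRingEnd ℂ) (k ω z)), integral_conj,
      Complex.mul_conj, Complex.normSq_eq_norm_sq]
  have hint := h.integral_prod_right
  simp only [hz] at hint
  have hint' : Integrable (fun z => ‖∫ ω, k ω z ∂P‖ ^ 2) ν := hint.re
  rw [integral_integral_swap (f := fun (p : Ω × Ω) z => k p.1 z * (starRingEnd ℂ) (k p.2 z)) h]
  simp only [hz]
  rw [integral_complex_ofReal, Complex.ofReal_re,
    ofReal_integral_eq_lintegral_ofReal hint' (Filter.Eventually.of_forall fun z => by positivity)]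
  refine lintegral_congr fun z => ?_
  rw [ENNReal.ofReal_pow (norm_nonneg _), ofReal_norm]

lemma integral_exp_neg_abs_mul_cexp {a : ℝ} (ha : 0 < a) (b : ℝ) :
    Integrable (fun t : ℝ => ((Real.exp (-a * |t|) : ℝ) : ℂ)) ∧
    ∫ t : ℝ, cexp ((-b * t : ℝ) * I) * ((Real.exp (-a * |t|) : ℝ) : ℂ) =
      (2 * a / (a ^ 2 + b ^ 2) : ℝ) := by
  have h1 : (-(a : ℂ) - b * I).re < 0 := by simpa using ha
  have h2 : 0 < ((a : ℂ) - b * I).re := by simpa using ha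
  have e1 : ∀ t ∈ Set.Ioi (0 : ℝ), cexp ((-b * t : ℝ) * I) * ((Real.exp (-a * |t|) : ℝ) : ℂ) =
      cexp ((-(a : ℂ) - b * I) * t) := by
    intro t ht
    rw [abs_of_pos ht, Complex.ofReal_exp, ← Complex.exp_add]
    congr 1; push_cast; ring
  have e2 : ∀ t ∈ Set.Iic (0 : ℝ), cexp ((-b * t : ℝ) * I) * ((Real.exp (-a * |t|) : ℝ) : ℂ) =
      cexp (((a : ℂ) - b * I) * t) := by
    intro t ht
    rw [abs_of_nonpos ht, Complex.ofReal_exp, ← Complex.exp_add]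
    congr 1; push_cast; ring
  have i1 : IntegrableOn (fun t : ℝ => cexp ((-b * t : ℝ) * I) *
      ((Real.exp (-a * |t|) : ℝ) : ℂ)) (Set.Ioi 0) :=
    (integrableOn_congr_fun e1 measurableSet_Ioi).2 (integrableOn_exp_mul_complex_Ioi h1 0)
  have i2 : IntegrableOn (fun t : ℝ => cexp ((-b * t : ℝ) * I) *
      ((Real.exp (-a * |t|) : ℝ) : ℂ)) (Set.Iic 0) :=
    (integrableOn_congr_fun e2 measurableSet_Iic).2 (integrableOn_exp_mul_complex_Iic h2 0)
  constructor
  · have h := (i2.union i1)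
    rw [Set.Iic_union_Ioi, integrableOn_univ] at h
    refine h.mono (by fun_prop) (Filter.Eventually.of_forall fun t => ?_)
    rw [norm_mul, Complex.norm_exp_ofReal_mul_I, one_mul]
  · rw [← setIntegral_univ, ← Set.Iic_union_Ioi (a := (0 : ℝ)),
      setIntegral_union (Set.Iic_disjoint_Ioi le_rfl) measurableSet_Ioi i2 i1,
      setIntegral_congr_fun measurableSet_Iic e2, setIntegral_congr_fun measurableSet_Ioi e1,
      integral_exp_mul_complex_Iic h2, integral_exp_mul_complex_Ioi h1]
    have n1 : (a : ℂ) - b * I ≠ 0 := by intro h; rw [h] at h2; simp at h2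
    have n2 : (-(a : ℂ) - b * I) ≠ 0 := by intro h; rw [h] at h1; simp at h1
    have n3 : ((a : ℂ) ^ 2 + b ^ 2) ≠ 0 := by
      have : a ^ 2 + b ^ 2 ≠ 0 := by positivity
      exact_mod_cast this
    simp only [Complex.ofReal_zero, mul_zero, Complex.exp_zero]
    push_cast
    rw [div_add_div _ _ n1 n2, div_eq_div_iff (mul_ne_zero n1 n2) n3]
    linear_combination (-2 * a * b ^ 2) * I_sq

lemma integrable_inv_add_sq {a : ℝ} (ha : 0 < a) : Integrable fun b : ℝ => (a ^ 2 + b ^ 2)⁻¹ := by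
  have h := (integrable_inv_one_add_sq.comp_div ha.ne').const_mul (a ^ 2)⁻¹
  refine h.congr (Filter.Eventually.of_forall fun b => ?_)
  simp only
  rw [← mul_inv]
  congr 1
  field_simp

lemma integral_cexp_mul_inv_add_sq {a : ℝ} (ha : 0 < a) (u : ℝ) :
    ∫ b : ℝ, cexp ((b * u : ℝ) * I) * (((a ^ 2 + b ^ 2)⁻¹ : ℝ) : ℂ) =
      (Real.pi / a * Real.exp (-a * |u|) : ℝ) := by
  have hF : FourierTransform.fourier (fun t : ℝ => ((Real.exp (-a * |t|) : ℝ) : ℂ)) =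
      fun ξ : ℝ => ((2 * a * (a ^ 2 + (ξ * (2 * Real.pi)) ^ 2)⁻¹ : ℝ) : ℂ) := by
    funext ξ
    rw [Real.fourier_real_eq_integral_exp_smul, ← div_eq_mul_inv,
      ← (integral_exp_neg_abs_mul_cexp ha (ξ * (2 * Real.pi))).2]
    refine integral_congr_ae (Filter.Eventually.of_forall fun t => ?_)
    simp only [smul_eq_mul]
    congr 3
    push_cast
    ring
  have hi : Integrable (FourierTransform.fourier
      (fun t : ℝ => ((Real.exp (-a * |t|) : ℝ) : ℂ))) := by
    rw [hF]
    exact (((integrable_inv_add_sq ha).comp_mul_right' (by positivity)).const_mul _).ofReal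
  have hc : Continuous (fun t : ℝ => ((Real.exp (-a * |t|) : ℝ) : ℂ)) := by fun_prop
  have h := congrFun (hc.fourierInv_fourier_eq (integral_exp_neg_abs_mul_cexp ha 0).1 hi) u
  rw [hF, Real.fourierInv_eq'] at h
  have h3 := Measure.integral_comp_mul_right (fun b : ℝ => cexp ((b * u : ℝ) * I) *
    (((a ^ 2 + b ^ 2)⁻¹ : ℝ) : ℂ)) (2 * Real.pi)
  have h4 : (∫ ξ : ℝ, cexp (((2 * Real.pi * inner ℝ ξ u : ℝ) : ℂ) * I) •
      ((2 * a * (a ^ 2 + (ξ * (2 * Real.pi)) ^ 2)⁻¹ : ℝ) : ℂ)) = (2 * a : ℂ) *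
      ∫ x : ℝ, cexp ((x * (2 * Real.pi) * u : ℝ) * I) *
      (((a ^ 2 + (x * (2 * Real.pi)) ^ 2)⁻¹ : ℝ) : ℂ) := by
    rw [← integral_const_mul]
    refine integral_congr_ae (Filter.Eventually.of_forall fun t => ?_)
    simp only [smul_eq_mul]
    have : 2 * Real.pi * inner ℝ t u = t * (2 * Real.pi) * u := by simp; ring
    rw [this]
    push_cast
    ring
  rw [h4, h3, abs_of_pos (by positivity : 0 < (2 * Real.pi)⁻¹), Complex.real_smul] at h
  have hπ : (Real.pi : ℂ) ≠ 0 := by exact_mod_cast Real.pi_ne_zero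
  have ha' : (a : ℂ) ≠ 0 := by exact_mod_cast ha.ne'
  rw [Complex.ofReal_mul, ← h]
  generalize (∫ b : ℝ, cexp ((b * u : ℝ) * I) * (((a ^ 2 + b ^ 2)⁻¹ : ℝ) : ℂ)) = J
  push_cast
  field_simp

lemma measurable_pair {Ω Z : Type*} [MeasurableSpace Ω] [MeasurableSpace Z] {k : Ω → Z → ℂ}
    (hk : Measurable (Function.uncurry k)) :
    Measurable fun x : (Ω × Ω) × Z => k x.1.1 x.2 * (starRingEnd ℂ) (k x.1.2 x.2) := by
  have m1 : Measurable fun x : (Ω × Ω) × Z => k x.1.1 x.2 :=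
    hk.comp ((measurable_fst.comp measurable_fst).prodMk measurable_snd)
  have m2 : Measurable fun x : (Ω × Ω) × Z => k x.1.2 x.2 :=
    hk.comp ((measurable_snd.comp measurable_fst).prodMk measurable_snd)
  exact m1.mul (Complex.continuous_conj.measurable.comp m2)

lemma integrable_pair_of_bound {Ω Z : Type*} [MeasurableSpace Ω] [MeasurableSpace Z]
    (P : Measure Ω) (ν : Measure Z) [IsFiniteMeasure P] [IsFiniteMeasure ν] (k : Ω → Z → ℂ)
    (hk : Measurable (Function.uncurry k)) (hk1 : ∀ ω z, ‖k ω z‖ ≤ 1) :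
    Integrable (fun x : (Ω × Ω) × Z => k x.1.1 x.2 * (starRingEnd ℂ) (k x.1.2 x.2))
      ((P.prod P).prod ν) := by
  refine Integrable.of_bound (C := 1) (measurable_pair hk).aestronglyMeasurable
    (Filter.Eventually.of_forall fun x => ?_)
  rw [norm_mul, RCLike.norm_conj]
  exact mul_le_one₀ (hk1 _ _) (norm_nonneg _) (hk1 _ _)

lemma integral_Ioi_exp_neg {a m : ℝ} (ha : 0 < a) (hm : 0 ≤ m) :
    ∫ A in Set.Ioi 0, (Set.Ici m).indicator (fun _ => (1 : ℝ)) A * Real.exp (-(2 * a) * A) =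
      Real.exp (-(2 * a) * m) / (2 * a) := by
  have h1 : ∀ A, (Set.Ici m).indicator (fun _ => (1 : ℝ)) A * Real.exp (-(2 * a) * A) =
      (Set.Ici m).indicator (fun A => Real.exp (-(2 * a) * A)) A := by
    intro A
    by_cases h : A ∈ Set.Ici m <;> simp [h]
  simp_rw [h1]
  rw [setIntegral_congr_set (Ioi_ae_eq_Ici (a := (0 : ℝ))), setIntegral_indicator measurableSet_Ici,
    Set.Ici_inter_Ici, max_eq_right hm, setIntegral_congr_set Ioi_ae_eq_Ici.symm,
    integral_exp_mul_Ioi (by linarith)]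
  rw [div_neg, neg_div, neg_neg]

/-- Plancherel's identity for the Laplace transform along a vertical line. -/
lemma laplace_plancherel {Ω : Type*} [MeasurableSpace Ω] (P : Measure Ω) [IsFiniteMeasure P]
    (κ : Ω → ℂ) (hκ : Measurable κ) (hκ1 : ∀ ω, ‖κ ω‖ ≤ 1) (r : Ω → ℝ) (hr : Measurable r)
    (hr0 : ∀ ω, 0 ≤ r ω) {a : ℝ} (ha : 0 < a) :
    ∫⁻ A in Set.Ioi 0, ENNReal.ofReal (Real.exp (-(2 * a) * A)) *
        ‖∫ ω, κ ω * (Set.Ici (r ω)).indicator (fun _ => 1) A ∂P‖ₑ ^ 2 =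
      ∫⁻ b : ℝ, ENNReal.ofReal ((2 * Real.pi)⁻¹ * (a ^ 2 + b ^ 2)⁻¹) *
        ‖∫ ω, κ ω * cexp (-(a + b * I) * r ω) ∂P‖ₑ ^ 2 := by
  let w₁ : ℝ → ENNReal := fun A => ENNReal.ofReal (Real.exp (-(2 * a) * A))
  let w₂ : ℝ → ENNReal := fun b => ENNReal.ofReal ((2 * Real.pi)⁻¹ * (a ^ 2 + b ^ 2)⁻¹)
  let ν₁ : Measure ℝ := (volume.restrict (Set.Ioi 0)).withDensity w₁
  let ν₂ : Measure ℝ := volume.withDensity w₂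
  have mw₁ : Measurable w₁ := by fun_prop
  have mw₂ : Measurable w₂ := by fun_prop
  have i₂ : Integrable fun b : ℝ => (2 * Real.pi)⁻¹ * (a ^ 2 + b ^ 2)⁻¹ :=
    (integrable_inv_add_sq ha).const_mul _
  have f₁ : IsFiniteMeasure ν₁ := isFiniteMeasure_withDensity_ofReal
    (integrableOn_exp_mul_Ioi (by linarith) 0).2
  have f₂ : IsFiniteMeasure ν₂ := isFiniteMeasure_withDensity_ofReal i₂.2
  have I₁ : ∀ f : ℝ → ℂ, ∫ A, f A ∂ν₁ = ∫ A in Set.Ioi 0, f A * (Real.exp (-(2 * a) * A) : ℝ) := by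
    intro f
    rw [integral_withDensity_eq_integral_toReal_smul mw₁
      (Filter.Eventually.of_forall fun _ => ENNReal.ofReal_lt_top)]
    refine integral_congr_ae (Filter.Eventually.of_forall fun A => ?_)
    simp only [w₁, ENNReal.toReal_ofReal (Real.exp_pos _).le, Complex.real_smul, mul_comm]
  have I₂ : ∀ f : ℝ → ℂ, ∫ b, f b ∂ν₂ =
      ∫ b : ℝ, f b * ((2 * Real.pi)⁻¹ * (a ^ 2 + b ^ 2)⁻¹ : ℝ) := by
    intro f
    rw [integral_withDensity_eq_integral_toReal_smul mw₂
      (Filter.Eventually.of_forall fun _ => ENNReal.ofReal_lt_top)]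
    refine integral_congr_ae (Filter.Eventually.of_forall fun b => ?_)
    simp only [w₂]
    rw [ENNReal.toReal_ofReal (by positivity), Complex.real_smul, mul_comm]
  let k₁ : Ω → ℝ → ℂ := fun ω A => κ ω * (Set.Ici (r ω)).indicator (fun _ => 1) A
  let k₂ : Ω → ℝ → ℂ := fun ω b => κ ω * cexp (-(a + b * I) * r ω)
  have mk₁ : Measurable (Function.uncurry k₁) := by
    refine (hκ.comp measurable_fst).mul ?_
    exact (measurable_const (a := (1 : ℂ))).indicator
      (measurableSet_le (hr.comp measurable_fst) (measurable_snd (α := Ω) (β := ℝ)))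
  have mk₂ : Measurable (Function.uncurry k₂) := by
    unfold k₂ Function.uncurry
    fun_prop
  have b₁ : ∀ ω z, ‖k₁ ω z‖ ≤ 1 := by
    intro ω z
    rw [norm_mul]
    refine mul_le_one₀ (hκ1 ω) (norm_nonneg _) ?_
    exact (norm_indicator_le_norm_self _ _).trans (by simp)
  have b₂ : ∀ ω z, ‖k₂ ω z‖ ≤ 1 := by
    intro ω z
    rw [norm_mul, Complex.norm_exp]
    refine mul_le_one₀ (hκ1 ω) (Real.exp_pos _).le ?_
    rw [Real.exp_le_one_iff]
    have : (-(a + z * I) * r ω).re = -(a * r ω) := by simp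
    rw [this]
    have := mul_nonneg ha.le (hr0 ω)
    linarith
  have e₁ := lintegral_sq_enorm_integral P ν₁ k₁ (integrable_pair_of_bound P ν₁ k₁ mk₁ b₁)
  have e₂ := lintegral_sq_enorm_integral P ν₂ k₂ (integrable_pair_of_bound P ν₂ k₂ mk₂ b₂)
  have s₁ : Measurable fun A => ‖∫ ω, k₁ ω A ∂P‖ₑ ^ 2 :=
    (mk₁.stronglyMeasurable.integral_prod_left (μ := P)).measurable.enorm.pow_const 2
  have s₂ : Measurable fun A => ‖∫ ω, k₂ ω A ∂P‖ₑ ^ 2 :=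
    (mk₂.stronglyMeasurable.integral_prod_left (μ := P)).measurable.enorm.pow_const 2
  rw [lintegral_withDensity_eq_lintegral_mul _ mw₁ s₁] at e₁
  rw [lintegral_withDensity_eq_lintegral_mul _ mw₂ s₂] at e₂
  refine e₁.trans (Eq.trans ?_ e₂.symm)
  congr 3
  funext p
  rw [I₁, I₂]
  have h₁ : ∀ A : ℝ, k₁ p.1 A * (starRingEnd ℂ) (k₁ p.2 A) * (Real.exp (-(2 * a) * A) : ℝ) =
      κ p.1 * (starRingEnd ℂ) (κ p.2) *
        (((Set.Ici (max (r p.1) (r p.2))).indicator (fun _ => (1 : ℝ)) A *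
          Real.exp (-(2 * a) * A) : ℝ) : ℂ) := by
    intro A
    simp only [k₁, Set.indicator_apply, Set.mem_Ici, max_le_iff]
    by_cases h1 : r p.1 ≤ A <;> by_cases h2 : r p.2 ≤ A <;> simp [h1, h2]
  have h₂ : ∀ b : ℝ, k₂ p.1 b * (starRingEnd ℂ) (k₂ p.2 b) *
      ((2 * Real.pi)⁻¹ * (a ^ 2 + b ^ 2)⁻¹ : ℝ) =
      (κ p.1 * (starRingEnd ℂ) (κ p.2) * ((2 * Real.pi)⁻¹ * Real.exp (-a * (r p.1 + r p.2)) : ℝ)) *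
        (cexp ((b * (r p.2 - r p.1) : ℝ) * I) * (((a ^ 2 + b ^ 2)⁻¹ : ℝ) : ℂ)) := by
    intro b
    simp only [k₂, map_mul, ← Complex.exp_conj, map_neg, map_add, Complex.conj_ofReal,
      Complex.conj_I]
    have : cexp (-(a + b * I) * r p.1) * cexp (-(a + b * -I) * r p.2) =
        (Real.exp (-a * (r p.1 + r p.2)) : ℝ) * cexp ((b * (r p.2 - r p.1) : ℝ) * I) := by
      rw [Complex.ofReal_exp, ← Complex.exp_add, ← Complex.exp_add]
      congr 1
      push_cast
      ring
    push_cast at this ⊢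
    linear_combination κ p.1 * (starRingEnd ℂ) (κ p.2) * ((2 * Real.pi)⁻¹ * (a ^ 2 + b ^ 2)⁻¹) * this
  simp_rw [h₁, h₂]
  rw [integral_const_mul, integral_const_mul, integral_complex_ofReal,
    integral_Ioi_exp_neg ha (le_max_of_le_left (hr0 _)), integral_cexp_mul_inv_add_sq ha,
    mul_assoc (κ p.1 * (starRingEnd ℂ) (κ p.2)) (((2 * Real.pi)⁻¹ *
      Real.exp (-a * (r p.1 + r p.2)) : ℝ) : ℂ),
    ← Complex.ofReal_mul]
  congr 2
  have hmax : max (r p.1) (r p.2) = (r p.1 + r p.2 + |r p.2 - r p.1|) / 2 := by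
    rcases le_total (r p.1) (r p.2) with h | h
    · rw [max_eq_right h, abs_of_nonneg (sub_nonneg.2 h)]; ring
    · rw [max_eq_left h, abs_of_nonpos (sub_nonpos.2 h)]; ring
  rw [hmax, show -(2 * a) * ((r p.1 + r p.2 + |r p.2 - r p.1|) / 2) =
    -a * (r p.1 + r p.2) + -a * |r p.2 - r p.1| by ring, Real.exp_add]
  field_simp

/-! ### Twisted superpositions -/

/-- The superposition of twisted translates of the radial profile `f`, with coefficient `κ`. -/
def twist {Ω : Type*} [MeasurableSpace Ω] {n : ℕ} (P : Measure Ω) (ζ : Ω → Fin n → ℂ) (κ : Ω → ℂ)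
    (l : ℝ) (f : ℝ → ℂ) (z : Fin n → ℂ) : ℂ :=
  ∫ ω, κ ω * (phase l z (ζ ω) * f (nsq (z - ζ ω))) ∂P

/-- The Gaussian energy of the twisted system, with values in `ℝ≥0∞`. -/
def gaussEnergy {Ω : Type*} [MeasurableSpace Ω] {n : ℕ} (P : Measure Ω) (ζ : Ω → Fin n → ℂ)
    (κ : Ω → ℂ) (l s : ℝ) : ENNReal :=
  ENNReal.ofReal (∫ p : Ω × Ω, κ p.1 * (starRingEnd ℂ) (κ p.2) *
    (phase l (ζ p.2) (ζ p.1) * cexp (-s * nsq (ζ p.1 - ζ p.2))) ∂(P.prod P)).re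

@[fun_prop]
lemma measurable_phase {n : ℕ} {X : Type*} [MeasurableSpace X] {l : X → ℝ} {f g : X → Fin n → ℂ}
    (hl : Measurable l) (hf : Measurable f) (hg : Measurable g) :
    Measurable fun x => phase (l x) (f x) (g x) := by
  have := continuous_symp (n := n).measurable.comp (hf.prodMk hg)
  unfold phase
  simp only [Function.comp_def] at this
  fun_prop

@[fun_prop]
lemma measurable_nsq {n : ℕ} : Measurable (nsq (n := n)) := continuous_nsq.measurable

lemma norm_cexp_neg_mul_nsq {n : ℕ} (α : ℂ) (z : Fin n → ℂ) :
    ‖cexp (-α * nsq z)‖ = Real.exp (-α.re * nsq z) := by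
  rw [Complex.norm_exp]; simp

lemma norm_cexp_neg_mul_nsq_le {n : ℕ} {α : ℂ} (hα : 0 ≤ α.re) (z : Fin n → ℂ) :
    ‖cexp (-α * nsq z)‖ ≤ 1 := by
  rw [norm_cexp_neg_mul_nsq, Real.exp_le_one_iff]
  have := mul_nonneg hα (nsq_nonneg z)
  linarith

lemma integrable_prod_exp_neg_nsq {Ω : Type*} [MeasurableSpace Ω] {n : ℕ} (P : Measure Ω)
    [IsFiniteMeasure P] {a : ℝ} (ha : 0 < a) {ξ : Ω → Fin n → ℂ} (hξ : Measurable ξ) :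
    Integrable (fun x : Ω × (Fin n → ℂ) => Real.exp (-a * nsq (x.2 - ξ x.1)))
      (P.prod volume) := by
  have hm : Measurable fun x : Ω × (Fin n → ℂ) => Real.exp (-a * nsq (x.2 - ξ x.1)) := by fun_prop
  refine (integrable_prod_iff hm.aestronglyMeasurable).2
    ⟨Filter.Eventually.of_forall fun p => integrable_exp_neg_nsq ha (ξ p), ?_⟩
  have : (fun p : Ω => ∫ z, ‖Real.exp (-a * nsq (z - ξ p))‖) = fun _ => (Real.pi / a) ^ n := by
    funext p
    rw [← integral_exp_neg_nsq ha (ξ p)]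
    exact integral_congr_ae (Filter.Eventually.of_forall fun z =>
      Real.norm_of_nonneg (Real.exp_pos _).le)
  exact this ▸ integrable_const _

section
variable {Ω : Type*} [MeasurableSpace Ω] {n : ℕ} (P : Measure Ω) [IsFiniteMeasure P]
  {ζ : Ω → Fin n → ℂ} {κ : Ω → ℂ}

lemma measurable_twist (hζ : Measurable ζ) (hκ : Measurable κ) (l : ℝ) {f : ℝ → ℂ}
    (hf : Measurable f) : Measurable (twist P ζ κ l f) := by
  have : Measurable (Function.uncurry fun (ω : Ω) (z : Fin n → ℂ) =>
      κ ω * (phase l z (ζ ω) * f (nsq (z - ζ ω)))) := by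
    unfold Function.uncurry
    fun_prop
  exact (this.stronglyMeasurable.integral_prod_left (μ := P)).measurable

lemma integrable_pair_of_le_exp (hζ : Measurable ζ) {a : ℝ} (ha : 0 < a)
    {k : Ω → (Fin n → ℂ) → ℂ} (mk : Measurable (Function.uncurry k))
    (bk : ∀ ω z, ‖k ω z‖ ≤ Real.exp (-a * nsq (z - ζ ω))) (bk1 : ∀ ω z, ‖k ω z‖ ≤ 1) :
    Integrable (fun x : (Ω × Ω) × (Fin n → ℂ) => k x.1.1 x.2 * (starRingEnd ℂ) (k x.1.2 x.2))
      ((P.prod P).prod volume) := by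
  have hz : Measurable fun p : Ω × Ω => ζ p.1 := hζ.comp measurable_fst
  refine (integrable_prod_exp_neg_nsq (P.prod P) ha hz).mono'
    (measurable_pair mk).aestronglyMeasurable (Filter.Eventually.of_forall fun x => ?_)
  rw [norm_mul, RCLike.norm_conj]
  exact (mul_le_of_le_one_right (norm_nonneg _) (bk1 _ _)).trans (bk _ _)

lemma gaussEnergy_le (hκ1 : ∀ ω, ‖κ ω‖ ≤ 1) (l : ℝ) {s : ℝ} (hs : 0 ≤ s) :
    gaussEnergy P ζ κ l s ≤ ENNReal.ofReal ((P.prod P).real Set.univ) := by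
  refine ENNReal.ofReal_le_ofReal ((Complex.re_le_norm _).trans ?_)
  refine (norm_integral_le_of_norm_le_const (C := 1) (Filter.Eventually.of_forall fun p => ?_)).trans
    (by simp)
  rw [norm_mul, norm_mul, norm_mul, norm_phase, RCLike.norm_conj, one_mul]
  exact mul_le_one₀ (mul_le_one₀ (hκ1 _) (norm_nonneg _) (hκ1 _)) (norm_nonneg _)
    (norm_cexp_neg_mul_nsq_le (by simpa using hs) _)

lemma lintegral_twist_gaussian (hζ : Measurable ζ) (hκ : Measurable κ) (hκ1 : ∀ ω, ‖κ ω‖ ≤ 1)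
    (l : ℝ) {α : ℂ} (hα : 0 < α.re) :
    ∫⁻ z, ‖twist P ζ κ l (fun r => cexp (-α * r)) z‖ₑ ^ 2 =
      ENNReal.ofReal ((Real.pi / (2 * α.re)) ^ n) *
        gaussEnergy P ζ κ l ((‖α‖ ^ 2 + (l / 4) ^ 2) / (2 * α.re)) := by
  let k : Ω → (Fin n → ℂ) → ℂ := fun ω z => κ ω * (phase l z (ζ ω) * cexp (-α * nsq (z - ζ ω)))
  have mk : Measurable (Function.uncurry k) := by
    unfold k Function.uncurry
    fun_prop
  have bk : ∀ ω z, ‖k ω z‖ ≤ Real.exp (-α.re * nsq (z - ζ ω)) := by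
    intro ω z
    rw [norm_mul, norm_mul, norm_phase, one_mul, norm_cexp_neg_mul_nsq]
    exact mul_le_of_le_one_left (Real.exp_pos _).le (hκ1 ω)
  have bk1 : ∀ ω z, ‖k ω z‖ ≤ 1 := by
    intro ω z
    rw [norm_mul, norm_mul, norm_phase, one_mul]
    exact mul_le_one₀ (hκ1 ω) (norm_nonneg _) (norm_cexp_neg_mul_nsq_le hα.le _)
  have hint : Integrable (fun x : (Ω × Ω) × (Fin n → ℂ) =>
      k x.1.1 x.2 * (starRingEnd ℂ) (k x.1.2 x.2)) ((P.prod P).prod volume) :=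
    integrable_pair_of_le_exp P hζ hα mk bk bk1
  have h := lintegral_sq_enorm_integral P volume k hint
  refine h.trans ?_
  rw [gaussEnergy, ← ENNReal.ofReal_mul (by positivity), ← Complex.re_ofReal_mul,
    ← integral_const_mul]
  congr 3
  funext p
  have e : ∀ z, k p.1 z * (starRingEnd ℂ) (k p.2 z) = κ p.1 * (starRingEnd ℂ) (κ p.2) *
      ((phase l z (ζ p.1) * cexp (-α * nsq (z - ζ p.1))) *
        (starRingEnd ℂ) (phase l z (ζ p.2) * cexp (-α * nsq (z - ζ p.2)))) := by
    intro z
    simp only [k, map_mul]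
    ring
  simp_rw [e]
  rw [integral_const_mul, integral_gaussian_pair l hα]
  push_cast
  ring

lemma twist_gaussian_eq_conv (hζ : Measurable ζ) (hκ : Measurable κ) (hκ1 : ∀ ω, ‖κ ω‖ ≤ 1)
    (l : ℝ) {c γ c₁ : ℝ} (hc : 0 < c) (hγ : 0 < γ) (hc₁ : c₁ * (c + γ) = c * γ + (l / 4) ^ 2)
    (w : Fin n → ℂ) :
    (Real.pi / (c + γ : ℝ) : ℂ) ^ n * twist P ζ κ l (fun r => cexp (-c₁ * r)) w =
      ∫ z, (phase l w z * cexp (-γ * nsq (w - z))) * twist P ζ κ l (fun r => cexp (-c * r)) z := by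
  simp only [twist]
  simp_rw [← integral_const_mul]
  rw [integral_integral_swap]
  · refine integral_congr_ae (Filter.Eventually.of_forall fun ω => ?_)
    simp only
    rw [mul_left_comm, ← integral_gaussian_twisted_conv l hc hγ hc₁, ← integral_const_mul]
    refine integral_congr_ae (Filter.Eventually.of_forall fun z => ?_)
    simp only
    ring
  · have hg : Integrable (fun x : (Fin n → ℂ) × Ω => Real.exp (-γ * nsq (x.1 - w)) * 1)
        (volume.prod P) := (integrable_exp_neg_nsq hγ w).mul_prod (integrable_const (1 : ℝ))
    refine hg.mono' ?_ (Filter.Eventually.of_forall fun x => ?_)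
    · refine Measurable.aestronglyMeasurable ?_
      unfold Function.uncurry
      fun_prop
    · simp only [Function.uncurry]
      rw [norm_mul, norm_mul, norm_mul, norm_mul, norm_phase, norm_phase, one_mul, one_mul,
        norm_cexp_neg_mul_nsq, nsq_sub_comm w]
      exact mul_le_mul_of_nonneg_left (mul_le_one₀ (hκ1 _) (norm_nonneg _)
        (norm_cexp_neg_mul_nsq_le (by simpa using hc.le) _)) (Real.exp_pos _).le

end

lemma sq_lintegral_mul_le {X : Type*} [MeasurableSpace X] (m : Measure X) {g f : X → ENNReal}
    (hg : Measurable g) (hf : Measurable f) :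
    (∫⁻ x, g x * f x ∂m) ^ 2 ≤ (∫⁻ x, g x ∂m) * ∫⁻ x, g x * f x ^ 2 ∂m := by
  have h := ENNReal.lintegral_mul_le_Lp_mul_Lq (m.withDensity g) Real.HolderConjugate.two_two
    (f := fun _ => 1) (g := f) aemeasurable_const hf.aemeasurable
  simp only [Pi.mul_apply, one_mul, ENNReal.rpow_two] at h
  rw [lintegral_withDensity_eq_lintegral_mul _ hg hf,
    lintegral_withDensity_eq_lintegral_mul _ hg (hf.pow_const 2),
    lintegral_withDensity_eq_lintegral_mul _ hg measurable_const] at h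
  simp only [Pi.mul_apply, one_pow, mul_one] at h
  calc (∫⁻ x, g x * f x ∂m) ^ 2
      ≤ ((∫⁻ x, g x ∂m) ^ (1 / 2 : ℝ) * (∫⁻ x, g x * f x ^ 2 ∂m) ^ (1 / 2 : ℝ)) ^ 2 := by gcongr
    _ = _ := by
      rw [mul_pow, ← ENNReal.rpow_two, ← ENNReal.rpow_two, ← ENNReal.rpow_mul, ← ENNReal.rpow_mul]
      norm_num

section
variable {Ω : Type*} [MeasurableSpace Ω] {n : ℕ} (P : Measure Ω) [IsFiniteMeasure P]
  {ζ : Ω → Fin n → ℂ} {κ : Ω → ℂ}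

lemma lintegral_twist_young (hζ : Measurable ζ) (hκ : Measurable κ) (hκ1 : ∀ ω, ‖κ ω‖ ≤ 1)
    (l : ℝ) {c γ c₁ : ℝ} (hc : 0 < c) (hγ : 0 < γ) (hc₁ : c₁ * (c + γ) = c * γ + (l / 4) ^ 2) :
    ENNReal.ofReal ((Real.pi / (c + γ)) ^ n) ^ 2 *
        ∫⁻ w, ‖twist P ζ κ l (fun r => cexp (-c₁ * r)) w‖ₑ ^ 2 ≤
      ENNReal.ofReal ((Real.pi / γ) ^ n) ^ 2 *
        ∫⁻ z, ‖twist P ζ κ l (fun r => cexp (-c * r)) z‖ₑ ^ 2 := by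
  set g : (Fin n → ℂ) → (Fin n → ℂ) → ENNReal :=
    fun w z => ENNReal.ofReal (Real.exp (-γ * nsq (w - z))) with hg
  set t : (Fin n → ℂ) → ENNReal := fun z => ‖twist P ζ κ l (fun r => cexp (-c * r)) z‖ₑ with ht
  have mt : Measurable t := (measurable_twist P hζ hκ l (by fun_prop)).enorm
  have hg1 : ∀ w, ∫⁻ z, g w z = ENNReal.ofReal ((Real.pi / γ) ^ n) := by
    intro w
    simp_rw [hg, nsq_sub_comm w]
    exact lintegral_exp_neg_nsq hγ w
  have hg2 : ∀ z, ∫⁻ w, g w z = ENNReal.ofReal ((Real.pi / γ) ^ n) := fun z =>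
    lintegral_exp_neg_nsq hγ z
  have key : ∀ w, ENNReal.ofReal ((Real.pi / (c + γ)) ^ n) ^ 2 *
      ‖twist P ζ κ l (fun r => cexp (-c₁ * r)) w‖ₑ ^ 2 ≤
      ENNReal.ofReal ((Real.pi / γ) ^ n) * ∫⁻ z, g w z * t z ^ 2 := by
    intro w
    have h := twist_gaussian_eq_conv P hζ hκ hκ1 l hc hγ hc₁ w
    have h1 : ENNReal.ofReal ((Real.pi / (c + γ)) ^ n) *
        ‖twist P ζ κ l (fun r => cexp (-c₁ * r)) w‖ₑ ≤ ∫⁻ z, g w z * t z := by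
      have h2 : ENNReal.ofReal ((Real.pi / (c + γ)) ^ n) = ‖(Real.pi / (c + γ : ℝ) : ℂ) ^ n‖ₑ := by
        rw [← ofReal_norm, norm_pow, ← Complex.ofReal_div, Complex.norm_real,
          Real.norm_of_nonneg (by positivity)]
      rw [h2, ← enorm_mul, h]
      refine (enorm_integral_le_lintegral_enorm _).trans (le_of_eq (lintegral_congr fun z => ?_))
      rw [enorm_mul, ht, hg]
      congr 1
      rw [← ofReal_norm, norm_mul, norm_phase, one_mul, norm_cexp_neg_mul_nsq, Complex.ofReal_re]
    rw [← mul_pow]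
    refine (pow_le_pow_left₀ zero_le h1 2).trans ?_
    rw [← hg1 w]
    exact sq_lintegral_mul_le _ (by simp only [hg]; fun_prop) mt
  calc _ = ∫⁻ w, ENNReal.ofReal ((Real.pi / (c + γ)) ^ n) ^ 2 *
        ‖twist P ζ κ l (fun r => cexp (-c₁ * r)) w‖ₑ ^ 2 :=
        (lintegral_const_mul' _ _ (by finiteness)).symm
    _ ≤ ∫⁻ w, ENNReal.ofReal ((Real.pi / γ) ^ n) * ∫⁻ z, g w z * t z ^ 2 := lintegral_mono key
    _ = ENNReal.ofReal ((Real.pi / γ) ^ n) * ∫⁻ z, ∫⁻ w, g w z * t z ^ 2 := by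
        rw [lintegral_const_mul' _ _ (by finiteness), lintegral_lintegral_swap]
        have : Measurable fun p : (Fin n → ℂ) × (Fin n → ℂ) => g p.1 p.2 * t p.2 ^ 2 := by
          refine Measurable.mul (by simp only [hg]; fun_prop) ((mt.comp measurable_snd).pow_const 2)
        exact this.aemeasurable
    _ = _ := by
        have : ∀ z, ∫⁻ w, g w z * t z ^ 2 = ENNReal.ofReal ((Real.pi / γ) ^ n) * t z ^ 2 := by
          intro z
          rw [lintegral_mul_const _ (by simp only [hg]; fun_prop), hg2]
        simp_rw [this]
        rw [lintegral_const_mul' _ _ (by finiteness), ← mul_assoc, sq]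

lemma gaussEnergy_mono_aux (hζ : Measurable ζ) (hκ : Measurable κ) (hκ1 : ∀ ω, ‖κ ω‖ ≤ 1)
    (l : ℝ) {c₁ c₂ : ℝ} (hc₁ : 0 < c₁) (hc : c₁ < c₂) (hl : 2 * (l / 4) ^ 2 ≤ c₁ * c₂) :
    gaussEnergy P ζ κ l ((c₁ ^ 2 + (l / 4) ^ 2) / (2 * c₁)) ≤
      ENNReal.ofReal ((4 * (c₂ / c₁)) ^ n) *
        gaussEnergy P ζ κ l ((c₂ ^ 2 + (l / 4) ^ 2) / (2 * c₂)) := by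
  have hc₂ : 0 < c₂ := hc₁.trans hc
  have hprod : 0 < c₁ * c₂ := by positivity
  have hd : 0 < c₁ * c₂ - (l / 4) ^ 2 := by nlinarith
  have hs : 0 < c₂ - c₁ := sub_pos.2 hc
  set γ : ℝ := (c₁ * c₂ - (l / 4) ^ 2) / (c₂ - c₁) with hγ
  have hγ0 : 0 < γ := by positivity
  have hrel : c₁ * (c₂ + γ) = c₂ * γ + (l / 4) ^ 2 := by
    rw [hγ]; field_simp; ring
  have h := lintegral_twist_young P hζ hκ hκ1 l hc₂ hγ0 hrel
  have e₁ := lintegral_twist_gaussian P hζ hκ hκ1 l (α := (c₁ : ℂ)) (by simpa using hc₁)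
  have e₂ := lintegral_twist_gaussian P hζ hκ hκ1 l (α := (c₂ : ℂ)) (by simpa using hc₂)
  simp only [Complex.ofReal_re, Complex.norm_real, Real.norm_eq_abs, sq_abs] at e₁ e₂
  rw [e₁, e₂, ← mul_assoc, ← mul_assoc, ← ENNReal.ofReal_pow (by positivity),
    ← ENNReal.ofReal_pow (by positivity), ← ENNReal.ofReal_mul (by positivity),
    ← ENNReal.ofReal_mul (by positivity)] at h
  set A : ℝ := ((Real.pi / (c₂ + γ)) ^ n) ^ 2 * (Real.pi / (2 * c₁)) ^ n with hA
  set B : ℝ := ((Real.pi / γ) ^ n) ^ 2 * (Real.pi / (2 * c₂)) ^ n with hB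
  have hA0 : 0 < A := by positivity
  have hBA : B ≤ A * (4 * (c₂ / c₁)) ^ n := by
    rw [hA, hB, pow_right_comm (Real.pi / γ) n 2,
      pow_right_comm (Real.pi / (c₂ + γ)) n 2, ← mul_pow, ← mul_pow, ← mul_pow]
    refine pow_le_pow_left₀ (by positivity) ?_ n
    have h1 : c₂ + γ ≤ 2 * (c₂ / c₁) * γ := by
      have : c₂ + γ = (c₂ ^ 2 - (l / 4) ^ 2) / (c₂ - c₁) := by rw [hγ]; field_simp; ring
      rw [this, hγ, ← mul_div_assoc]
      refine div_le_div_of_nonneg_right ?_ hs.le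
      rw [mul_div_assoc', div_mul_eq_mul_div, le_div_iff₀ hc₁]
      nlinarith [mul_nonneg hc₁.le (sq_nonneg (l / 4)), mul_nonneg hc₂.le (sub_nonneg.2 hl)]
    have h2 : (c₂ + γ) ^ 2 ≤ (2 * (c₂ / c₁) * γ) ^ 2 := pow_le_pow_left₀ (by positivity) h1 2
    have h3 : (Real.pi / (c₂ + γ)) ^ 2 * (Real.pi / (2 * c₁)) * (4 * (c₂ / c₁)) =
        (Real.pi ^ 3 / (2 * c₂)) * ((2 * (c₂ / c₁)) ^ 2 / (c₂ + γ) ^ 2) := by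
      field_simp; ring
    have h4 : (Real.pi / γ) ^ 2 * (Real.pi / (2 * c₂)) =
        (Real.pi ^ 3 / (2 * c₂)) * (1 / γ ^ 2) := by field_simp
    rw [h3, h4]
    refine mul_le_mul_of_nonneg_left ?_ (by positivity)
    rw [div_le_div_iff₀ (by positivity) (by positivity), one_mul, ← mul_pow]
    exact h2
  have hfin : ENNReal.ofReal A ≠ ⊤ := ENNReal.ofReal_ne_top
  have hne : ENNReal.ofReal A ≠ 0 := by simpa using hA0
  have h5 : ENNReal.ofReal A * gaussEnergy P ζ κ l ((c₁ ^ 2 + (l / 4) ^ 2) / (2 * c₁)) ≤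
      ENNReal.ofReal A * (ENNReal.ofReal ((4 * (c₂ / c₁)) ^ n) *
        gaussEnergy P ζ κ l ((c₂ ^ 2 + (l / 4) ^ 2) / (2 * c₂))) := by
    rw [← mul_assoc, ← ENNReal.ofReal_mul hA0.le]
    exact h.trans (mul_le_mul_left (ENNReal.ofReal_le_ofReal hBA) _)
  exact (ENNReal.mul_le_mul_iff_right hne hfin).1 h5

lemma gaussEnergy_mono (hζ : Measurable ζ) (hκ : Measurable κ) (hκ1 : ∀ ω, ‖κ ω‖ ≤ 1)
    {l : ℝ} (hl : |l| ≤ 1) {s₁ s₂ : ℝ} (hs₁ : 1 ≤ s₁) (hs : s₁ ≤ s₂) :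
    gaussEnergy P ζ κ l s₁ ≤ ENNReal.ofReal ((8 * (s₂ / s₁)) ^ n) * gaussEnergy P ζ κ l s₂ := by
  have hl2 : (l / 4) ^ 2 ≤ 1 / 16 := by
    have : l ^ 2 ≤ 1 := by rw [← sq_abs]; nlinarith [abs_nonneg l]
    nlinarith
  have hex : ∀ s : ℝ, 1 ≤ s → ∃ c : ℝ, s ≤ c ∧ c ≤ 2 * s ∧ (c ^ 2 + (l / 4) ^ 2) / (2 * c) = s := by
    intro s hs
    have h0 : 0 ≤ s ^ 2 - (l / 4) ^ 2 := by nlinarith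
    have h1 : √(s ^ 2 - (l / 4) ^ 2) ≤ s := by
      rw [Real.sqrt_le_left (by linarith)]; nlinarith [sq_nonneg (l / 4)]
    refine ⟨s + √(s ^ 2 - (l / 4) ^ 2), by linarith [Real.sqrt_nonneg (s ^ 2 - (l / 4) ^ 2)],
      by linarith, ?_⟩
    rw [div_eq_iff (by positivity)]
    nlinarith [Real.sq_sqrt h0]
  obtain ⟨c₁, h₁, h₁', e₁⟩ := hex s₁ hs₁
  obtain ⟨c₂, h₂, h₂', e₂⟩ := hex s₂ (hs₁.trans hs)
  rcases lt_or_ge c₁ c₂ with h | h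
  · have := gaussEnergy_mono_aux P hζ hκ hκ1 l (by linarith) h (by nlinarith)
    rw [e₁, e₂] at this
    refine this.trans (mul_le_mul_left (ENNReal.ofReal_le_ofReal ?_) _)
    refine pow_le_pow_left₀ (mul_nonneg (by norm_num)
      (div_nonneg (by linarith) (by linarith))) ?_ n
    have : c₂ / c₁ ≤ 2 * s₂ / s₁ := div_le_div₀ (by linarith) h₂' (by linarith) h₁
    rw [mul_div_assoc] at this
    linarith
  · have : s₂ = s₁ := by
      refine le_antisymm ?_ hs
      rw [← e₁, ← e₂, div_le_div_iff₀ (by linarith) (by linarith)]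
      nlinarith [mul_nonneg (sub_nonneg.2 h) (by nlinarith : 0 ≤ c₁ * c₂ - (l / 4) ^ 2)]
    rw [this, div_self (by linarith)]
    refine le_mul_of_one_le_left zero_le ?_
    rw [ENNReal.one_le_ofReal]
    exact one_le_pow₀ (by norm_num)

end

/-! ### Energy of the radial shells -/

/-- The energy of the twisted superposition of indicators of balls of squared radius `A`. -/
def shellEnergy {Ω : Type*} [MeasurableSpace Ω] {n : ℕ} (P : Measure Ω) (ζ : Ω → Fin n → ℂ)
    (κ : Ω → ℂ) (l A : ℝ) : ENNReal :=
  ∫⁻ z, ‖twist P ζ κ l ((Set.Iic A).indicator fun _ => 1) z‖ₑ ^ 2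

lemma measurable_twist_param {Ω X : Type*} [MeasurableSpace Ω] [MeasurableSpace X] {n : ℕ}
    (P : Measure Ω) [SFinite P] {ζ : Ω → Fin n → ℂ} (hζ : Measurable ζ) {κ : X → Ω → ℂ}
    (hκ : Measurable (Function.uncurry κ)) {l : X → ℝ} (hl : Measurable l) {f : X → ℝ → ℂ}
    (hf : Measurable (Function.uncurry f)) :
    Measurable fun p : X × (Fin n → ℂ) => twist P ζ (κ p.1) (l p.1) (f p.1) p.2 := by
  have h1 : Measurable fun q : (X × (Fin n → ℂ)) × Ω => κ q.1.1 q.2 :=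
    hκ.comp (f := fun q : (X × (Fin n → ℂ)) × Ω => (q.1.1, q.2)) (by fun_prop)
  have h2 : Measurable fun q : (X × (Fin n → ℂ)) × Ω => f q.1.1 (nsq (q.1.2 - ζ q.2)) :=
    hf.comp (f := fun q : (X × (Fin n → ℂ)) × Ω => (q.1.1, nsq (q.1.2 - ζ q.2))) (by fun_prop)
  have h3 : Measurable (Function.uncurry fun (p : X × (Fin n → ℂ)) (ω : Ω) =>
      κ p.1 ω * (phase (l p.1) p.2 (ζ ω) * f p.1 (nsq (p.2 - ζ ω)))) := by
    unfold Function.uncurry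
    fun_prop
  exact (h3.stronglyMeasurable.integral_prod_right (ν := P)).measurable

lemma measurable_indicator_Iic : Measurable (Function.uncurry fun (A : ℝ) (r : ℝ) =>
    (Set.Iic A).indicator (fun _ => (1 : ℂ)) r) := by
  exact (measurable_const (a := (1 : ℂ))).indicator
    (measurableSet_le (measurable_snd (α := ℝ) (β := ℝ)) measurable_fst)

lemma setLIntegral_comp_affine_le (h : ℝ → ENNReal) {ρ d : ℝ} (hρ : 0 < ρ) (hd : 0 ≤ d) :
    ∫⁻ b in Set.Ioi 0, h (ρ * b + d) ≤ ENNReal.ofReal ρ⁻¹ * ∫⁻ b in Set.Ioi 0, h b := by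
  have e := lintegral_image_eq_lintegral_abs_deriv_mul (s := Set.Ioi 0)
    (f := fun b => ρ * b + d) (f' := fun _ => ρ) measurableSet_Ioi
    (fun x _ => by
      simpa using (((hasDerivAt_id x).const_mul ρ).add_const d).hasDerivWithinAt)
    (fun x _ y _ hxy => by simpa [hρ.ne'] using hxy) h
  rw [lintegral_const_mul' _ _ (by finiteness), abs_of_pos hρ] at e
  have e2 : ∫⁻ b in Set.Ioi 0, h (ρ * b + d) = ENNReal.ofReal ρ⁻¹ *
      ∫⁻ x in (fun b => ρ * b + d) '' Set.Ioi 0, h x := by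
    rw [e, ← mul_assoc, ← ENNReal.ofReal_mul (by positivity), inv_mul_cancel₀ hρ.ne',
      ENNReal.ofReal_one, one_mul]
  rw [e2]
  refine mul_le_mul_right (lintegral_mono_set ?_) _
  rintro _ ⟨b, hb, rfl⟩
  have : 0 < ρ * b := mul_pos hρ hb
  simp only [Set.mem_Ioi]
  linarith

lemma lintegral_even (h : ℝ → ENNReal) (he : ∀ b, h (-b) = h b) :
    ∫⁻ b, h b = 2 * ∫⁻ b in Set.Ioi 0, h b := by
  have e := lintegral_image_eq_lintegral_abs_deriv_mul (s := Set.Ioi 0)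
    (f := fun b => -b) (f' := fun _ => -1) measurableSet_Ioi
    (fun x _ => (hasDerivAt_neg x).hasDerivWithinAt)
    (fun x _ y _ hxy => by simpa using hxy) h
  simp only [abs_neg, abs_one, ENNReal.ofReal_one, one_mul, he, Set.image_neg_eq_neg, Set.neg_Ioi,
    neg_zero] at e
  have h1 := lintegral_add_compl h (measurableSet_Ioi (a := (0 : ℝ))) (μ := volume)
  rw [Set.compl_Ioi, setLIntegral_congr Iio_ae_eq_Iic.symm, e] at h1
  rw [← h1, two_mul]

section
variable {Ω : Type*} [MeasurableSpace Ω] {n : ℕ} (P : Measure Ω) [IsFiniteMeasure P]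
  {ζ : Ω → Fin n → ℂ} {κ : Ω → ℂ}

/-- The Laplace transform of the shell energy. -/
def shellLaplace {Ω : Type*} [MeasurableSpace Ω] {n : ℕ} (P : Measure Ω) (ζ : Ω → Fin n → ℂ)
    (κ : Ω → ℂ) (l a : ℝ) : ENNReal :=
  ∫⁻ A in Set.Ioi 0, ENNReal.ofReal (Real.exp (-(2 * a) * A)) * shellEnergy P ζ κ l A

/-- The spectral side of the Laplace transform of the shell energy. -/
def spectralIntegral {Ω : Type*} [MeasurableSpace Ω] {n : ℕ} (P : Measure Ω) (ζ : Ω → Fin n → ℂ)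
    (κ : Ω → ℂ) (l a : ℝ) : ENNReal :=
  ∫⁻ b in Set.Ioi 0, ENNReal.ofReal (a ^ 2 + b ^ 2)⁻¹ *
    gaussEnergy P ζ κ l ((a ^ 2 + b ^ 2 + (l / 4) ^ 2) / (2 * a))

lemma measurable_shellEnergy (hζ : Measurable ζ) (hκ : Measurable κ) (l : ℝ) :
    Measurable (shellEnergy P ζ κ l) :=
  (((measurable_twist_param P hζ (κ := fun _ => κ) (l := fun _ => l) (hκ.comp measurable_snd)
    measurable_const measurable_indicator_Iic).enorm.pow_const 2).lintegral_prod_right')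

lemma shellLaplace_eq (hζ : Measurable ζ) (hκ : Measurable κ) (hκ1 : ∀ ω, ‖κ ω‖ ≤ 1)
    (l : ℝ) {a : ℝ} (ha : 0 < a) :
    shellLaplace P ζ κ l a = ENNReal.ofReal (Real.pi⁻¹ * (Real.pi / (2 * a)) ^ n) *
      spectralIntegral P ζ κ l a := by
  have mA : Measurable fun p : ℝ × (Fin n → ℂ) => ENNReal.ofReal (Real.exp (-(2 * a) * p.1)) *
      ‖twist P ζ κ l ((Set.Iic p.1).indicator fun _ => 1) p.2‖ₑ ^ 2 := by
    have h1 : Measurable fun p : ℝ × (Fin n → ℂ) =>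
      ENNReal.ofReal (Real.exp (-(2 * a) * p.1)) := by fun_prop
    exact h1.mul ((measurable_twist_param P hζ (κ := fun _ => κ) (l := fun _ => l)
      (hκ.comp measurable_snd) measurable_const measurable_indicator_Iic).enorm.pow_const 2)
  have mb : Measurable fun p : ℝ × (Fin n → ℂ) =>
      ENNReal.ofReal ((2 * Real.pi)⁻¹ * (a ^ 2 + p.1 ^ 2)⁻¹) *
      ‖twist P ζ κ l (fun r => cexp (-(a + p.1 * I) * r)) p.2‖ₑ ^ 2 := by
    have h1 : Measurable fun p : ℝ × (Fin n → ℂ) =>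
      ENNReal.ofReal ((2 * Real.pi)⁻¹ * (a ^ 2 + p.1 ^ 2)⁻¹) := by fun_prop
    exact h1.mul ((measurable_twist_param P hζ (κ := fun _ => κ) (l := fun _ => l)
      (f := fun (b : ℝ) (r : ℝ) => cexp (-(a + b * I) * r)) (hκ.comp measurable_snd)
      measurable_const (by unfold Function.uncurry; fun_prop)).enorm.pow_const 2)
  have hz : ∀ z : Fin n → ℂ, ∫⁻ A in Set.Ioi 0, ENNReal.ofReal (Real.exp (-(2 * a) * A)) *
      ‖twist P ζ κ l ((Set.Iic A).indicator fun _ => 1) z‖ₑ ^ 2 =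
      ∫⁻ b : ℝ, ENNReal.ofReal ((2 * Real.pi)⁻¹ * (a ^ 2 + b ^ 2)⁻¹) *
        ‖twist P ζ κ l (fun r => cexp (-(a + b * I) * r)) z‖ₑ ^ 2 := by
    intro z
    have h := laplace_plancherel P (fun ω => κ ω * phase l z (ζ ω)) (by fun_prop)
      (fun ω => by rw [norm_mul, norm_phase, mul_one]; exact hκ1 ω)
      (fun ω => nsq (z - ζ ω)) (by fun_prop) (fun ω => nsq_nonneg _) ha
    simp only [mul_assoc] at h
    exact h
  have e1 : shellLaplace P ζ κ l a = ∫⁻ b : ℝ,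
      ENNReal.ofReal ((2 * Real.pi)⁻¹ * (a ^ 2 + b ^ 2)⁻¹) *
        ∫⁻ z, ‖twist P ζ κ l (fun r => cexp (-(a + b * I) * r)) z‖ₑ ^ 2 := by
    calc shellLaplace P ζ κ l a = ∫⁻ A in Set.Ioi 0, ∫⁻ z,
          ENNReal.ofReal (Real.exp (-(2 * a) * A)) *
          ‖twist P ζ κ l ((Set.Iic A).indicator fun _ => 1) z‖ₑ ^ 2 :=
        lintegral_congr fun A => (lintegral_const_mul' _ _ (by finiteness)).symm
      _ = ∫⁻ z, ∫⁻ A in Set.Ioi 0, ENNReal.ofReal (Real.exp (-(2 * a) * A)) *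
          ‖twist P ζ κ l ((Set.Iic A).indicator fun _ => 1) z‖ₑ ^ 2 :=
        lintegral_lintegral_swap mA.aemeasurable
      _ = ∫⁻ z, ∫⁻ b : ℝ, ENNReal.ofReal ((2 * Real.pi)⁻¹ * (a ^ 2 + b ^ 2)⁻¹) *
          ‖twist P ζ κ l (fun r => cexp (-(a + b * I) * r)) z‖ₑ ^ 2 := lintegral_congr hz
      _ = ∫⁻ b : ℝ, ∫⁻ z, ENNReal.ofReal ((2 * Real.pi)⁻¹ * (a ^ 2 + b ^ 2)⁻¹) *
          ‖twist P ζ κ l (fun r => cexp (-(a + b * I) * r)) z‖ₑ ^ 2 :=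
        (lintegral_lintegral_swap mb.aemeasurable).symm
      _ = _ := lintegral_congr fun b => lintegral_const_mul' _ _ (by finiteness)
  have e2 : ∀ b : ℝ, ENNReal.ofReal ((2 * Real.pi)⁻¹ * (a ^ 2 + b ^ 2)⁻¹) *
        ∫⁻ z, ‖twist P ζ κ l (fun r => cexp (-(a + b * I) * r)) z‖ₑ ^ 2 =
      ENNReal.ofReal ((2 * Real.pi)⁻¹ * (Real.pi / (2 * a)) ^ n) *
        (ENNReal.ofReal (a ^ 2 + b ^ 2)⁻¹ *
          gaussEnergy P ζ κ l ((a ^ 2 + b ^ 2 + (l / 4) ^ 2) / (2 * a))) := by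
    intro b
    have hn : ‖(a + b * I : ℂ)‖ ^ 2 = a ^ 2 + b ^ 2 := by
      rw [← Complex.normSq_eq_norm_sq, Complex.normSq_add_mul_I]
    have hre : (a + b * I : ℂ).re = a := by simp
    rw [lintegral_twist_gaussian P hζ hκ hκ1 l (by rw [hre]; exact ha), hn, hre, ← mul_assoc,
      ← mul_assoc, ← ENNReal.ofReal_mul (by positivity), ← ENNReal.ofReal_mul (by positivity)]
    congr 2
    ring
  rw [e1]
  simp_rw [e2]
  rw [lintegral_const_mul' _ _ (by finiteness), lintegral_even _ (fun b => by simp),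
    spectralIntegral, ← mul_assoc]
  congr 1
  rw [← ENNReal.ofReal_ofNat, ← ENNReal.ofReal_mul (by positivity)]
  congr 1
  field_simp

lemma spectralIntegral_comparison (hζ : Measurable ζ) (hκ : Measurable κ)
    (hκ1 : ∀ ω, ‖κ ω‖ ≤ 1) {l : ℝ} (hl : |l| ≤ 1) {a r : ℝ} (ha : 2 ≤ a) (hr : 0 < r)
    (hr2 : r ≤ 2) (hra : 1 ≤ r * a) :
    spectralIntegral P ζ κ l a ≤ ENNReal.ofReal (96 ^ n * 10 * √r) *
      spectralIntegral P ζ κ l (r * a) := by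
  have hl2 : (l / 4) ^ 2 ≤ 1 / 16 := by
    have : l ^ 2 ≤ 1 := by rw [← sq_abs]; nlinarith [abs_nonneg l]
    nlinarith
  have hβ := sq_nonneg (l / 4)
  have hsr : √r ^ 2 = r := Real.sq_sqrt hr.le
  have hsr0 : 0 < √r := Real.sqrt_pos.2 hr
  set h : ℝ → ENNReal := fun b => ENNReal.ofReal ((r * a) ^ 2 + b ^ 2)⁻¹ *
    gaussEnergy P ζ κ l (((r * a) ^ 2 + b ^ 2 + (l / 4) ^ 2) / (2 * (r * a))) with hh
  have key : ∀ b ∈ Set.Ioi (0 : ℝ), ENNReal.ofReal (a ^ 2 + b ^ 2)⁻¹ *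
      gaussEnergy P ζ κ l ((a ^ 2 + b ^ 2 + (l / 4) ^ 2) / (2 * a)) ≤
      ENNReal.ofReal (96 ^ n * (10 * r)) * h (√r * b + √r * (2 * a)) := by
    intro b hb
    have hb : 0 < b := hb
    have hsq : (√r * b + √r * (2 * a)) ^ 2 = r * (b + 2 * a) ^ 2 := by
      rw [← mul_add, mul_pow, hsr]
    simp only [hh]
    rw [hsq]
    set s₁ := (a ^ 2 + b ^ 2 + (l / 4) ^ 2) / (2 * a) with hs₁
    set s₂ := ((r * a) ^ 2 + r * (b + 2 * a) ^ 2 + (l / 4) ^ 2) / (2 * (r * a)) with hs₂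
    have h1 : 1 ≤ s₁ := by
      rw [hs₁, le_div_iff₀ (by positivity)]; nlinarith
    have h2 : s₁ ≤ s₂ := by
      rw [hs₁, hs₂, div_le_div_iff₀ (by positivity) (by positivity)]
      have : (a ^ 2 + b ^ 2 + (l / 4) ^ 2) ≤ (b + 2 * a) ^ 2 := by nlinarith
      have h3 : (a ^ 2 + b ^ 2 + (l / 4) ^ 2) * r ≤
          (r * a) ^ 2 + r * (b + 2 * a) ^ 2 + (l / 4) ^ 2 := by nlinarith [sq_nonneg (r * a)]
      nlinarith
    have h3 : s₂ ≤ 12 * s₁ := by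
      have e : 12 * ((a ^ 2 + b ^ 2 + (l / 4) ^ 2) / (2 * a)) * (2 * (r * a)) =
          12 * r * (a ^ 2 + b ^ 2 + (l / 4) ^ 2) := by field_simp
      rw [hs₁, hs₂, div_le_iff₀ (by positivity), e]
      have e1 : (r * a) ^ 2 ≤ r * (2 * a ^ 2) := by
        nlinarith [mul_nonneg (mul_nonneg hr.le (sq_nonneg a)) (sub_nonneg.2 hr2)]
      have e2 : r * (b + 2 * a) ^ 2 ≤ r * (2 * b ^ 2 + 8 * a ^ 2) :=
        mul_le_mul_of_nonneg_left (by nlinarith [sq_nonneg (b - 2 * a)]) hr.le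
      have e3 : (l / 4) ^ 2 ≤ r * a ^ 2 := by nlinarith
      nlinarith [mul_nonneg hr.le hβ, mul_nonneg hr.le (sq_nonneg b)]
    have h4 := gaussEnergy_mono P hζ hκ hκ1 hl h1 h2
    have h5 : ENNReal.ofReal ((8 * (s₂ / s₁)) ^ n) ≤ ENNReal.ofReal (96 ^ n) := by
      refine ENNReal.ofReal_le_ofReal (pow_le_pow_left₀ ?_ ?_ n)
      · exact mul_nonneg (by norm_num) (div_nonneg (by linarith) (by linarith))
      · have : s₂ / s₁ ≤ 12 := by rw [div_le_iff₀ (by linarith)]; exact h3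
        linarith
    have h6 : (a ^ 2 + b ^ 2)⁻¹ ≤ (10 * r) * ((r * a) ^ 2 + r * (b + 2 * a) ^ 2)⁻¹ := by
      rw [← div_eq_mul_inv, inv_eq_one_div, div_le_div_iff₀ (by positivity) (by positivity)]
      have : (r * a) ^ 2 ≤ r * (2 * a ^ 2) := by nlinarith [sq_nonneg a, mul_nonneg hr.le (sq_nonneg a)]
      nlinarith [sq_nonneg (b - 2 * a), mul_nonneg hr.le (sq_nonneg (b - 2 * a))]
    calc _ ≤ ENNReal.ofReal ((10 * r) * ((r * a) ^ 2 + r * (b + 2 * a) ^ 2)⁻¹) *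
          (ENNReal.ofReal (96 ^ n) * gaussEnergy P ζ κ l s₂) :=
          mul_le_mul' (ENNReal.ofReal_le_ofReal h6) (h4.trans (mul_le_mul_left h5 _))
      _ = _ := by
          rw [ENNReal.ofReal_mul (by positivity : 0 ≤ 10 * r),
            ENNReal.ofReal_mul (by positivity : (0 : ℝ) ≤ 96 ^ n)]
          ring
  calc spectralIntegral P ζ κ l a ≤
        ∫⁻ b in Set.Ioi 0, ENNReal.ofReal (96 ^ n * (10 * r)) * h (√r * b + √r * (2 * a)) :=
        setLIntegral_mono' measurableSet_Ioi key
    _ = ENNReal.ofReal (96 ^ n * (10 * r)) * ∫⁻ b in Set.Ioi 0, h (√r * b + √r * (2 * a)) :=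
        lintegral_const_mul' _ _ (by finiteness)
    _ ≤ ENNReal.ofReal (96 ^ n * (10 * r)) * (ENNReal.ofReal (√r)⁻¹ * ∫⁻ b in Set.Ioi 0, h b) :=
        mul_le_mul_right (setLIntegral_comp_affine_le h hsr0 (by positivity)) _
    _ = _ := by
        rw [← mul_assoc, ← ENNReal.ofReal_mul (by positivity)]
        congr 2
        nth_rewrite 1 [← hsr]
        field_simp

end

section
variable {Ω : Type*} [MeasurableSpace Ω] {n : ℕ} (P : Measure Ω) [IsFiniteMeasure P]
  {ζ : Ω → Fin n → ℂ} {κ : Ω → ℂ}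

lemma shellLaplace_ne_top (hζ : Measurable ζ) (hκ : Measurable κ) (hκ1 : ∀ ω, ‖κ ω‖ ≤ 1)
    (l : ℝ) {a : ℝ} (ha : 0 < a) : shellLaplace P ζ κ l a ≠ ⊤ := by
  rw [shellLaplace_eq P hζ hκ hκ1 l ha]
  refine ENNReal.mul_ne_top (by finiteness) (ne_top_of_le_ne_top ?_ (lintegral_mono fun b =>
    mul_le_mul_right (gaussEnergy_le P hκ1 l (by positivity)) _))
  rw [lintegral_mul_const' _ _ (by finiteness)]
  refine ENNReal.mul_ne_top ?_ (by finiteness)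
  exact (ne_top_of_le_ne_top (integrable_inv_add_sq ha).lintegral_lt_top.ne
    (setLIntegral_le_lintegral _ _))

lemma shellLaplace_comparison (hζ : Measurable ζ) (hκ : Measurable κ)
    (hκ1 : ∀ ω, ‖κ ω‖ ≤ 1) {l : ℝ} (hl : |l| ≤ 1) {a r : ℝ} (ha : 2 ≤ a) (hr : 0 < r)
    (hr2 : r ≤ 2) (hra : 1 ≤ r * a) :
    shellLaplace P ζ κ l a ≤ ENNReal.ofReal (96 ^ n * 10 * √r * r ^ n) *
      shellLaplace P ζ κ l (r * a) := by
  have ha0 : 0 < a := by linarith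
  rw [shellLaplace_eq P hζ hκ hκ1 l ha0, shellLaplace_eq P hζ hκ hκ1 l (mul_pos hr ha0),
    ← mul_assoc, ← ENNReal.ofReal_mul (by positivity)]
  refine (mul_le_mul_right (spectralIntegral_comparison P hζ hκ hκ1 hl ha hr hr2 hra) _).trans ?_
  rw [← mul_assoc, ← ENNReal.ofReal_mul (by positivity)]
  refine mul_le_mul_left (ENNReal.ofReal_le_ofReal (le_of_eq ?_)) _
  have : Real.pi / (2 * a) = r * (Real.pi / (2 * (r * a))) := by field_simp
  rw [this, mul_pow]
  ring

lemma shellLaplace_le_split (hζ : Measurable ζ) (hκ : Measurable κ) (l : ℝ) {a m : ℝ}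
    (ha : 0 < a) (hm : 0 < m) :
    shellLaplace P ζ κ l a ≤ ENNReal.ofReal (Real.exp 1) * shellLaplace P ζ κ l (m * a) +
      (∫⁻ A in Set.Ioc (2 * m * a)⁻¹ 1, shellEnergy P ζ κ l A) +
      ENNReal.ofReal (Real.exp (-a)) * shellLaplace P ζ κ l (2⁻¹ * a) := by
  have mX := measurable_shellEnergy P hζ hκ l
  set X := shellEnergy P ζ κ l with hX
  have key : ∀ A ∈ Set.Ioi (0 : ℝ), ENNReal.ofReal (Real.exp (-(2 * a) * A)) * X A ≤
      ENNReal.ofReal (Real.exp 1) * (ENNReal.ofReal (Real.exp (-(2 * (m * a)) * A)) * X A) +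
      (Set.Ioc (2 * m * a)⁻¹ 1).indicator X A +
      ENNReal.ofReal (Real.exp (-a)) *
        (ENNReal.ofReal (Real.exp (-(2 * (2⁻¹ * a)) * A)) * X A) := by
    intro A hA
    have hA : 0 < A := hA
    rw [← mul_assoc (ENNReal.ofReal _), ← mul_assoc (ENNReal.ofReal (Real.exp (-a))),
      ← ENNReal.ofReal_mul (Real.exp_pos _).le, ← ENNReal.ofReal_mul (Real.exp_pos _).le, ← Real.exp_add, ← Real.exp_add]
    rcases le_or_gt A (2 * m * a)⁻¹ with h | h
    · refine le_trans ?_ (le_self_add.trans le_self_add)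
      refine mul_le_mul_left (ENNReal.ofReal_le_ofReal (Real.exp_le_exp.2 ?_)) _
      rw [le_inv_comm₀ hA (by positivity), ← one_div, le_div_iff₀ hA] at h
      nlinarith [mul_pos ha hA]
    · rcases le_or_gt A 1 with h1 | h1
      · rw [Set.indicator_of_mem (Set.mem_Ioc.2 ⟨h, h1⟩)]
        refine le_trans ?_ (le_add_self.trans le_self_add)
        refine mul_le_of_le_one_left zero_le (ENNReal.ofReal_le_one.2 (Real.exp_le_one_iff.2 ?_))
        nlinarith [mul_pos ha hA]
      · refine le_trans ?_ le_add_self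
        refine mul_le_mul_left (ENNReal.ofReal_le_ofReal (Real.exp_le_exp.2 ?_)) _
        nlinarith
  refine (setLIntegral_mono' measurableSet_Ioi key).trans ?_
  rw [lintegral_add_right _ (by fun_prop), lintegral_add_right _
    (mX.indicator measurableSet_Ioc), lintegral_const_mul' _ _ (by finiteness),
    lintegral_const_mul' _ _ (by finiteness)]
  refine add_le_add (add_le_add le_rfl ?_) le_rfl
  exact (setLIntegral_le_lintegral _ _).trans_eq (lintegral_indicator measurableSet_Ioc _)

lemma gaussEnergy_le_spectralIntegral (hζ : Measurable ζ) (hκ : Measurable κ)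
    (hκ1 : ∀ ω, ‖κ ω‖ ≤ 1) {l : ℝ} (hl : |l| ≤ 1) {a B : ℝ} (ha : 1 ≤ a) (hB : 1 ≤ B) :
    ENNReal.ofReal (2 / (17 * a * B)) * gaussEnergy P ζ κ l (B ^ 2) ≤
      ENNReal.ofReal ((72 * a) ^ n) * spectralIntegral P ζ κ l a := by
  have ha0 : 0 < a := by linarith
  have hB0 : 0 < B := by linarith
  have hl2 : (l / 4) ^ 2 ≤ 1 / 16 := by
    have : l ^ 2 ≤ 1 := by rw [← sq_abs]; nlinarith [abs_nonneg l]
    nlinarith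
  have hβ := sq_nonneg (l / 4)
  have hab : 1 ≤ a * B := by nlinarith
  have key : ∀ b ∈ Set.Ioc (2 * a * B) (4 * a * B),
      ENNReal.ofReal (17 * a ^ 2 * B ^ 2)⁻¹ * gaussEnergy P ζ κ l (B ^ 2) ≤
      ENNReal.ofReal ((72 * a) ^ n) * (ENNReal.ofReal (a ^ 2 + b ^ 2)⁻¹ *
        gaussEnergy P ζ κ l ((a ^ 2 + b ^ 2 + (l / 4) ^ 2) / (2 * a))) := by
    intro b hb
    have hb0 : 0 < b := lt_trans (by positivity) hb.1
    have hb1 : (2 * a * B) ^ 2 ≤ b ^ 2 := pow_le_pow_left₀ (by positivity) hb.1.le 2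
    have hb2 : b ^ 2 ≤ (4 * a * B) ^ 2 := pow_le_pow_left₀ hb0.le hb.2 2
    set s := (a ^ 2 + b ^ 2 + (l / 4) ^ 2) / (2 * a) with hs
    have haB : a ^ 2 ≤ a ^ 2 * B ^ 2 := le_mul_of_one_le_right (by positivity) (by nlinarith)
    have hab2 : 1 ≤ a ^ 2 * B ^ 2 := by nlinarith
    have h1 : B ^ 2 ≤ s := by
      rw [hs, le_div_iff₀ (by positivity)]
      nlinarith [mul_le_mul_of_nonneg_right ha (by positivity : 0 ≤ a * B ^ 2)]
    have h2 : s ≤ 9 * a * B ^ 2 := by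
      rw [hs, div_le_iff₀ (by positivity)]
      nlinarith
    have h3 := gaussEnergy_mono P hζ hκ hκ1 hl (by nlinarith : 1 ≤ B ^ 2) h1
    have h4 : (8 * (s / B ^ 2)) ^ n ≤ (72 * a) ^ n := by
      refine pow_le_pow_left₀ (by positivity) ?_ n
      have : s / B ^ 2 ≤ 9 * a := by rw [div_le_iff₀ (by positivity)]; exact h2
      linarith
    rw [mul_left_comm]
    refine mul_le_mul' (ENNReal.ofReal_le_ofReal (inv_anti₀ (by positivity) (by nlinarith)))
      (h3.trans (mul_le_mul_left (ENNReal.ofReal_le_ofReal h4) _))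
  calc ENNReal.ofReal (2 / (17 * a * B)) * gaussEnergy P ζ κ l (B ^ 2)
      = ∫⁻ b in Set.Ioc (2 * a * B) (4 * a * B),
          ENNReal.ofReal (17 * a ^ 2 * B ^ 2)⁻¹ * gaussEnergy P ζ κ l (B ^ 2) := by
        rw [setLIntegral_const, Real.volume_Ioc, mul_right_comm (ENNReal.ofReal _),
          ← ENNReal.ofReal_mul (by positivity)]
        congr 2
        field_simp
        norm_num
    _ ≤ ∫⁻ b in Set.Ioc (2 * a * B) (4 * a * B),
          ENNReal.ofReal ((72 * a) ^ n) * (ENNReal.ofReal (a ^ 2 + b ^ 2)⁻¹ *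
        gaussEnergy P ζ κ l ((a ^ 2 + b ^ 2 + (l / 4) ^ 2) / (2 * a))) :=
        setLIntegral_mono' measurableSet_Ioc key
    _ ≤ _ := by
        rw [lintegral_const_mul' _ _ (by finiteness)]
        refine mul_le_mul_right (lintegral_mono_set fun b hb => ?_) _
        exact lt_trans (by positivity : 0 < 2 * a * B) hb.1

/-- The part of the shell energy at squared radii in a fixed window controls the Gaussian
energy at every scale. -/
lemma exists_gaussEnergy_le_shellEnergy (n : ℕ) : ∃ c > (0 : ℝ), ∃ δ ∈ Set.Ioo (0 : ℝ) 1,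
    ∀ {Ω : Type} [MeasurableSpace Ω] (P : Measure Ω) [IsFiniteMeasure P] (ζ : Ω → Fin n → ℂ)
      (κ : Ω → ℂ), Measurable ζ → Measurable κ → (∀ ω, ‖κ ω‖ ≤ 1) → ∀ l : ℝ, |l| ≤ 1 →
      ∀ B : ℝ, 1 ≤ B → ENNReal.ofReal (c / B) * gaussEnergy P ζ κ l (B ^ 2) ≤
        ∫⁻ A in Set.Ioc δ 1, shellEnergy P ζ κ l A := by
  obtain ⟨K, hK⟩ : ∃ K : ℝ, K = 96 ^ n * 10 := ⟨_, rfl⟩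
  have hK1 : 10 ≤ K := by
    have : (1 : ℝ) ≤ 96 ^ n := one_le_pow₀ (by norm_num)
    linarith
  obtain ⟨a, ha⟩ : ∃ a : ℝ, a = 4 * (K * √2 * 2 ^ n) := ⟨_, rfl⟩
  have h2n : (1 : ℝ) ≤ 2 ^ n := one_le_pow₀ (by norm_num)
  have hs2 : 1 ≤ √2 := Real.one_le_sqrt.2 (by norm_num)
  have hM : 10 ≤ K * √2 * 2 ^ n := by
    have : 10 ≤ K * √2 := by nlinarith
    nlinarith
  have ha40 : 40 ≤ a := by linarith
  have ha0 : 0 < a := by linarith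
  obtain ⟨m', hm'⟩ : ∃ m' : ℝ, m' = 4 * Real.exp 1 * K := ⟨_, rfl⟩
  have he : 1 ≤ Real.exp 1 := Real.one_le_exp (by norm_num)
  have hm40 : 40 ≤ m' := by nlinarith
  have hm0 : 0 < m' := by linarith
  have hδ0 : 0 < (2 * m' ^ 2 * a)⁻¹ := by positivity
  have hδ1 : (2 * m' ^ 2 * a)⁻¹ < 1 := inv_lt_one_of_one_lt₀ (by nlinarith [sq_nonneg m'])
  refine ⟨2⁻¹ * (Real.pi⁻¹ * (Real.pi / (2 * a)) ^ n) * ((72 * a) ^ n)⁻¹ * (2 / (17 * a)),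
    by positivity, _, ⟨hδ0, hδ1⟩, ?_⟩
  intro Ω _ P _ ζ κ hζ hκ hκ1 l hl B hB
  have hB0 : 0 < B := by linarith
  set L := shellLaplace P ζ κ l a with hL
  set J := ∫⁻ A in Set.Ioc (2 * m' ^ 2 * a)⁻¹ 1, shellEnergy P ζ κ l A with hJ
  have hLt : L ≠ ⊤ := shellLaplace_ne_top P hζ hκ hκ1 l ha0
  have h1 : ENNReal.ofReal (Real.exp 1) * shellLaplace P ζ κ l (m' ^ 2 * a) ≤
      ENNReal.ofReal 4⁻¹ * L := by
    have := shellLaplace_comparison P hζ hκ hκ1 hl (a := m' ^ 2 * a) (r := (m' ^ 2)⁻¹)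
      (by nlinarith [sq_nonneg m']) (by positivity)
      ((inv_le_one_of_one_le₀ (by nlinarith)).trans (by norm_num)) (by field_simp; linarith)
    rw [← mul_assoc, inv_mul_cancel₀ (by positivity), one_mul] at this
    refine (mul_le_mul_right this _).trans ?_
    rw [← mul_assoc, ← ENNReal.ofReal_mul (by positivity)]
    refine mul_le_mul_left (ENNReal.ofReal_le_ofReal ?_) _
    rw [Real.sqrt_inv, Real.sqrt_sq hm0.le, ← hK]
    have : ((m' ^ 2)⁻¹) ^ n ≤ 1 :=
      pow_le_one₀ (by positivity) (inv_le_one_of_one_le₀ (by nlinarith))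
    calc Real.exp 1 * (K * m'⁻¹ * (m' ^ 2)⁻¹ ^ n) ≤ Real.exp 1 * (K * m'⁻¹ * 1) := by gcongr
      _ = 4⁻¹ := by rw [hm']; field_simp
  have h2 : ENNReal.ofReal (Real.exp (-a)) * shellLaplace P ζ κ l (2⁻¹ * a) ≤
      ENNReal.ofReal 4⁻¹ * L := by
    have := shellLaplace_comparison P hζ hκ hκ1 hl (a := 2⁻¹ * a) (r := 2)
      (by linarith) (by norm_num) le_rfl (by linarith)
    rw [← mul_assoc, mul_inv_cancel₀ (by norm_num), one_mul] at this
    refine (mul_le_mul_right this _).trans ?_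
    rw [← mul_assoc, ← ENNReal.ofReal_mul (by positivity)]
    refine mul_le_mul_left (ENNReal.ofReal_le_ofReal ?_) _
    rw [← hK, Real.exp_neg, inv_mul_le_iff₀ (Real.exp_pos _)]
    linarith [Real.add_one_le_exp a]
  have h3 : L ≤ ENNReal.ofReal 4⁻¹ * L + J + ENNReal.ofReal 4⁻¹ * L :=
    (shellLaplace_le_split P hζ hκ l ha0 (by positivity)).trans
      (add_le_add (add_le_add h1 le_rfl) h2)
  have h4 : ENNReal.ofReal 2⁻¹ * L ≤ J := by
    have e1 : ENNReal.ofReal 4⁻¹ * L + J + ENNReal.ofReal 4⁻¹ * L =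
        ENNReal.ofReal 2⁻¹ * L + J := by
      have : ENNReal.ofReal 2⁻¹ = ENNReal.ofReal 4⁻¹ + ENNReal.ofReal 4⁻¹ := by
        rw [← ENNReal.ofReal_add (by norm_num) (by norm_num)]; norm_num
      rw [this]
      ring
    have e2 : L = ENNReal.ofReal 2⁻¹ * L + ENNReal.ofReal 2⁻¹ * L := by
      rw [← add_mul, ← ENNReal.ofReal_add (by norm_num) (by norm_num)]
      norm_num
    rw [e1] at h3
    nth_rewrite 1 [e2] at h3
    exact (ENNReal.add_le_add_iff_left (by finiteness)).1 h3
  refine le_trans ?_ h4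
  have h5 := gaussEnergy_le_spectralIntegral P hζ hκ hκ1 hl (a := a) (by linarith) hB
  rw [hL, shellLaplace_eq P hζ hκ hκ1 l ha0, ← mul_assoc (ENNReal.ofReal _), ← ENNReal.ofReal_mul (by norm_num)]
  have e3 : 2⁻¹ * (Real.pi⁻¹ * (Real.pi / (2 * a)) ^ n) * ((72 * a) ^ n)⁻¹ * (2 / (17 * a)) / B =
      (2⁻¹ * (Real.pi⁻¹ * (Real.pi / (2 * a)) ^ n) * ((72 * a) ^ n)⁻¹) *
        (2 / (17 * a * B)) := by field_simp
  rw [e3, ENNReal.ofReal_mul (by positivity), mul_assoc]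
  refine (mul_le_mul_right h5 _).trans_eq ?_
  rw [← mul_assoc, ← ENNReal.ofReal_mul (by positivity)]
  congr 2
  field_simp

end

/-! ### Averaging over the central frequency -/

/-- The triangular probability distribution on `[-1, 1]`, realised as the law of the difference of
two independent uniform variables. -/
def freqMeasure : Measure ℝ :=
  ((volume.restrict (Set.Ioc (0 : ℝ) 1)).prod (volume.restrict (Set.Ioc (0 : ℝ) 1))).map
    fun p => p.1 - p.2

/-- The Fourier transform of the triangular distribution. -/
def freqKernel (θ : ℝ) : ℝ := ‖∫ x in (0 : ℝ)..1, cexp ((x * θ : ℝ) * I)‖ ^ 2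

instance isProbabilityMeasure_restrict_Ioc_zero_one :
    IsProbabilityMeasure (volume.restrict (Set.Ioc (0 : ℝ) 1)) :=
  ⟨by simp⟩

instance isProbabilityMeasure_freqMeasure : IsProbabilityMeasure freqMeasure :=
  Measure.isProbabilityMeasure_map (by fun_prop)

lemma ae_freqMeasure_abs_le_one : ∀ᵐ l ∂freqMeasure, |l| ≤ 1 := by
  rw [freqMeasure, ae_map_iff (by fun_prop) (measurableSet_le (by fun_prop) (by fun_prop)),
    Measure.prod_restrict]
  filter_upwards [ae_restrict_mem (measurableSet_Ioc.prod measurableSet_Ioc)] with p hp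
  rw [Set.mem_prod, Set.mem_Ioc, Set.mem_Ioc] at hp
  rw [abs_le]
  constructor <;> linarith [hp.1.1, hp.1.2, hp.2.1, hp.2.2]

lemma integral_cexp_freqMeasure (θ : ℝ) :
    ∫ l, cexp ((l * θ : ℝ) * I) ∂freqMeasure = (freqKernel θ : ℂ) := by
  rw [freqMeasure, integral_map (by fun_prop)
    (Continuous.aestronglyMeasurable (by fun_prop)), freqKernel, Complex.ofReal_pow,
    ← Complex.mul_conj', intervalIntegral.integral_of_le zero_le_one, ← integral_conj,
    ← integral_prod_mul]
  refine integral_congr_ae (Filter.Eventually.of_forall fun p => ?_)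
  simp only
  rw [← Complex.exp_conj, ← Complex.exp_add]
  congr 1
  simp
  ring

lemma freqKernel_nonneg (θ : ℝ) : 0 ≤ freqKernel θ := by unfold freqKernel; positivity

lemma freqKernel_sub_comm (s t : ℝ) : freqKernel (s - t) = freqKernel (t - s) := by
  have h1 := integral_cexp_freqMeasure (s - t)
  have h2 := congrArg (starRingEnd ℂ) (integral_cexp_freqMeasure (t - s))
  rw [← integral_conj, Complex.conj_ofReal] at h2
  apply Complex.ofReal_injective
  rw [← h1, ← h2]
  refine integral_congr_ae (Filter.Eventually.of_forall fun l => ?_)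
  simp only
  rw [← Complex.exp_conj]
  congr 1
  simp
  ring

@[simp]
lemma freqKernel_zero : freqKernel 0 = 1 := by simp [freqKernel]

lemma norm_integral_cexp_le_one (θ : ℝ) : ‖∫ x in (0 : ℝ)..1, cexp ((x * θ : ℝ) * I)‖ ≤ 1 := by
  have := intervalIntegral.norm_integral_le_of_norm_le_const (a := 0) (b := 1) (C := 1)
    (f := fun x : ℝ => cexp ((x * θ : ℝ) * I))
    (fun x _ => (Complex.norm_exp_ofReal_mul_I _).le)
  simpa using this

lemma freqKernel_le (θ : ℝ) : freqKernel θ ≤ 5 * (1 + θ ^ 2)⁻¹ := by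
  have h1 := norm_integral_cexp_le_one θ
  have h2 : |θ| * ‖∫ x in (0 : ℝ)..1, cexp ((x * θ : ℝ) * I)‖ ≤ 2 := by
    rcases eq_or_ne θ 0 with rfl | h0
    · simp
    · have e : ∫ x in (0 : ℝ)..1, cexp ((x * θ : ℝ) * I) =
          (cexp ((θ : ℝ) * I) - 1) / (θ * I) := by
        have := integral_exp_mul_complex (a := 0) (b := 1) (c := θ * I)
          (mul_ne_zero (by exact_mod_cast h0) I_ne_zero)
        simp only [ofReal_one, mul_one, ofReal_zero, mul_zero, Complex.exp_zero] at this
        rw [← this]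
        refine intervalIntegral.integral_congr fun x _ => ?_
        congr 1
        push_cast
        ring
      rw [e, norm_div, norm_mul, Complex.norm_I, mul_one, Complex.norm_real, Real.norm_eq_abs,
        mul_div_cancel₀ _ (abs_ne_zero.2 h0)]
      refine (norm_sub_le _ _).trans ?_
      rw [Complex.norm_exp_ofReal_mul_I]
      norm_num
  rw [← div_eq_mul_inv, le_div_iff₀ (by positivity), freqKernel]
  set r := ‖∫ x in (0 : ℝ)..1, cexp ((x * θ : ℝ) * I)‖
  have h0 : 0 ≤ r := norm_nonneg _
  have h3 : θ ^ 2 * r ^ 2 = (|θ| * r) ^ 2 := by rw [mul_pow, sq_abs]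
  nlinarith [mul_nonneg (abs_nonneg θ) h0]

lemma continuous_freqKernel : Continuous freqKernel := by
  unfold freqKernel
  refine (Continuous.norm ?_).pow 2
  exact intervalIntegral.continuous_parametric_intervalIntegral_of_continuous'
    (f := fun (θ x : ℝ) => cexp ((x * θ : ℝ) * I)) (by unfold Function.uncurry; fun_prop) 0 1

lemma lintegral_freqKernel_sub_le (t : ℝ) :
    ∫⁻ s, ENNReal.ofReal (freqKernel (t - s)) ≤ ENNReal.ofReal (5 * Real.pi) := by
  rw [lintegral_sub_left_eq_self (fun s => ENNReal.ofReal (freqKernel s))]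
  refine (lintegral_mono fun s => ENNReal.ofReal_le_ofReal (freqKernel_le s)).trans ?_
  rw [← ofReal_integral_eq_lintegral_ofReal (integrable_inv_one_add_sq.const_mul 5)
    (Filter.Eventually.of_forall fun s => by positivity), integral_const_mul,
    integral_univ_inv_one_add_sq]

lemma mul_le_sq_add_sq (a b : ENNReal) : a * b ≤ a ^ 2 + b ^ 2 := by
  rcases le_total a b with h | h
  · exact (mul_le_mul_left h b).trans (by rw [sq b]; exact le_add_self)
  · exact (mul_le_mul_right h a).trans (by rw [sq a]; exact le_self_add)

lemma lintegral_sq_enorm_fourier_le {D : ℝ → ℂ} (hm : Measurable D) (hD : Integrable D) :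
    ∫⁻ l, ‖∫ t, D t * cexp ((l * t : ℝ) * I)‖ₑ ^ 2 ∂freqMeasure ≤
      ENNReal.ofReal (10 * Real.pi) * ∫⁻ t, ‖D t‖ₑ ^ 2 := by
  have hint : Integrable (fun x : (ℝ × ℝ) × ℝ => (D x.1.1 * cexp ((x.2 * x.1.1 : ℝ) * I)) *
      (starRingEnd ℂ) (D x.1.2 * cexp ((x.2 * x.1.2 : ℝ) * I)))
      (((volume : Measure ℝ).prod volume).prod freqMeasure) := by
    have h := (hD.norm.mul_prod hD.norm).mul_prod (integrable_const (μ := freqMeasure) (1 : ℝ))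
    refine h.mono' (Measurable.aestronglyMeasurable (by fun_prop))
      (Filter.Eventually.of_forall fun x => le_of_eq ?_)
    rw [norm_mul, RCLike.norm_conj, norm_mul, norm_mul, Complex.norm_exp_ofReal_mul_I,
      Complex.norm_exp_ofReal_mul_I]
    ring
  rw [lintegral_sq_enorm_integral volume freqMeasure
    (fun t l => D t * cexp ((l * t : ℝ) * I)) hint]
  have hin : ∀ p : ℝ × ℝ, ∫ l, (D p.1 * cexp ((l * p.1 : ℝ) * I)) *
      (starRingEnd ℂ) (D p.2 * cexp ((l * p.2 : ℝ) * I)) ∂freqMeasure =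
      D p.1 * (starRingEnd ℂ) (D p.2) * freqKernel (p.1 - p.2) := by
    intro p
    rw [← integral_cexp_freqMeasure, ← integral_const_mul]
    refine integral_congr_ae (Filter.Eventually.of_forall fun l => ?_)
    simp only
    rw [map_mul, mul_mul_mul_comm, ← Complex.exp_conj, ← Complex.exp_add]
    congr 2
    simp
    ring
  simp_rw [hin]
  have mk : Measurable fun p : ℝ × ℝ => ENNReal.ofReal (freqKernel (p.1 - p.2)) := by
    have := continuous_freqKernel
    fun_prop
  calc ENNReal.ofReal (∫ p : ℝ × ℝ, D p.1 * (starRingEnd ℂ) (D p.2) * freqKernel (p.1 - p.2)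
        ∂(volume.prod volume)).re
      ≤ ‖∫ p : ℝ × ℝ, D p.1 * (starRingEnd ℂ) (D p.2) * freqKernel (p.1 - p.2)
        ∂(volume.prod volume)‖ₑ := by
        rw [← ofReal_norm]; exact ENNReal.ofReal_le_ofReal (Complex.re_le_norm _)
    _ ≤ ∫⁻ p : ℝ × ℝ, ‖D p.1 * (starRingEnd ℂ) (D p.2) * freqKernel (p.1 - p.2)‖ₑ
        ∂(volume.prod volume) := enorm_integral_le_lintegral_enorm _
    _ ≤ ∫⁻ p : ℝ × ℝ, (‖D p.1‖ₑ ^ 2 * ENNReal.ofReal (freqKernel (p.1 - p.2)) +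
          ‖D p.2‖ₑ ^ 2 * ENNReal.ofReal (freqKernel (p.1 - p.2))) ∂(volume.prod volume) := by
        refine lintegral_mono fun p => ?_
        rw [enorm_mul, enorm_mul, ← add_mul, RCLike.enorm_conj]
        refine mul_le_mul' (mul_le_sq_add_sq _ _) (le_of_eq ?_)
        rw [← ofReal_norm, Complex.norm_real, Real.norm_of_nonneg (freqKernel_nonneg _)]
    _ = (∫⁻ p : ℝ × ℝ, ‖D p.1‖ₑ ^ 2 * ENNReal.ofReal (freqKernel (p.1 - p.2))
          ∂(volume.prod volume)) + ∫⁻ p : ℝ × ℝ, ‖D p.2‖ₑ ^ 2 *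
            ENNReal.ofReal (freqKernel (p.1 - p.2)) ∂(volume.prod volume) :=
        lintegral_add_left (by fun_prop) _
    _ ≤ (ENNReal.ofReal (5 * Real.pi) * ∫⁻ t, ‖D t‖ₑ ^ 2) +
          ENNReal.ofReal (5 * Real.pi) * ∫⁻ t, ‖D t‖ₑ ^ 2 := by
        refine add_le_add ?_ ?_
        · rw [lintegral_prod _ (by fun_prop), ← lintegral_const_mul' _ _ (by finiteness)]
          refine lintegral_mono fun t => ?_
          simp only
          rw [lintegral_const_mul' _ _ (by finiteness), mul_comm]
          exact mul_le_mul_left (lintegral_freqKernel_sub_le t) _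
        · rw [lintegral_prod_symm _ (by fun_prop), ← lintegral_const_mul' _ _ (by finiteness)]
          refine lintegral_mono fun t => ?_
          simp only
          rw [lintegral_const_mul' _ _ (by finiteness), mul_comm]
          refine mul_le_mul_left ?_ _
          simp_rw [freqKernel_sub_comm _ t]
          exact lintegral_freqKernel_sub_le t
    _ = _ := by
        rw [← add_mul, ← ENNReal.ofReal_add (by positivity) (by positivity)]
        congr 2
        ring

section
variable {Ω : Type*} [MeasurableSpace Ω] {n : ℕ} (P : Measure Ω) [IsFiniteMeasure P]

/-- The superposition of indicators of Heisenberg boxes with squared radius `A`, with centres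
`(ζ, τ)` and weights `ε`, as a function of the reflected position. -/
def boxSum {Ω : Type*} [MeasurableSpace Ω] {n : ℕ} (P : Measure Ω) (ζ : Ω → Fin n → ℂ)
    (τ : Ω → ℝ) (ε : Ω → ℂ) (A : ℝ) (z : Fin n → ℂ) (t : ℝ) : ℂ :=
  ∫ ω, ε ω * ((Set.Iic A).indicator (fun _ => 1) (nsq (z - ζ ω)) *
    (Set.Iic A).indicator (fun _ => 1) |τ ω - 2⁻¹ * symp z (ζ ω) - t|) ∂P

/-- The Fourier transform of the indicator of `[-A, A]`. -/
def dirichletWindow (A l : ℝ) : ℂ :=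
  ∫ v : ℝ, (Set.Iic A).indicator (fun _ => (1 : ℂ)) |v| * cexp ((l * v : ℝ) * I)

@[fun_prop]
lemma measurable_symp {X : Type*} [MeasurableSpace X] {f g : X → Fin n → ℂ}
    (hf : Measurable f) (hg : Measurable g) : Measurable fun x => symp (f x) (g x) :=
  continuous_symp.measurable.comp (hf.prodMk hg)

@[fun_prop]
lemma measurable_indicator_Iic_comp {X : Type*} [MeasurableSpace X] {A f : X → ℝ}
    (hA : Measurable A) (hf : Measurable f) :
    Measurable fun x => (Set.Iic (A x)).indicator (fun _ => (1 : ℂ)) (f x) :=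
  measurable_indicator_Iic.comp (hA.prodMk hf)

lemma norm_indicator_Iic_le (A x : ℝ) : ‖(Set.Iic A).indicator (fun _ => (1 : ℂ)) x‖ ≤ 1 := by
  by_cases h : x ∈ Set.Iic A <;> simp [h]

lemma integrable_indicator_Iic_abs (A : ℝ) :
    Integrable fun v : ℝ => (Set.Iic A).indicator (fun _ => (1 : ℂ)) |v| := by
  have : (fun v : ℝ => (Set.Iic A).indicator (fun _ => (1 : ℂ)) |v|) =
      (Set.Icc (-A) A).indicator fun _ => 1 := by
    funext v
    simp [Set.indicator, abs_le]
  rw [this]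
  exact (integrable_indicator_iff measurableSet_Icc).2 (by simp)

lemma le_norm_dirichletWindow {A l : ℝ} (hA0 : 0 ≤ A) (hA : A ≤ 1) (hl : |l| ≤ 1) :
    A ≤ ‖dirichletWindow A l‖ := by
  have e : dirichletWindow A l = ∫ v in (-A)..A, cexp ((l * v : ℝ) * I) := by
    rw [intervalIntegral.integral_of_le (by linarith), ← integral_Icc_eq_integral_Ioc,
      ← integral_indicator measurableSet_Icc, dirichletWindow]
    congr 1
    funext v
    simp [Set.indicator, abs_le]
  refine le_trans ?_ (Complex.re_le_norm _)
  have hi : IntervalIntegrable (fun v : ℝ => cexp ((l * v : ℝ) * I)) volume (-A) A :=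
    Continuous.intervalIntegrable (by fun_prop) _ _
  have e2 : (∫ v in (-A)..A, cexp ((l * v : ℝ) * I)).re = ∫ v in (-A)..A, Real.cos (l * v) := by
    rw [← Complex.reCLM_apply, ← Complex.reCLM.intervalIntegral_comp_comm hi]
    refine intervalIntegral.integral_congr fun v _ => ?_
    exact Complex.exp_ofReal_mul_I_re _
  rw [e, e2]
  have : ∫ v in (-A)..A, (2⁻¹ : ℝ) ≤ ∫ v in (-A)..A, Real.cos (l * v) := by
    refine intervalIntegral.integral_mono_on (by linarith) (by simp)
      (Continuous.intervalIntegrable (by fun_prop) _ _) fun v hv => ?_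
    refine le_trans ?_ (Real.one_sub_sq_div_two_le_cos (x := l * v))
    have h1 : |l * v| ≤ 1 := by
      rw [abs_mul]
      have : |v| ≤ 1 := abs_le.2 ⟨by linarith [hv.1], by linarith [hv.2]⟩
      exact mul_le_one₀ hl (abs_nonneg _) this
    have h2 : (l * v) ^ 2 ≤ 1 := by rw [← sq_abs]; nlinarith [abs_nonneg (l * v)]
    linarith
  refine le_trans (le_of_eq ?_) this
  rw [intervalIntegral.integral_const, smul_eq_mul]
  ring

lemma integrable_prod_window {u : Ω → ℝ} (hu : Measurable u) (A : ℝ) :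
    Integrable (fun x : Ω × ℝ => (Set.Iic A).indicator (fun _ => (1 : ℂ)) |u x.1 - x.2|)
      (P.prod volume) := by
  refine (integrable_prod_iff (Measurable.aestronglyMeasurable (by fun_prop))).2
    ⟨Filter.Eventually.of_forall fun ω =>
      (integrable_indicator_Iic_abs A).comp_sub_left (u ω), ?_⟩
  have : (fun ω : Ω => ∫ t : ℝ, ‖(Set.Iic A).indicator (fun _ => (1 : ℂ)) |u ω - t|‖) =
      fun _ => ∫ t : ℝ, ‖(Set.Iic A).indicator (fun _ => (1 : ℂ)) |t|‖ := by
    funext ω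
    exact integral_sub_left_eq_self
      (fun t : ℝ => ‖(Set.Iic A).indicator (fun _ => (1 : ℂ)) |t|‖) volume (u ω)
  exact this ▸ integrable_const _

variable {ζ : Ω → Fin n → ℂ} {τ : Ω → ℝ} {ε : Ω → ℂ}

lemma integrable_prod_boxSum (hζ : Measurable ζ) (hτ : Measurable τ) (hε : Measurable ε)
    (hε1 : ∀ ω, ‖ε ω‖ ≤ 1) (A : ℝ) (z : Fin n → ℂ) :
    Integrable (fun x : Ω × ℝ => ε x.1 * ((Set.Iic A).indicator (fun _ => 1) (nsq (z - ζ x.1)) *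
      (Set.Iic A).indicator (fun _ => 1) |τ x.1 - 2⁻¹ * symp z (ζ x.1) - x.2|))
      (P.prod volume) := by
  refine (integrable_prod_window P (u := fun ω => τ ω - 2⁻¹ * symp z (ζ ω)) (by fun_prop) A).mono
    (Measurable.aestronglyMeasurable (by fun_prop)) (Filter.Eventually.of_forall fun x => ?_)
  rw [norm_mul, norm_mul]
  exact mul_le_of_le_one_left (by positivity) (hε1 _) |>.trans
    (mul_le_of_le_one_left (norm_nonneg _) (norm_indicator_Iic_le _ _))

lemma fourier_boxSum (hζ : Measurable ζ) (hτ : Measurable τ) (hε : Measurable ε)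
    (hε1 : ∀ ω, ‖ε ω‖ ≤ 1) (A l : ℝ) (z : Fin n → ℂ) :
    ∫ t, boxSum P ζ τ ε A z t * cexp ((l * t : ℝ) * I) = dirichletWindow A (-l) *
      twist P ζ (fun ω => ε ω * cexp ((l * τ ω : ℝ) * I)) l
        ((Set.Iic A).indicator fun _ => 1) z := by
  simp only [boxSum, twist]
  simp_rw [← integral_const_mul, ← integral_mul_const]
  rw [integral_integral_swap]
  · refine integral_congr_ae (Filter.Eventually.of_forall fun ω => ?_)
    simp only
    have h1 := integral_sub_left_eq_self (fun v : ℝ => (Set.Iic A).indicator (fun _ => (1 : ℂ)) |v| *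
      cexp ((-l * v : ℝ) * I)) volume (τ ω - 2⁻¹ * symp z (ζ ω))
    rw [dirichletWindow, ← h1, ← integral_mul_const]
    refine integral_congr_ae (Filter.Eventually.of_forall fun t => ?_)
    have h2 : cexp ((l * t : ℝ) * I) = cexp ((-l * (τ ω - 2⁻¹ * symp z (ζ ω) - t) : ℝ) * I) *
        (cexp ((l * τ ω : ℝ) * I) * phase l z (ζ ω)) := by
      rw [phase, ← Complex.exp_add, ← Complex.exp_add]
      congr 1
      push_cast
      ring
    simp only
    rw [h2]
    ring
  · have h := (integrable_prod_boxSum P hζ hτ hε hε1 A z).swap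
    refine h.mono (Measurable.aestronglyMeasurable (by unfold Function.uncurry; fun_prop))
      (Filter.Eventually.of_forall fun x => ?_)
    simp only [Function.uncurry]
    rw [norm_mul _ (cexp _), Complex.norm_exp_ofReal_mul_I, mul_one]
    rfl

lemma measurable_boxSum_param {X : Type*} [MeasurableSpace X] (hζ : Measurable ζ)
    (hτ : Measurable τ) (hε : Measurable ε) {A t : X → ℝ} {z : X → Fin n → ℂ}
    (hA : Measurable A) (ht : Measurable t) (hz : Measurable z) :
    Measurable fun x => boxSum P ζ τ ε (A x) (z x) (t x) := by
  have : Measurable (Function.uncurry fun (x : X) (ω : Ω) =>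
      ε ω * ((Set.Iic (A x)).indicator (fun _ => (1 : ℂ)) (nsq (z x - ζ ω)) *
        (Set.Iic (A x)).indicator (fun _ => (1 : ℂ)) |τ ω - 2⁻¹ * symp (z x) (ζ ω) - t x|)) := by
    unfold Function.uncurry
    fun_prop
  exact (this.stronglyMeasurable.integral_prod_right (ν := P)).measurable

lemma lintegral_sq_twist_le (hζ : Measurable ζ) (hτ : Measurable τ) (hε : Measurable ε)
    (hε1 : ∀ ω, ‖ε ω‖ ≤ 1) {A : ℝ} (hA0 : 0 ≤ A) (hA1 : A ≤ 1) (z : Fin n → ℂ) :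
    ENNReal.ofReal (A ^ 2) * ∫⁻ l, ‖twist P ζ (fun ω => ε ω * cexp ((l * τ ω : ℝ) * I)) l
        ((Set.Iic A).indicator fun _ => 1) z‖ₑ ^ 2 ∂freqMeasure ≤
      ENNReal.ofReal (10 * Real.pi) * ∫⁻ t, ‖boxSum P ζ τ ε A z t‖ₑ ^ 2 := by
  refine le_trans ?_ (lintegral_sq_enorm_fourier_le
    (measurable_boxSum_param P hζ hτ hε measurable_const measurable_id measurable_const)
    (integrable_prod_boxSum P hζ hτ hε hε1 A z).integral_prod_right)
  rw [← lintegral_const_mul' _ _ (by finiteness)]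
  refine lintegral_mono_ae ?_
  filter_upwards [ae_freqMeasure_abs_le_one] with l hl
  rw [fourier_boxSum P hζ hτ hε hε1, enorm_mul, mul_pow]
  refine mul_le_mul_left ?_ _
  rw [ENNReal.ofReal_pow hA0]
  refine pow_le_pow_left₀ zero_le ?_ 2
  rw [← ofReal_norm]
  exact ENNReal.ofReal_le_ofReal (le_norm_dirichletWindow hA0 hA1 (by rwa [abs_neg]))

end

lemma ofReal_integral_le_lintegral_ofReal {X : Type*} [MeasurableSpace X] {m : Measure X}
    {g : X → ℝ} (hg : Integrable g m) :
    ENNReal.ofReal (∫ x, g x ∂m) ≤ ∫⁻ x, ENNReal.ofReal (g x) ∂m := by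
  refine (ENNReal.ofReal_le_ofReal (integral_mono hg hg.pos_part fun x => le_max_left _ _)).trans ?_
  rw [ofReal_integral_eq_lintegral_ofReal hg.pos_part
    (Filter.Eventually.of_forall fun x => le_max_right _ _)]
  refine le_of_eq (lintegral_congr fun x => ?_)
  rcases le_total (g x) 0 with h | h
  · rw [max_eq_right h, ENNReal.ofReal_of_nonpos h, ENNReal.ofReal_zero]
  · rw [max_eq_left h]

lemma setLIntegral_le_two_mul_comp_sq (F : ℝ → ENNReal) :
    ∫⁻ A in Set.Ioc 0 1, F A ≤ 2 * ∫⁻ ρ in Set.Ioc 0 1, F (ρ ^ 2) := by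
  have e := lintegral_image_eq_lintegral_abs_deriv_mul (s := Set.Ioc (0 : ℝ) 1)
    (f := fun x => x ^ 2) (f' := fun x => 2 * x) measurableSet_Ioc
    (fun x _ => by simpa using (hasDerivAt_pow 2 x).hasDerivWithinAt)
    (fun x hx y hy hxy => (pow_left_inj₀ hx.1.le hy.1.le two_ne_zero).1 hxy) F
  have hi : Set.Ioc (0 : ℝ) 1 ⊆ (fun x => x ^ 2) '' Set.Ioc (0 : ℝ) 1 := fun A hA =>
    ⟨√A, ⟨Real.sqrt_pos.2 hA.1, Real.sqrt_le_one.2 hA.2⟩, Real.sq_sqrt hA.1.le⟩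
  refine (lintegral_mono_set hi).trans ?_
  rw [e, ← lintegral_const_mul' _ _ (by finiteness)]
  refine setLIntegral_mono' measurableSet_Ioc fun x hx => mul_le_mul_left ?_ _
  rw [← ENNReal.ofReal_ofNat]
  refine ENNReal.ofReal_le_ofReal ?_
  rw [abs_of_pos (by linarith [hx.1])]
  linarith [hx.2]

section
variable {Ω : Type*} [MeasurableSpace Ω] {n : ℕ} (P : Measure Ω) [IsFiniteMeasure P]
  {ζ : Ω → Fin n → ℂ} {τ : Ω → ℝ} {ε : Ω → ℂ}

/-- The Gaussian energy after averaging over the central frequency. -/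
def avgEnergy {Ω : Type*} [MeasurableSpace Ω] {n : ℕ} (P : Measure Ω) (ζ : Ω → Fin n → ℂ)
    (τ : Ω → ℝ) (ε : Ω → ℂ) (s : ℝ) : ℝ :=
  (∫ p : Ω × Ω, ε p.1 * (starRingEnd ℂ) (ε p.2) *
    ((freqKernel (τ p.1 - τ p.2 - 2⁻¹ * symp (ζ p.2) (ζ p.1)) *
      Real.exp (-s * nsq (ζ p.1 - ζ p.2)) : ℝ) : ℂ) ∂(P.prod P)).re

lemma ofReal_avgEnergy_le (hζ : Measurable ζ) (hτ : Measurable τ) (hε : Measurable ε)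
    (hε1 : ∀ ω, ‖ε ω‖ ≤ 1) {s : ℝ} (hs : 0 ≤ s) :
    ENNReal.ofReal (avgEnergy P ζ τ ε s) ≤
      ∫⁻ l, gaussEnergy P ζ (fun ω => ε ω * cexp ((l * τ ω : ℝ) * I)) l s ∂freqMeasure := by
  set F : ℝ → Ω × Ω → ℂ := fun l p => ε p.1 * cexp ((l * τ p.1 : ℝ) * I) *
    (starRingEnd ℂ) (ε p.2 * cexp ((l * τ p.2 : ℝ) * I)) *
    (phase l (ζ p.2) (ζ p.1) * cexp (-s * nsq (ζ p.1 - ζ p.2))) with hF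
  have hi : Integrable (Function.uncurry F) (freqMeasure.prod (P.prod P)) := by
    refine (integrable_const (1 : ℝ)).mono' (Measurable.aestronglyMeasurable
      (by unfold F Function.uncurry; fun_prop)) (Filter.Eventually.of_forall fun x => ?_)
    simp only [Function.uncurry, hF]
    rw [norm_mul, norm_mul, norm_mul _ (cexp (_ * _)), RCLike.norm_conj, norm_mul, norm_mul,
      Complex.norm_exp_ofReal_mul_I, Complex.norm_exp_ofReal_mul_I, norm_phase, mul_one, mul_one,
      one_mul]
    exact mul_le_one₀ (mul_le_one₀ (hε1 _) (norm_nonneg _) (hε1 _)) (norm_nonneg _)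
      (norm_cexp_neg_mul_nsq_le (by simpa using hs) _)
  have h1 : avgEnergy P ζ τ ε s = ∫ l, (∫ p, F l p ∂(P.prod P)).re ∂freqMeasure := by
    have h2 : ∀ p, ∫ l, F l p ∂freqMeasure = ε p.1 * (starRingEnd ℂ) (ε p.2) *
        ((freqKernel (τ p.1 - τ p.2 - 2⁻¹ * symp (ζ p.2) (ζ p.1)) *
          Real.exp (-s * nsq (ζ p.1 - ζ p.2)) : ℝ) : ℂ) := by
      intro p
      rw [mul_comm (freqKernel _), Complex.ofReal_mul, ← integral_cexp_freqMeasure, ← mul_assoc,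
        ← integral_const_mul]
      refine integral_congr_ae (Filter.Eventually.of_forall fun l => ?_)
      have h3 : cexp ((l * (τ p.1 - τ p.2 - 2⁻¹ * symp (ζ p.2) (ζ p.1)) : ℝ) * I) =
          cexp ((l * τ p.1 : ℝ) * I) * (starRingEnd ℂ) (cexp ((l * τ p.2 : ℝ) * I)) *
            phase l (ζ p.2) (ζ p.1) := by
        rw [phase, ← Complex.exp_conj, ← Complex.exp_add, ← Complex.exp_add, map_mul, conj_I,
          conj_ofReal]
        congr 1
        push_cast
        ring
      simp only [hF]
      rw [h3, map_mul]
      push_cast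
      ring
    rw [avgEnergy, ← integral_congr_ae (Filter.Eventually.of_forall h2),
      ← integral_integral_swap hi]
    exact (Complex.reCLM.integral_comp_comm hi.integral_prod_left).symm
  rw [h1]
  refine (ofReal_integral_le_lintegral_ofReal ?_).trans_eq rfl
  exact hi.integral_prod_left.re

end

/-- The quadratic mean of a superposition of boxes is bounded below by its averaged energy at
any scale. -/
lemma exists_avgEnergy_le (n : ℕ) : ∃ c > (0 : ℝ), ∀ {Ω : Type} [MeasurableSpace Ω]
    (P : Measure Ω) [IsFiniteMeasure P] (ζ : Ω → Fin n → ℂ) (τ : Ω → ℝ) (ε : Ω → ℂ),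
    Measurable ζ → Measurable τ → Measurable ε → (∀ ω, ‖ε ω‖ ≤ 1) → ∀ B : ℝ, 1 ≤ B →
    ENNReal.ofReal (c / B * avgEnergy P ζ τ ε (B ^ 2)) ≤
      ∫⁻ ρ in Set.Ioc (0 : ℝ) 1, ∫⁻ z, ∫⁻ t, ‖boxSum P ζ τ ε (ρ ^ 2) z t‖ₑ ^ 2 := by
  obtain ⟨c, hc, δ, hδ, H⟩ := exists_gaussEnergy_le_shellEnergy n
  refine ⟨(20 * Real.pi)⁻¹ * δ ^ 2 * c, by have := hδ.1; positivity, ?_⟩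
  intro Ω _ P _ ζ τ ε hζ hτ hε hε1 B hB
  have hB0 : 0 < B := by linarith
  set κ : ℝ → Ω → ℂ := fun l ω => ε ω * cexp ((l * τ ω : ℝ) * I) with hκ
  have mκ : Measurable (Function.uncurry κ) := by unfold κ Function.uncurry; fun_prop
  have hκ1 : ∀ l ω, ‖κ l ω‖ ≤ 1 := fun l ω => by
    rw [hκ, norm_mul, Complex.norm_exp_ofReal_mul_I, mul_one]; exact hε1 ω
  set F : ℝ → ENNReal := fun A => ∫⁻ z, ∫⁻ t, ‖boxSum P ζ τ ε A z t‖ₑ ^ 2 with hF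
  have mS : Measurable fun p : ℝ × ℝ => shellEnergy P ζ (κ p.1) p.1 p.2 := by
    refine Measurable.lintegral_prod_right' (f := fun x : (ℝ × ℝ) × (Fin n → ℂ) =>
      ‖twist P ζ (κ x.1.1) x.1.1 ((Set.Iic x.1.2).indicator fun _ => 1) x.2‖ₑ ^ 2) ?_
    exact (measurable_twist_param P hζ (κ := fun p : ℝ × ℝ => κ p.1) (l := fun p : ℝ × ℝ => p.1)
      (f := fun p : ℝ × ℝ => (Set.Iic p.2).indicator fun _ => 1)
      (mκ.comp (f := fun q : (ℝ × ℝ) × Ω => (q.1.1, q.2)) (by fun_prop))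
      measurable_fst (by unfold Function.uncurry; fun_prop)).enorm.pow_const 2
  have hA : ∀ A ∈ Set.Ioc δ 1, ENNReal.ofReal (δ ^ 2) *
      ∫⁻ l, shellEnergy P ζ (κ l) l A ∂freqMeasure ≤ ENNReal.ofReal (10 * Real.pi) * F A := by
    intro A hA
    have hA0 : 0 ≤ A := hδ.1.le.trans hA.1.le
    have hm : Measurable fun x : ℝ × (Fin n → ℂ) =>
        ‖twist P ζ (κ x.1) x.1 ((Set.Iic A).indicator fun _ => 1) x.2‖ₑ ^ 2 :=
      (measurable_twist_param P hζ (κ := κ) (l := fun p => p)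
        (f := fun _ => (Set.Iic A).indicator fun _ => 1) mκ
        measurable_id (by unfold Function.uncurry; fun_prop)).enorm.pow_const 2
    calc _ ≤ ENNReal.ofReal (A ^ 2) * ∫⁻ l, shellEnergy P ζ (κ l) l A ∂freqMeasure :=
          mul_le_mul_left (ENNReal.ofReal_le_ofReal (pow_le_pow_left₀ hδ.1.le hA.1.le 2)) _
      _ = ENNReal.ofReal (A ^ 2) * ∫⁻ z, ∫⁻ l,
            ‖twist P ζ (κ l) l ((Set.Iic A).indicator fun _ => 1) z‖ₑ ^ 2 ∂freqMeasure := by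
          congr 1
          exact lintegral_lintegral_swap hm.aemeasurable
      _ = ∫⁻ z, ENNReal.ofReal (A ^ 2) * ∫⁻ l,
            ‖twist P ζ (κ l) l ((Set.Iic A).indicator fun _ => 1) z‖ₑ ^ 2 ∂freqMeasure :=
          (lintegral_const_mul' _ _ (by finiteness)).symm
      _ ≤ ∫⁻ z, ENNReal.ofReal (10 * Real.pi) * ∫⁻ t, ‖boxSum P ζ τ ε A z t‖ₑ ^ 2 :=
          lintegral_mono fun z => lintegral_sq_twist_le P hζ hτ hε hε1 hA0 hA.2 z
      _ = _ := lintegral_const_mul' _ _ (by finiteness)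
  have h1 : ENNReal.ofReal (c / B * avgEnergy P ζ τ ε (B ^ 2)) ≤
      ∫⁻ A in Set.Ioc δ 1, ∫⁻ l, shellEnergy P ζ (κ l) l A ∂freqMeasure := by
    rw [ENNReal.ofReal_mul (by positivity)]
    refine (mul_le_mul_right (ofReal_avgEnergy_le P hζ hτ hε hε1 (by positivity)) _).trans ?_
    rw [← lintegral_const_mul' _ _ (by finiteness)]
    refine le_trans (lintegral_mono_ae (ae_freqMeasure_abs_le_one.mono fun l hl => ?_))
      (lintegral_lintegral_swap mS.aemeasurable).le
    exact H P ζ (κ l) hζ (mκ.comp (f := fun ω => (l, ω)) (by fun_prop)) (hκ1 l) l hl B hB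
  have h2 : ENNReal.ofReal (δ ^ 2) *
      ∫⁻ A in Set.Ioc δ 1, ∫⁻ l, shellEnergy P ζ (κ l) l A ∂freqMeasure ≤
      ENNReal.ofReal (20 * Real.pi) * ∫⁻ ρ in Set.Ioc (0 : ℝ) 1, F (ρ ^ 2) := by
    calc _ = ∫⁻ A in Set.Ioc δ 1, ENNReal.ofReal (δ ^ 2) *
            ∫⁻ l, shellEnergy P ζ (κ l) l A ∂freqMeasure :=
          (lintegral_const_mul' _ _ (by finiteness)).symm
      _ ≤ ∫⁻ A in Set.Ioc δ 1, ENNReal.ofReal (10 * Real.pi) * F A :=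
          setLIntegral_mono' measurableSet_Ioc hA
      _ = ENNReal.ofReal (10 * Real.pi) * ∫⁻ A in Set.Ioc δ 1, F A :=
          lintegral_const_mul' _ _ (by finiteness)
      _ ≤ ENNReal.ofReal (10 * Real.pi) * (2 * ∫⁻ ρ in Set.Ioc (0 : ℝ) 1, F (ρ ^ 2)) :=
          mul_le_mul_right ((lintegral_mono_set (Set.Ioc_subset_Ioc_left hδ.1.le)).trans
            (setLIntegral_le_two_mul_comp_sq F)) _
      _ = _ := by
          rw [← mul_assoc, ← ENNReal.ofReal_ofNat 2, ← ENNReal.ofReal_mul (by positivity)]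
          congr 2
          ring
  have e : (20 * Real.pi)⁻¹ * δ ^ 2 * c / B * avgEnergy P ζ τ ε (B ^ 2) =
      (20 * Real.pi)⁻¹ * (δ ^ 2 * (c / B * avgEnergy P ζ τ ε (B ^ 2))) := by ring
  rw [e, ENNReal.ofReal_mul (by positivity), ENNReal.ofReal_mul (by positivity)]
  refine (mul_le_mul_right ((mul_le_mul_right h1 _).trans h2) _).trans_eq ?_
  rw [← mul_assoc, ← ENNReal.ofReal_mul (by positivity), inv_mul_cancel₀ (by positivity),
    ENNReal.ofReal_one, one_mul]

/-! ### Consequences of upper Ahlfors regularity -/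

lemma symp_add_left {n : ℕ} (u v w : Fin n → ℂ) : symp (u + v) w = symp u w + symp v w := by
  simp [symp, add_mul, Finset.sum_add_distrib]

lemma symp_neg_left {n : ℕ} (u w : Fin n → ℂ) : symp (-u) w = -symp u w := by
  simp [symp]

lemma symp_add_right {n : ℕ} (u v w : Fin n → ℂ) : symp u (v + w) = symp u v + symp u w := by
  simp [symp, mul_add, Finset.sum_add_distrib]

lemma symp_neg_right {n : ℕ} (u w : Fin n → ℂ) : symp u (-w) = -symp u w := by
  simp [symp]

lemma symp_self {n : ℕ} (u : Fin n → ℂ) : symp u u = 0 := by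
  have := symp_antisymm u u
  linarith

lemma Hmul_Hinv {n : ℕ} (p q : Heis n) :
    Hmul (Hinv p) q = (q.1 - p.1, q.2 - p.2 - 2⁻¹ * symp p.1 q.1) := by
  have h := symp_neg_left p.1 q.1
  rw [symp] at h
  refine Prod.ext (by simp [Hmul, Hinv]; ring) ?_
  simp only [Hmul, Hinv]
  rw [h]
  ring

lemma Hmul_Hinv_Hmul_Hinv {n : ℕ} (p q x : Heis n) :
    Hmul (Hinv p) (Hmul (Hinv q) x) = Hmul (Hinv (Hmul q p)) x := by
  have h : (Hmul q p).2 = q.2 + p.2 + 2⁻¹ * symp q.1 p.1 := by simp [Hmul, symp]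
  have h1 : (Hmul q p).1 = q.1 + p.1 := rfl
  simp only [Hmul_Hinv, h, h1, sub_eq_add_neg, symp_add_left, symp_add_right, symp_neg_right]
  refine Prod.ext (by simp only; ring) ?_
  simp only
  linear_combination 2⁻¹ * symp_antisymm p.1 q.1

lemma znorm_eq {n : ℕ} (z : Fin n → ℂ) : znorm z = √(nsq z) := rfl

lemma znorm_pow_four {n : ℕ} (z : Fin n → ℂ) : znorm z ^ 4 = nsq z ^ 2 := by
  rw [znorm_eq, show (4 : ℕ) = 2 * 2 from rfl, pow_mul, Real.sq_sqrt (nsq_nonneg z)]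

lemma nsq_le {n : ℕ} (z : Fin n → ℂ) : nsq z ≤ n * ‖z‖ ^ 2 := by
  refine (Finset.sum_le_card_nsmul _ _ (‖z‖ ^ 2) fun j _ =>
    pow_le_pow_left₀ (norm_nonneg _) (norm_le_pi_norm z j) 2).trans_eq (by simp)

lemma nsq_add_le {n : ℕ} (u v : Fin n → ℂ) : nsq (u + v) ≤ 2 * nsq u + 2 * nsq v := by
  simp only [nsq, Finset.mul_sum, ← Finset.sum_add_distrib]
  refine Finset.sum_le_sum fun j _ => ?_
  have := norm_add_le (u j) (v j)
  simp only [Pi.add_apply]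
  nlinarith [norm_nonneg (u j + v j), sq_nonneg (‖u j‖ - ‖v j‖)]

lemma symp_sq_le {n : ℕ} (u v : Fin n → ℂ) : symp u v ^ 2 ≤ nsq u * nsq v := by
  have h1 : |symp u v| ≤ ∑ j, ‖u j‖ * ‖v j‖ := by
    refine (Complex.abs_im_le_norm _).trans ((norm_sum_le _ _).trans_eq ?_)
    simp
  rw [← sq_abs]
  exact (pow_le_pow_left₀ (abs_nonneg _) h1 2).trans (Finset.sum_mul_sq_le_sq_mul_sq _ _ _)

lemma measurable_Hmul_Hinv {n : ℕ} (q : Heis n) : Measurable (Hmul (Hinv q)) := by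
  have : Hmul (Hinv q) = fun x : Heis n => (x.1 - q.1, x.2 - q.2 - 2⁻¹ * symp q.1 x.1) :=
    funext fun x => Hmul_Hinv q x
  rw [this]
  fun_prop

lemma mem_Hball_of_mem {n : ℕ} {r : ℝ} (hn : 1 ≤ n) (hr : 0 < r) {p y : Heis n}
    (h1 : ‖y.1 - p.1‖ ≤ r) (h2 : |y.2 - p.2 - 2⁻¹ * symp p.1 y.1| ≤ r ^ 2) :
    y ∈ Hball p ((n + 1) * r) := by
  have hn' : (1 : ℝ) ≤ n := by exact_mod_cast hn
  have h3 : nsq (y.1 - p.1) ≤ n * r ^ 2 := (nsq_le _).trans (by gcongr)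
  have h4 := nsq_nonneg (y.1 - p.1)
  rw [Hball, Set.mem_ofPred_eq, Hdist, Hmul_Hinv, koranyi, znorm_pow_four]
  simp only
  have h5 : nsq (y.1 - p.1) ^ 2 + (y.2 - p.2 - 2⁻¹ * symp p.1 y.1) ^ 2 < ((n + 1) * r) ^ 4 := by
    have h6 : nsq (y.1 - p.1) ^ 2 ≤ (n * r ^ 2) ^ 2 := pow_le_pow_left₀ h4 h3 2
    have h7 : (y.2 - p.2 - 2⁻¹ * symp p.1 y.1) ^ 2 ≤ (r ^ 2) ^ 2 := by
      rw [← sq_abs]; exact pow_le_pow_left₀ (abs_nonneg _) h2 2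
    have h8 : (n : ℝ) ^ 2 + 1 < (n + 1) ^ 4 := by nlinarith [sq_nonneg (n : ℝ)]
    have h9 : 0 < r ^ 4 := by positivity
    nlinarith
  calc _ < (((n + 1) * r) ^ 4) ^ ((1 : ℝ) / 4) :=
        Real.rpow_lt_rpow (by positivity) h5 (by norm_num)
    _ = (n + 1) * r := by
        rw [← Real.rpow_natCast, ← Real.rpow_mul (by positivity)]
        norm_num

lemma kernel_le_of_mem {n : ℕ} {s : ℝ} (hs : 1 ≤ s) {p y : Heis n}
    (h1 : ‖y.1 - p.1‖ ^ 2 ≤ s⁻¹) (h2 : |y.2 - p.2 - 2⁻¹ * symp p.1 y.1| ≤ s⁻¹) :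
    Real.exp (-s * nsq y.1) * (1 + y.2 ^ 2)⁻¹ ≤
      2 * (3 + 2 * n) * Real.exp n * (Real.exp (-(s / 4) * nsq (p.1 - 0)) * (1 + p.2 ^ 2)⁻¹) := by
  rw [sub_zero]
  have hs0 : 0 < s := by linarith
  have hinv : s⁻¹ ≤ 1 := inv_le_one_of_one_le₀ hs
  have ha := nsq_nonneg p.1
  have hd : nsq (y.1 - p.1) ≤ n * s⁻¹ := (nsq_le _).trans (by gcongr)
  have hsymp : symp p.1 y.1 = symp p.1 (y.1 - p.1) := by
    rw [sub_eq_add_neg, symp_add_right, symp_neg_right, symp_self, neg_zero, add_zero]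
  have hsq : symp p.1 y.1 ^ 2 ≤ n * (s * nsq p.1) := by
    rw [hsymp]
    calc _ ≤ nsq p.1 * (n * s⁻¹) := (symp_sq_le _ _).trans (by gcongr)
      _ ≤ nsq p.1 * (n * s) := by gcongr; linarith
      _ = _ := by ring
  have hnX : 0 ≤ (n : ℝ) * (s * nsq p.1) := by positivity
  have habs := abs_le.1 (h2.trans hinv)
  have hdiff : (y.2 - p.2) ^ 2 ≤ 2 + n * (s * nsq p.1) / 2 := by
    have h3 : (y.2 - p.2 - 2⁻¹ * symp p.1 y.1) ^ 2 ≤ 1 := by nlinarith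
    nlinarith [sq_nonneg (y.2 - p.2 - 2⁻¹ * symp p.1 y.1 - 2⁻¹ * symp p.1 y.1)]
  have hquot : (1 + y.2 ^ 2)⁻¹ ≤ 2 * (3 + n * (s * nsq p.1) / 2) * (1 + p.2 ^ 2)⁻¹ := by
    rw [← div_eq_mul_inv, inv_eq_one_div, div_le_div_iff₀ (by positivity) (by positivity)]
    nlinarith [sq_nonneg (2 * y.2 - p.2), mul_nonneg hnX (sq_nonneg y.2), sq_nonneg y.2]
  have hexp : Real.exp (-s * nsq y.1) ≤ Real.exp n * Real.exp (-(s * nsq p.1) / 2) := by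
    rw [← Real.exp_add, Real.exp_le_exp]
    have h4 := nsq_add_le y.1 (p.1 - y.1)
    rw [add_sub_cancel, nsq_sub_comm] at h4
    have h5 : s * nsq p.1 ≤ s * (2 * nsq y.1 + 2 * (n * s⁻¹)) := by gcongr; linarith
    have h6 : s * (2 * nsq y.1 + 2 * (n * s⁻¹)) = 2 * (s * nsq y.1) + 2 * n := by
      field_simp
    linarith
  have hpoly : 3 + n * (s * nsq p.1) / 2 ≤ (3 + 2 * n) * Real.exp (s * nsq p.1 / 4) := by
    have h7 := Real.add_one_le_exp (s * nsq p.1 / 4)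
    have h8 : 0 ≤ s * nsq p.1 := by positivity
    have h9 : (0 : ℝ) ≤ 3 + 2 * n := by positivity
    nlinarith [mul_le_mul_of_nonneg_left h7 h9]
  calc _ ≤ (Real.exp n * Real.exp (-(s * nsq p.1) / 2)) *
        (2 * ((3 + 2 * n) * Real.exp (s * nsq p.1 / 4)) * (1 + p.2 ^ 2)⁻¹) := by
        refine mul_le_mul hexp (hquot.trans (by gcongr)) (by positivity) (by positivity)
    _ = 2 * (3 + 2 * n) * Real.exp n *
        (Real.exp (-(s * nsq p.1) / 2) * Real.exp (s * nsq p.1 / 4) * (1 + p.2 ^ 2)⁻¹) := by ring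
    _ = _ := by rw [← Real.exp_add]; congr 4; ring

lemma volume_box_inv {n : ℕ} {r : ℝ} (hr : 0 < r) (y : Heis n) :
    volume {p : Heis n | ‖y.1 - p.1‖ ≤ r ∧ |y.2 - p.2 - 2⁻¹ * symp p.1 y.1| ≤ r ^ 2} =
      ENNReal.ofReal ((Real.pi * r ^ 2) ^ n * (2 * r ^ 2)) := by
  have hmeas : MeasurableSet
      {p : Heis n | ‖y.1 - p.1‖ ≤ r ∧ |y.2 - p.2 - 2⁻¹ * symp p.1 y.1| ≤ r ^ 2} :=
    (measurableSet_le (f := fun p : Heis n => ‖y.1 - p.1‖) (by fun_prop) measurable_const).inter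
      (measurableSet_le ((by fun_prop : Measurable fun p : Heis n =>
        y.2 - p.2 - 2⁻¹ * symp p.1 y.1).abs) measurable_const)
  rw [Measure.volume_eq_prod, Measure.prod_apply hmeas]
  have hslice (z : Fin n → ℂ) : volume (Prod.mk z ⁻¹'
      {p : Heis n | ‖y.1 - p.1‖ ≤ r ∧ |y.2 - p.2 - 2⁻¹ * symp p.1 y.1| ≤ r ^ 2}) =
      (Metric.closedBall y.1 r).indicator (fun _ => ENNReal.ofReal (2 * r ^ 2)) z := by
    by_cases hz : z ∈ Metric.closedBall y.1 r
    · rw [Set.indicator_of_mem hz, ← Real.volume_closedBall (y.2 - 2⁻¹ * symp z y.1)]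
      congr 1
      ext t
      rw [mem_closedBall_iff_norm'] at hz
      simp only [Set.mem_preimage, Set.mem_ofPred_eq, hz, true_and, mem_closedBall_iff_norm',
        Real.norm_eq_abs]
      rw [show y.2 - t - 2⁻¹ * symp z y.1 = y.2 - 2⁻¹ * symp z y.1 - t by ring]
    · rw [Set.indicator_of_notMem hz]
      rw [mem_closedBall_iff_norm'] at hz
      simp [hz]
  simp_rw [hslice]
  rw [lintegral_indicator_const Metric.isClosed_closedBall.measurableSet,
    volume_pi_closedBall _ hr.le]
  simp only [Complex.volume_closedBall, Finset.prod_const, Finset.card_univ, Fintype.card_fin]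
  have h : 0 ≤ (Real.pi * r ^ 2) ^ n := by positivity
  rw [ENNReal.ofReal_mul h, ENNReal.ofReal_pow (by positivity),
    ENNReal.ofReal_mul Real.pi_nonneg, ENNReal.ofReal_pow hr.le,
    ← NNReal.coe_real_pi, ENNReal.ofReal_coe_nnreal, mul_comm, mul_comm (ENNReal.ofReal r ^ 2)]
lemma lintegral_kernel_le {n : ℕ} (hn : 1 ≤ n) {c : ℝ} (hc : 0 < c) (m : Measure (Heis n))
    [IsFiniteMeasure m]
    (hm : ∀ (p : Heis n) (r : ℝ), 0 < r → m (Hball p r) ≤ ENNReal.ofReal (c * r ^ (2 * n + 2)))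
    {s : ℝ} (hs : 1 ≤ s) :
    ∫⁻ y, ENNReal.ofReal (Real.exp (-s * nsq y.1) * (1 + y.2 ^ 2)⁻¹) ∂m ≤
      ENNReal.ofReal (c * (n + 1) ^ (2 * n + 2) * ((3 + 2 * n) * Real.exp n) * 4 ^ n * Real.pi *
        (s ^ n)⁻¹) := by
  have hs0 : 0 < s := by linarith
  obtain ⟨r, hr, hrs⟩ : ∃ r : ℝ, 0 < r ∧ r ^ 2 = s⁻¹ :=
    ⟨(√s)⁻¹, by positivity, by rw [inv_pow, Real.sq_sqrt hs0.le]⟩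
  let E : Set (Heis n × Heis n) :=
    {x | ‖x.2.1 - x.1.1‖ ≤ r ∧ |x.2.2 - x.1.2 - 2⁻¹ * symp x.1.1 x.2.1| ≤ r ^ 2}
  have hE : MeasurableSet E :=
    (measurableSet_le (f := fun x : Heis n × Heis n => ‖x.2.1 - x.1.1‖)
      (by fun_prop) measurable_const).inter
      (measurableSet_le ((by fun_prop : Measurable fun x : Heis n × Heis n =>
        x.2.2 - x.1.2 - 2⁻¹ * symp x.1.1 x.2.1).abs) measurable_const)
  let F : Heis n → ENNReal := fun y =>
    ENNReal.ofReal (Real.exp (-s * nsq y.1) * (1 + y.2 ^ 2)⁻¹)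
  let G : Heis n → ENNReal := fun p => ENNReal.ofReal (2 * (3 + 2 * n) * Real.exp n *
    (Real.exp (-(s / 4) * nsq (p.1 - 0)) * (1 + p.2 ^ 2)⁻¹))
  have hF : Measurable F := by fun_prop
  have hG : Measurable G := by fun_prop
  let V : ENNReal := ENNReal.ofReal ((Real.pi * r ^ 2) ^ n * (2 * r ^ 2))
  have hV (y : Heis n) : ∫⁻ p, E.indicator (fun _ => 1) (p, y) = V := by
    refine Eq.trans ?_ (volume_box_inv hr y)
    refine Eq.trans ?_ (lintegral_indicator_one ?_)
    · rfl
    · exact (measurable_prodMk_right : Measurable fun p : Heis n => (p, y)) hE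
  have hball (p : Heis n) : ∫⁻ y, E.indicator (fun _ => 1) (p, y) ∂m ≤
      ENNReal.ofReal (c * ((n + 1) * r) ^ (2 * n + 2)) := by
    have : ∫⁻ y, E.indicator (fun _ => 1) (p, y) ∂m = m (Prod.mk p ⁻¹' E) := by
      rw [← lintegral_indicator_one (measurable_prodMk_left hE)]
      rfl
    rw [this]
    refine (measure_mono ?_).trans (hm p _ (by positivity))
    exact fun y hy => mem_Hball_of_mem hn hr hy.1 hy.2
  have hGint : ∫⁻ p, G p = ENNReal.ofReal (2 * (3 + 2 * n) * Real.exp n *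
      ((Real.pi / (s / 4)) ^ n * Real.pi)) := by
    rw [← ofReal_integral_eq_lintegral_ofReal]
    · rw [integral_const_mul, Measure.volume_eq_prod,
        integral_prod_mul (fun z : Fin n → ℂ => Real.exp (-(s / 4) * nsq (z - 0)))
          (fun t : ℝ => (1 + t ^ 2)⁻¹),
        integral_exp_neg_nsq (by positivity), integral_univ_inv_one_add_sq]
    · refine Integrable.const_mul ?_ _
      rw [Measure.volume_eq_prod]
      exact (integrable_exp_neg_nsq (by positivity) 0).mul_prod integrable_inv_one_add_sq
    · exact Filter.Eventually.of_forall fun p => by positivity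
  have hmain : V * ∫⁻ y, F y ∂m ≤ ENNReal.ofReal (c * ((n + 1) * r) ^ (2 * n + 2)) * ∫⁻ p, G p := by
    calc V * ∫⁻ y, F y ∂m = ∫⁻ y, (∫⁻ p, E.indicator (fun _ => 1) (p, y) * F y) ∂m := by
          rw [← lintegral_const_mul _ hF]
          refine lintegral_congr fun y => ?_
          rw [lintegral_mul_const' _ _ (by finiteness), hV]
      _ ≤ ∫⁻ y, (∫⁻ p, E.indicator (fun _ => 1) (p, y) * G p) ∂m := by
          refine lintegral_mono fun y => lintegral_mono fun p => ?_
          by_cases h : (p, y) ∈ E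
          · refine mul_le_mul_right (ENNReal.ofReal_le_ofReal ?_) _
            refine kernel_le_of_mem hs ?_ (hrs ▸ h.2)
            rw [← hrs]
            exact pow_le_pow_left₀ (norm_nonneg _) h.1 2
          · simp [h]
      _ = ∫⁻ p, (∫⁻ y, E.indicator (fun _ => 1) (p, y) * G p ∂m) := by
          refine lintegral_lintegral_swap (Measurable.aemeasurable ?_)
          have h1 : Measurable (E.indicator (fun _ => (1 : ENNReal))) :=
            measurable_const.indicator hE
          exact (h1.comp measurable_swap).mul (hG.comp measurable_snd)
      _ ≤ ∫⁻ p, ENNReal.ofReal (c * ((n + 1) * r) ^ (2 * n + 2)) * G p := by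
          refine lintegral_mono fun p => ?_
          rw [lintegral_mul_const' _ _ (by finiteness)]
          exact mul_le_mul_left (hball p) _
      _ = _ := lintegral_const_mul _ hG
  have hV0 : 0 < (Real.pi * r ^ 2) ^ n * (2 * r ^ 2) := by positivity
  rw [hGint, ← ENNReal.ofReal_mul (by positivity)] at hmain
  refine (ENNReal.mul_le_mul_iff_right (a := V) (ENNReal.ofReal_pos.2 hV0).ne' (by finiteness)).1
    (hmain.trans_eq ?_)
  rw [← ENNReal.ofReal_mul hV0.le]
  congr 1
  rw [mul_pow _ r, show r ^ (2 * n + 2) = (r ^ 2) ^ n * r ^ 2 by ring, hrs]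
  field_simp
  simp only [div_pow, mul_pow, one_pow]
  field_simp

/-! ### The signed point configuration -/

/-- The averaged box kernel, as a function of two points of the Heisenberg group. -/
def heisKernel {n : ℕ} (s : ℝ) (p q : Heis n) : ℝ :=
  freqKernel (p.2 - q.2 - 2⁻¹ * symp q.1 p.1) * Real.exp (-s * nsq (p.1 - q.1))

lemma heisKernel_nonneg {n : ℕ} (s : ℝ) (p q : Heis n) : 0 ≤ heisKernel s p q :=
  mul_nonneg (freqKernel_nonneg _) (Real.exp_nonneg _)

lemma heisKernel_self {n : ℕ} (s : ℝ) (p : Heis n) : heisKernel s p p = 1 := by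
  simp [heisKernel, symp_self, nsq]

lemma heisKernel_comm {n : ℕ} (s : ℝ) (p q : Heis n) : heisKernel s p q = heisKernel s q p := by
  rw [heisKernel, heisKernel, nsq_sub_comm, symp_antisymm q.1 p.1,
    show q.2 - p.2 - 2⁻¹ * -symp q.1 p.1 = q.2 - (p.2 - 2⁻¹ * symp q.1 p.1) by ring,
    freqKernel_sub_comm q.2]
  congr 2
  ring

lemma heisKernel_le {n : ℕ} (s : ℝ) (p q : Heis n) :
    heisKernel s p q ≤ 5 * (Real.exp (-s * nsq (Hmul (Hinv p) q).1) *
      (1 + (Hmul (Hinv p) q).2 ^ 2)⁻¹) := by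
  rw [heisKernel_comm, Hmul_Hinv, heisKernel]
  calc _ ≤ 5 * (1 + (q.2 - p.2 - 2⁻¹ * symp p.1 q.1) ^ 2)⁻¹ * Real.exp (-s * nsq (q.1 - p.1)) := by
        gcongr; exact freqKernel_le _
    _ = _ := by ring

lemma heisKernel_le_five {n : ℕ} {s : ℝ} (hs : 0 ≤ s) (p q : Heis n) : heisKernel s p q ≤ 5 := by
  refine (heisKernel_le s p q).trans ?_
  have h1 : Real.exp (-s * nsq (Hmul (Hinv p) q).1) ≤ 1 :=
    Real.exp_le_one_iff.2 (by nlinarith [nsq_nonneg (Hmul (Hinv p) q).1])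
  have h2 : (1 + (Hmul (Hinv p) q).2 ^ 2)⁻¹ ≤ 1 :=
    inv_le_one_of_one_le₀ (by nlinarith [sq_nonneg (Hmul (Hinv p) q).2])
  have := mul_le_mul h1 h2 (by positivity) zero_le_one
  linarith

@[fun_prop]
lemma measurable_heisKernel {X : Type*} [MeasurableSpace X] {n : ℕ} (s : ℝ) {p q : X → Heis n}
    (hp : Measurable p) (hq : Measurable q) : Measurable fun x => heisKernel s (p x) (q x) := by
  have h := continuous_freqKernel.measurable
  unfold heisKernel
  fun_prop

lemma measurable_koranyi {n : ℕ} : Measurable (koranyi : Heis n → ℝ) := by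
  have h : (koranyi : Heis n → ℝ) = fun p => (nsq p.1 ^ 2 + p.2 ^ 2) ^ ((1 : ℝ) / 4) :=
    funext fun p => by rw [koranyi, znorm_pow_four]
  rw [h]
  fun_prop

lemma measurableSet_Hball {n : ℕ} (p : Heis n) (r : ℝ) : MeasurableSet (Hball p r) :=
  measurableSet_lt (measurable_koranyi.comp (measurable_Hmul_Hinv p)) measurable_const

lemma exists_integral_heisKernel_le {n : ℕ} (hn : 1 ≤ n) {c : ℝ} (hc : 0 < c)
    (μ : Measure (Heis n)) [IsFiniteMeasure μ]
    (hμ : ∀ (p : Heis n) (r : ℝ), 0 < r → μ (Hball p r) ≤ ENNReal.ofReal (c * r ^ (2 * n + 2))) :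
    ∃ M > 0, ∀ s : ℝ, 1 ≤ s → ∀ p, ∫ q, heisKernel s p q ∂μ ≤ M * (s ^ n)⁻¹ := by
  refine ⟨5 * (c * (n + 1) ^ (2 * n + 2) * ((3 + 2 * n) * Real.exp n) * 4 ^ n * Real.pi),
    by positivity, fun s hs p => ?_⟩
  have hs0 : 0 < s := by linarith
  have hp := measurable_Hmul_Hinv p
  have key := lintegral_kernel_le hn hc (μ.map (Hmul (Hinv p))) (fun q r hr => by
    rw [Measure.map_apply hp (measurableSet_Hball q r)]
    refine (measure_mono fun x hx => ?_).trans (hμ (Hmul p q) r hr)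
    have hx' : koranyi (Hmul (Hinv q) (Hmul (Hinv p) x)) < r := hx
    rwa [Hmul_Hinv_Hmul_Hinv] at hx') hs
  rw [lintegral_map (by fun_prop) hp] at key
  rw [integral_eq_lintegral_of_nonneg_ae
    (Filter.Eventually.of_forall fun q => heisKernel_nonneg s p q)
    (measurable_heisKernel s measurable_const measurable_id).aestronglyMeasurable]
  refine ENNReal.toReal_le_of_le_ofReal (by positivity) ?_
  calc _ ≤ ∫⁻ q, ENNReal.ofReal 5 * ENNReal.ofReal (Real.exp (-s * nsq (Hmul (Hinv p) q).1) *
      (1 + (Hmul (Hinv p) q).2 ^ 2)⁻¹) ∂μ := by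
        refine lintegral_mono fun q => ?_
        rw [← ENNReal.ofReal_mul (by norm_num)]
        exact ENNReal.ofReal_le_ofReal (heisKernel_le s p q)
    _ ≤ _ := by
        rw [lintegral_const_mul' _ _ (by finiteness)]
        refine (mul_le_mul_right key _).trans_eq ?_
        rw [← ENNReal.ofReal_mul (by norm_num)]
        congr 1
        ring

/-- The positive measure underlying the signed measure `∑ δ_{pts j} - N μ`; the Boolean coordinate
records the sign. -/
def configMeasure {n N : ℕ} (μ : Measure (Heis n)) (pts : Fin N → Heis n) :
    Measure (Heis n × Bool) :=
  Measure.sum (fun j => Measure.dirac (pts j, true)) + (N : NNReal) • μ.map (fun q => (q, false))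

/-- The sign attached to a point of the configuration. -/
def configSign (b : Bool) : ℝ := if b then 1 else -1

@[fun_prop]
lemma measurable_configSign : Measurable configSign := .of_discrete

lemma abs_configSign (b : Bool) : |configSign b| = 1 := by
  cases b <;> simp [configSign]

instance {n N : ℕ} (μ : Measure (Heis n)) [IsFiniteMeasure μ] (pts : Fin N → Heis n) :
    IsFiniteMeasure (configMeasure μ pts) := by
  unfold configMeasure
  rw [Measure.sum_fintype]
  infer_instance

lemma integral_configSign_mul {n N : ℕ} (μ : Measure (Heis n)) [IsFiniteMeasure μ]
    (pts : Fin N → Heis n) {g : Heis n → ℝ} (hg : Measurable g) {K : ℝ} (hK : ∀ q, |g q| ≤ K) :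
    ∫ ω, configSign ω.2 * g ω.1 ∂configMeasure μ pts = ∑ j, g (pts j) - N * ∫ q, g q ∂μ := by
  have hm : Measurable fun ω : Heis n × Bool => configSign ω.2 * g ω.1 :=
    (measurable_configSign.comp measurable_snd).mul (hg.comp measurable_fst)
  have hint : Integrable (fun ω : Heis n × Bool => configSign ω.2 * g ω.1)
      (configMeasure μ pts) :=
    .of_bound hm.aestronglyMeasurable K (.of_forall fun ω => by
      rw [Real.norm_eq_abs, abs_mul, abs_configSign, one_mul]; exact hK _)
  rw [configMeasure] at hint ⊢
  rw [integral_add_measure hint.left_of_add_measure hint.right_of_add_measure,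
    integral_smul_nnreal_measure, Measure.sum_fintype, integral_finsetSum_measure,
    integral_map (by fun_prop) hm.aestronglyMeasurable]
  · simp only [integral_dirac' _ _ hm.stronglyMeasurable]
    simp [configSign, integral_neg, NNReal.smul_def, sub_eq_add_neg]
  · intro j _
    have := hint.left_of_add_measure
    rw [Measure.sum_fintype] at this
    exact (integrable_finsetSum_measure.1 this) j (Finset.mem_univ j)

lemma abs_heisKernel_le {n : ℕ} {s : ℝ} (hs : 0 ≤ s) (p q : Heis n) : |heisKernel s p q| ≤ 5 := by
  rw [abs_of_nonneg (heisKernel_nonneg s p q)]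
  exact heisKernel_le_five hs p q

lemma integrable_heisKernel {n : ℕ} {s : ℝ} (hs : 0 ≤ s) (μ : Measure (Heis n)) [IsFiniteMeasure μ]
    (p : Heis n) : Integrable (heisKernel s p) μ :=
  .of_bound (measurable_heisKernel s measurable_const measurable_id).aestronglyMeasurable 5
    (.of_forall (abs_heisKernel_le hs p))

/-- The potential of the signed measure `∑ δ_{pts j} - N μ` with respect to the kernel. -/
def configPotential {n N : ℕ} (μ : Measure (Heis n)) (pts : Fin N → Heis n) (s : ℝ)
    (p : Heis n) : ℝ :=
  ∑ k, heisKernel s p (pts k) - N * ∫ q, heisKernel s p q ∂μ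

lemma measurable_configPotential {n N : ℕ} (μ : Measure (Heis n)) [SFinite μ]
    (pts : Fin N → Heis n) (s : ℝ) : Measurable (configPotential μ pts s) := by
  have hW : Measurable (Function.uncurry (heisKernel (n := n) s)) :=
    measurable_heisKernel s measurable_fst measurable_snd
  have h : Measurable fun p => ∫ q, heisKernel s p q ∂μ :=
    (hW.stronglyMeasurable.integral_prod_right (ν := μ)).measurable
  unfold configPotential
  fun_prop

lemma abs_configPotential_le {n N : ℕ} (μ : Measure (Heis n)) [IsProbabilityMeasure μ]
    (pts : Fin N → Heis n) {s : ℝ} (hs : 0 ≤ s) (p : Heis n) :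
    |configPotential μ pts s p| ≤ N * 5 + N * 5 := by
  have havg : |∫ q, heisKernel s p q ∂μ| ≤ 5 := by
    simpa using norm_integral_le_of_norm_le_const (μ := μ) (f := heisKernel s p)
      (.of_forall (abs_heisKernel_le hs p))
  refine (abs_sub _ _).trans (add_le_add ?_ ?_)
  · refine (Finset.abs_sum_le_sum_abs _ _).trans ?_
    exact (Finset.sum_le_card_nsmul _ _ 5 fun k _ => abs_heisKernel_le hs _ _).trans_eq (by simp)
  · rw [abs_mul, abs_of_nonneg (N.cast_nonneg : (0 : ℝ) ≤ N)]
    gcongr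

lemma avgEnergy_config_eq {n N : ℕ} (μ : Measure (Heis n)) [IsProbabilityMeasure μ]
    (pts : Fin N → Heis n) {s : ℝ} (hs : 0 ≤ s) :
    avgEnergy (configMeasure μ pts) (fun ω => ω.1.1) (fun ω => ω.1.2)
      (fun ω => (configSign ω.2 : ℂ)) s =
    ∑ j, configPotential μ pts s (pts j) - N * ∫ p, configPotential μ pts s p ∂μ := by
  rw [← integral_configSign_mul μ pts (measurable_configPotential μ pts s)
    (abs_configPotential_le μ pts hs), avgEnergy]
  have hre (x : (Heis n × Bool) × (Heis n × Bool)) :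
      (configSign x.1.2 : ℂ) * (starRingEnd ℂ) (configSign x.2.2 : ℂ) *
      ((freqKernel (x.1.1.2 - x.2.1.2 - 2⁻¹ * symp x.2.1.1 x.1.1.1) *
        Real.exp (-s * nsq (x.1.1.1 - x.2.1.1)) : ℝ) : ℂ) =
      ((configSign x.1.2 * (configSign x.2.2 * heisKernel s x.1.1 x.2.1) : ℝ) : ℂ) := by
    rw [Complex.conj_ofReal, ← mul_assoc (configSign _), ← Complex.ofReal_mul, ← Complex.ofReal_mul]
    rfl
  simp_rw [hre]
  rw [integral_complex_ofReal, Complex.ofReal_re, integral_prod]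
  · refine integral_congr_ae (.of_forall fun ω => ?_)
    simp only
    rw [integral_const_mul, integral_configSign_mul μ pts (g := heisKernel s ω.1)
      (measurable_heisKernel s measurable_const measurable_id) (abs_heisKernel_le hs ω.1)]
    rfl
  · refine .of_bound (Measurable.aestronglyMeasurable (by fun_prop)) 5 (.of_forall fun x => ?_)
    rw [Real.norm_eq_abs, abs_mul, abs_mul, abs_configSign, abs_configSign, one_mul, one_mul]
    exact abs_heisKernel_le hs _ _

/-- The energy of the configuration is at least its diagonal part, up to a small error. -/
lemma le_avgEnergy_config {n N : ℕ} (μ : Measure (Heis n)) [IsProbabilityMeasure μ]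
    (pts : Fin N → Heis n) {s M : ℝ} (hs : 0 ≤ s)
    (hM : ∀ p, ∫ q, heisKernel s p q ∂μ ≤ M) :
    N - 2 * N ^ 2 * M ≤ avgEnergy (configMeasure μ pts) (fun ω => ω.1.1) (fun ω => ω.1.2)
      (fun ω => (configSign ω.2 : ℂ)) s := by
  have hN0 : (0 : ℝ) ≤ N := N.cast_nonneg
  have h1 : ∑ j, configPotential μ pts s (pts j) ≥ N - N ^ 2 * M := by
    have (j : Fin N) : 1 - N * M ≤ configPotential μ pts s (pts j) := by
      have h2 : (1 : ℝ) ≤ ∑ k, heisKernel s (pts j) (pts k) := by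
        rw [← heisKernel_self s (pts j)]
        exact Finset.single_le_sum (f := fun k => heisKernel s (pts j) (pts k))
          (fun k _ => heisKernel_nonneg s _ _) (Finset.mem_univ j)
      exact sub_le_sub h2 (mul_le_mul_of_nonneg_left (hM (pts j)) hN0)
    have := Finset.card_nsmul_le_sum Finset.univ
      (fun j => configPotential μ pts s (pts j)) _ fun j _ => this j
    simp only [Finset.card_univ, Fintype.card_fin, nsmul_eq_mul] at this
    nlinarith
  have h2 : ∫ p, configPotential μ pts s p ∂μ ≤ N * M := by
    have h3 (k : Fin N) : Integrable (fun p => heisKernel s p (pts k)) μ := by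
      simpa only [heisKernel_comm s _ (pts k)] using integrable_heisKernel hs μ (pts k)
    calc _ ≤ ∫ p, ∑ k, heisKernel s p (pts k) ∂μ := by
          refine integral_mono
            (.of_bound (measurable_configPotential μ pts s).aestronglyMeasurable _
              (.of_forall (abs_configPotential_le μ pts hs)))
            (integrable_finsetSum _ fun k _ => h3 k) fun p => ?_
          exact sub_le_self _ (mul_nonneg hN0 (integral_nonneg (heisKernel_nonneg s p)))
      _ = ∑ k, ∫ p, heisKernel s (pts k) p ∂μ := by
          rw [integral_finsetSum _ fun k _ => h3 k]
          simp only [heisKernel_comm s _ (pts _)]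
      _ ≤ N * M := (Finset.sum_le_card_nsmul _ _ M fun k _ => hM _).trans_eq (by simp)
  have h4 := mul_le_mul_of_nonneg_left h2 hN0
  rw [avgEnergy_config_eq μ pts hs]
  nlinarith

lemma measurableSet_Htranslate_Hbox {n : ℕ} (p : Heis n) (ρ : ℝ) :
    MeasurableSet (Htranslate p (Hbox n ρ)) := by
  refine measurable_Hmul_Hinv p (?_ : MeasurableSet (Hbox n ρ))
  exact (measurableSet_le (f := fun p : Heis n => √(nsq p.1)) (by fun_prop) measurable_const).inter
    (measurableSet_le (f := fun p : Heis n => |p.2|) measurable_snd.abs measurable_const)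

lemma ofReal_disc_eq_boxSum {n N : ℕ} (μ : Measure (Heis n)) [IsFiniteMeasure μ]
    (pts : Fin N → Heis n) {ρ : ℝ} (hρ : 0 ≤ ρ) (z : Fin n → ℂ) (t : ℝ) :
    (disc μ pts (z, t) ρ : ℂ) = boxSum (configMeasure μ pts) (fun ω => ω.1.1) (fun ω => ω.1.2)
      (fun ω => (configSign ω.2 : ℂ)) (ρ ^ 2) z t := by
  set S := Htranslate (z, t) (Hbox n ρ) with hS
  have hSm : MeasurableSet S := measurableSet_Htranslate_Hbox _ _
  have hg (q : Heis n) : |S.indicator (fun _ => (1 : ℝ)) q| ≤ 1 := by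
    by_cases h : q ∈ S <;> simp [h]
  have h1 := integral_configSign_mul μ pts (measurable_const.indicator hSm) hg
  rw [integral_indicator_const _ hSm, smul_eq_mul, mul_one, measureReal_def] at h1
  rw [disc, ← hS, ← h1, ← integral_complex_ofReal, boxSum]
  refine integral_congr_ae (.of_forall fun ω => ?_)
  simp only
  rw [Complex.ofReal_mul]
  congr 1
  have hmem : ω.1 ∈ S ↔ nsq (z - ω.1.1) ≤ ρ ^ 2 ∧ |ω.1.2 - 2⁻¹ * symp z ω.1.1 - t| ≤ ρ ^ 2 := by
    change Hmul (Hinv (z, t)) ω.1 ∈ Hbox n ρ ↔ _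
    rw [Hmul_Hinv]
    change √(nsq (ω.1.1 - z)) ≤ ρ ∧ |ω.1.2 - t - 2⁻¹ * symp z ω.1.1| ≤ ρ ^ 2 ↔ _
    rw [Real.sqrt_le_left hρ, nsq_sub_comm, sub_right_comm]
  by_cases ha : nsq (z - ω.1.1) ≤ ρ ^ 2 <;>
    by_cases hb : |ω.1.2 - 2⁻¹ * symp z ω.1.1 - t| ≤ ρ ^ 2 <;>
    simp [hmem, ha, hb]

/-! ### Passing to Bochner integrals -/

/-- The square function of the configuration at scale `ρ`. -/
def configSquare {n N : ℕ} (μ : Measure (Heis n)) (pts : Fin N → Heis n) (ρ : ℝ) : ENNReal :=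
  ∫⁻ z, ∫⁻ t, ‖boxSum (configMeasure μ pts) (fun ω => ω.1.1) (fun ω => ω.1.2)
    (fun ω => (configSign ω.2 : ℂ)) (ρ ^ 2) z t‖ₑ ^ 2

section

variable {n N : ℕ} (μ : Measure (Heis n)) [IsFiniteMeasure μ] (pts : Fin N → Heis n)

lemma measurable_boxSum_config {X : Type*} [MeasurableSpace X] {A t : X → ℝ}
    {z : X → Fin n → ℂ} (hA : Measurable A) (ht : Measurable t) (hz : Measurable z) :
    Measurable fun x => boxSum (configMeasure μ pts) (fun ω => ω.1.1) (fun ω => ω.1.2)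
      (fun ω => (configSign ω.2 : ℂ)) (A x) (z x) (t x) :=
  measurable_boxSum_param _ (by fun_prop) (by fun_prop) (by fun_prop) hA ht hz

lemma measurable_configSquare : Measurable (configSquare μ pts) := by
  have h : Measurable fun x : (ℝ × (Fin n → ℂ)) × ℝ =>
      ‖boxSum (configMeasure μ pts) (fun ω => ω.1.1) (fun ω => ω.1.2)
        (fun ω => (configSign ω.2 : ℂ)) (x.1.1 ^ 2) x.1.2 x.2‖ₑ ^ 2 :=
    (measurable_boxSum_config μ pts (by fun_prop) (by fun_prop) (by fun_prop)).enorm.pow_const 2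
  exact h.lintegral_prod_right'.lintegral_prod_right'

lemma configSquare_eq (ρ : ℝ) : configSquare μ pts ρ =
    ∫⁻ p : Heis n, ‖boxSum (configMeasure μ pts) (fun ω => ω.1.1) (fun ω => ω.1.2)
      (fun ω => (configSign ω.2 : ℂ)) (ρ ^ 2) p.1 p.2‖ₑ ^ 2 := by
  rw [Measure.volume_eq_prod, lintegral_prod]
  · rfl
  · exact ((measurable_boxSum_config μ pts (by fun_prop) (by fun_prop)
      (by fun_prop)).enorm.pow_const 2).aemeasurable

lemma integral_disc_sq_eq {ρ : ℝ} (hρ : 0 ≤ ρ) :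
    ∫ p : Heis n, disc μ pts p ρ ^ 2 = (configSquare μ pts ρ).toReal := by
  have hd (p : Heis n) : disc μ pts p ρ = (boxSum (configMeasure μ pts) (fun ω => ω.1.1)
      (fun ω => ω.1.2) (fun ω => (configSign ω.2 : ℂ)) (ρ ^ 2) p.1 p.2).re := by
    rw [← ofReal_disc_eq_boxSum μ pts hρ, Complex.ofReal_re]
  have hm : Measurable fun p => disc μ pts p ρ := by
    simp_rw [hd]
    exact Complex.measurable_re.comp
      (measurable_boxSum_config μ pts measurable_const measurable_snd measurable_fst)
  rw [integral_eq_lintegral_of_nonneg_ae (.of_forall fun p => sq_nonneg _)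
    (hm.pow_const 2).aestronglyMeasurable, configSquare_eq]
  congr 1
  refine lintegral_congr fun p => ?_
  rw [← ofReal_disc_eq_boxSum μ pts hρ, ← sq_abs, ENNReal.ofReal_pow (abs_nonneg _),
    ← ofReal_norm, Complex.norm_real, Real.norm_eq_abs]

lemma configSquare_le {ρ : ℝ} (hρ : ρ ∈ Set.Icc (0 : ℝ) 1) :
    configSquare μ pts ρ ≤ configMeasure μ pts Set.univ *
      (ENNReal.ofReal ((Real.pi * 1 ^ 2) ^ n * (2 * 1 ^ 2)) * configMeasure μ pts Set.univ) := by
  set P := configMeasure μ pts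
  let E : Set (Heis n × (Heis n × Bool)) :=
    {x | ‖x.2.1.1 - x.1.1‖ ≤ 1 ∧ |x.2.1.2 - x.1.2 - 2⁻¹ * symp x.1.1 x.2.1.1| ≤ 1 ^ 2}
  have hE : MeasurableSet E :=
    (measurableSet_le (f := fun x : Heis n × (Heis n × Bool) => ‖x.2.1.1 - x.1.1‖)
      (by fun_prop) measurable_const).inter
      (measurableSet_le ((by fun_prop : Measurable fun x : Heis n × (Heis n × Bool) =>
        x.2.1.2 - x.1.2 - 2⁻¹ * symp x.1.1 x.2.1.1).abs) measurable_const)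
  have hρ2 : ρ ^ 2 ≤ 1 := by nlinarith [hρ.1, hρ.2]
  have hb (p : Heis n) : ‖boxSum P (fun ω => ω.1.1) (fun ω => ω.1.2)
      (fun ω => (configSign ω.2 : ℂ)) (ρ ^ 2) p.1 p.2‖ₑ ≤ P (Prod.mk p ⁻¹' E) := by
    rw [← lintegral_indicator_one (measurable_prodMk_left hE)]
    refine (enorm_integral_le_lintegral_enorm _).trans (lintegral_mono fun ω => ?_)
    by_cases hω : ω ∈ Prod.mk p ⁻¹' E
    · rw [Set.indicator_of_mem hω, ← ofReal_norm, norm_mul, norm_mul, Complex.norm_real,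
        Real.norm_eq_abs, abs_configSign, one_mul, Pi.one_apply, ENNReal.ofReal_le_one]
      exact mul_le_one₀ (norm_indicator_Iic_le _ _) (norm_nonneg _) (norm_indicator_Iic_le _ _)
    · rw [Set.indicator_of_notMem hω, nonpos_iff_eq_zero, enorm_eq_zero]
      by_contra h
      refine hω ⟨?_, ?_⟩
      · have h1 : nsq (p.1 - ω.1.1) ≤ ρ ^ 2 := by
          by_contra h1
          exact h (by simp [h1])
        refine (pi_norm_le_iff_of_nonneg zero_le_one).2 fun j => ?_
        have h2 : ‖(p.1 - ω.1.1) j‖ ^ 2 ≤ nsq (p.1 - ω.1.1) :=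
          Finset.single_le_sum (f := fun j => ‖(p.1 - ω.1.1) j‖ ^ 2)
            (fun _ _ => sq_nonneg _) (Finset.mem_univ j)
        simp only [Pi.sub_apply] at h2 ⊢
        rw [norm_sub_rev]
        exact (sq_le_one_iff₀ (norm_nonneg _)).1 (h2.trans (h1.trans hρ2))
      · have h1 : |ω.1.2 - 2⁻¹ * symp p.1 ω.1.1 - p.2| ≤ ρ ^ 2 := by
          by_contra h1
          exact h (by simp [h1])
        rw [sub_right_comm, one_pow]
        exact h1.trans hρ2
  rw [configSquare_eq]
  calc _ ≤ ∫⁻ p : Heis n, P Set.univ * P (Prod.mk p ⁻¹' E) := by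
        refine lintegral_mono fun p => ?_
        rw [sq]
        exact mul_le_mul' ((hb p).trans (measure_mono (Set.subset_univ _))) (hb p)
    _ = P Set.univ * (volume.prod P) E := by
        rw [lintegral_const_mul' _ _ (by finiteness), Measure.prod_apply hE]
    _ = P Set.univ * ∫⁻ ω, ENNReal.ofReal ((Real.pi * 1 ^ 2) ^ n * (2 * 1 ^ 2)) ∂P := by
        rw [Measure.prod_apply_symm hE]
        congr 1
        exact lintegral_congr fun ω => volume_box_inv one_pos ω.1
    _ = _ := by rw [lintegral_const]

lemma lintegral_configSquare :
    ∫⁻ ρ in Set.Ioc (0 : ℝ) 1, configSquare μ pts ρ =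
      ENNReal.ofReal (∫ ρ in (0 : ℝ)..1, ∫ p : Heis n, disc μ pts p ρ ^ 2) := by
  rw [intervalIntegral.integral_of_le zero_le_one,
    setIntegral_congr_fun measurableSet_Ioc fun ρ hρ => integral_disc_sq_eq μ pts hρ.1.le,
    integral_toReal (measurable_configSquare μ pts).aemeasurable, ENNReal.ofReal_toReal]
  · refine ((setLIntegral_mono measurable_const fun ρ hρ =>
      configSquare_le μ pts (Set.Ioc_subset_Icc_self hρ)).trans_lt ?_).ne
    rw [setLIntegral_const, Real.volume_Ioc]
    finiteness
  · refine (ae_restrict_mem measurableSet_Ioc).mono fun ρ hρ => ?_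
    refine (configSquare_le μ pts (Set.Ioc_subset_Icc_self hρ)).trans_lt ?_
    finiteness

end

/-- Roth-type lower bound for the quadratic discrepancy of upper
Ahlfors regular probability measures on the Heisenberg group: there are `C > 0` and
`N₀` such that for every `N ≥ N₀` and every choice of `N` points in `ℍⁿ`,
`∫₀¹ ∫_{ℍⁿ} |D_N(z,t;ρ)|² dz dt dρ ≥ C·N^{1 − 1/(Q−2)}`, `Q = 2n+2`. -/
theorem quadratic_discrepancy_lower_bound
    (n : ℕ) (hn : 1 ≤ n) (μ : Measure (Heis n)) [IsProbabilityMeasure μ]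
    (c : ℝ) (hc : 0 < c)
    (hAhlfors : ∀ (p : Heis n) (r : ℝ), 0 < r →
      μ (Hball p r) ≤ ENNReal.ofReal (c * r ^ (2 * n + 2))) :
    ∃ C > (0 : ℝ), ∃ N₀ : ℕ, ∀ N : ℕ, N₀ ≤ N → ∀ pts : Fin N → Heis n,
      C * (N : ℝ) ^ ((1 : ℝ) - 1 / ((2 * (n : ℝ) + 2) - 2)) ≤
        ∫ ρ in (0 : ℝ)..1, ∫ p : Heis n, (disc μ pts p ρ) ^ 2 := by
  obtain ⟨c₀, hc₀, henergy⟩ := exists_avgEnergy_le n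
  obtain ⟨M, hM, hpot⟩ := exists_integral_heisKernel_le hn hc μ hAhlfors
  have hn0 : (0 : ℝ) < 2 * n := by
    have : (1 : ℝ) ≤ n := by exact_mod_cast hn
    linarith
  refine ⟨c₀ / 2 * (4 * M) ^ (-(1 / (2 * n : ℝ))), by positivity, ⌈(4 * M)⁻¹⌉₊ + 1,
    fun N hN pts => ?_⟩
  have hN1 : (1 : ℝ) ≤ N := by
    exact_mod_cast (Nat.le_add_left 1 _).trans hN
  have hN0 : (0 : ℝ) < N := by linarith
  have hMN : 1 ≤ 4 * M * N := by
    have h1 : (4 * M)⁻¹ ≤ N := (Nat.le_ceil _).trans (by exact_mod_cast (Nat.le_succ _).trans hN)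
    calc 1 = 4 * M * (4 * M)⁻¹ := (mul_inv_cancel₀ (by positivity)).symm
      _ ≤ _ := by gcongr
  set B : ℝ := (4 * M * N) ^ (1 / (2 * n : ℝ)) with hB
  have hB1 : 1 ≤ B := Real.one_le_rpow hMN (by positivity)
  have hB0 : 0 < B := by linarith
  have hBn : (B ^ 2) ^ n = 4 * M * N := by
    rw [← pow_mul, ← Real.rpow_natCast, hB, ← Real.rpow_mul (by positivity)]
    push_cast
    rw [one_div_mul_cancel hn0.ne', Real.rpow_one]
  have havg : (N : ℝ) / 2 ≤ avgEnergy (configMeasure μ pts) (fun ω => ω.1.1) (fun ω => ω.1.2)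
      (fun ω => (configSign ω.2 : ℂ)) (B ^ 2) := by
    refine le_trans ?_ (le_avgEnergy_config μ pts (sq_nonneg B) (hpot (B ^ 2) (one_le_pow₀ hB1)))
    rw [hBn]
    refine le_of_eq ?_
    field_simp
    ring
  have hle := henergy (configMeasure μ pts) (fun ω => ω.1.1) (fun ω => ω.1.2)
    (fun ω => (configSign ω.2 : ℂ)) (by fun_prop) (by fun_prop) (by fun_prop)
    (fun ω => by rw [Complex.norm_real, Real.norm_eq_abs, abs_configSign]) B hB1
  have hI : 0 ≤ ∫ ρ in (0 : ℝ)..1, ∫ p : Heis n, disc μ pts p ρ ^ 2 :=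
    intervalIntegral.integral_nonneg zero_le_one fun ρ _ => integral_nonneg fun p => sq_nonneg _
  have hle' := (ENNReal.ofReal_le_ofReal_iff hI).1 (hle.trans_eq (lintegral_configSquare μ pts))
  refine le_trans (le_of_eq ?_) ((mul_le_mul_of_nonneg_left havg (by positivity)).trans hle')
  rw [add_sub_cancel_right, Real.rpow_sub hN0, Real.rpow_one, hB,
    Real.mul_rpow (by positivity) hN0.le, Real.rpow_neg (by positivity)]
  field_simp
end
end

section
/- Let n ≥ 1 and Q = 2n+2. Let F ⊆ ℍⁿ be a Borel set of Lebesgue measure 1 and let μ be the restriction of Lebesgue measure to F. Assume there exist c₁, c₂ > 0 such that c₁·r^Q ≤ μ(𝔅_r(p)) ≤ c₂·r^Q for every p ∈ F and every 0 < r < diam(F). Then there exists C > 0 such that for every sufficiently large N there exists a finite sequence of points (ζ₁,τ₁),…,(ζ_N,τ_N) ∈ ℍⁿ with ∫₀^{diam(F)} ∫_F |D_N(z,t;ρ)|² dz dt dρ ≤ C · N^{1 − 1/Q}. -/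
open MeasureTheory Complex

noncomputable section

/-- The diameter of a set `F ⊆ ℍⁿ` with respect to the Korányi distance. -/
def Hdiam {n : ℕ} (F : Set (Heis n)) : ℝ := sSup (Set.image2 Hdist F F)

lemma exists_nsmul_add_of_finite {X : Type*} [MeasurableSpace X] (κ : Measure X)
    [IsFiniteMeasure κ] :
    ∃ (k : ℕ) (η κ' : Measure X), κ = k • η + κ' ∧ κ' Set.univ ≤ 1 ∧
      (k ≠ 0 → IsProbabilityMeasure η) ∧ η ≪ κ := by
  have hfin : κ Set.univ ≠ ⊤ := measure_ne_top _ _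
  set k := ⌊(κ Set.univ).toReal⌋₊ with hk
  have hle : (k : ENNReal) ≤ κ Set.univ := by
    rw [← ENNReal.ofReal_toReal hfin, ← ENNReal.ofReal_natCast]
    exact ENNReal.ofReal_le_ofReal (Nat.floor_le ENNReal.toReal_nonneg)
  have hlt : κ Set.univ ≤ k + 1 := by
    rw [← ENNReal.ofReal_toReal hfin, ← ENNReal.ofReal_natCast, ← ENNReal.ofReal_one,
      ← ENNReal.ofReal_add (by positivity) (by positivity)]
    exact ENNReal.ofReal_le_ofReal (Nat.lt_floor_add_one _).le
  by_cases h0 : κ Set.univ = 0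
  · refine ⟨0, κ, κ, by simp, by simp [h0], by simp, Measure.AbsolutelyContinuous.rfl⟩
  refine ⟨k, (κ Set.univ)⁻¹ • κ, ((κ Set.univ - k) * (κ Set.univ)⁻¹) • κ, ?_, ?_, ?_,
    Measure.smul_absolutelyContinuous⟩
  · rw [← Nat.cast_smul_eq_nsmul ENNReal, smul_smul, ← add_smul, ← add_mul,
      add_tsub_cancel_of_le hle, ENNReal.mul_inv_cancel h0 hfin, one_smul]
  · rw [Measure.smul_apply, smul_eq_mul, mul_assoc, ENNReal.inv_mul_cancel h0 hfin, mul_one]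
    exact tsub_le_iff_left.2 hlt
  · exact fun _ => ⟨by rw [Measure.smul_apply, smul_eq_mul, ENNReal.inv_mul_cancel h0 hfin]⟩

lemma exists_list_add_of_cover {X ι : Type*} [MeasurableSpace X] (E : ι → Set X)
    (hE : ∀ i, MeasurableSet (E i)) (s : Finset ι) (ν : Measure X) [IsFiniteMeasure ν]
    (hν : ν (⋃ i ∈ s, E i)ᶜ = 0) :
    ∃ (L : List (Measure X)) (ν' : Measure X), ν = L.sum + ν' ∧ ν' Set.univ ≤ s.card ∧
      ∀ m ∈ L, IsProbabilityMeasure m ∧ ∃ i ∈ s, m (E i)ᶜ = 0 := by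
  classical
  induction s using Finset.induction_on generalizing ν with
  | empty =>
    refine ⟨[], 0, ?_, by simp, by simp⟩
    simpa using hν
  | insert i s hi ih =>
    obtain ⟨L, ν₁, h₁, h₂, h₃⟩ := ih (ν.restrict (E i)ᶜ) (by
      rw [Measure.restrict_apply' (hE i).compl]
      refine measure_mono_null ?_ hν
      intro x hx
      simp only [Finset.set_biUnion_insert, Set.mem_compl_iff, Set.mem_union, not_or]
      exact ⟨hx.2, hx.1⟩)
    obtain ⟨k, η, ν₂, g₁, g₂, g₃, g₄⟩ := exists_nsmul_add_of_finite (ν.restrict (E i))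
    refine ⟨List.replicate k η ++ L, ν₂ + ν₁, ?_, ?_, ?_⟩
    · rw [← Measure.restrict_add_restrict_compl (μ := ν) (hE i), g₁, h₁, List.sum_append,
        List.sum_replicate]
      abel
    · rw [Finset.card_insert_of_notMem hi, Measure.add_apply]
      push_cast
      rw [add_comm]
      exact add_le_add h₂ g₂
    · intro m hm
      rcases List.mem_append.1 hm with hm | hm
      · obtain ⟨hk, rfl⟩ := List.mem_replicate.1 hm
        refine ⟨g₃ hk, i, by simp, g₄ ?_⟩
        rw [Measure.restrict_apply' (hE i)]
        simp
      · obtain ⟨a, j, hj, b⟩ := h₃ m hm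
        exact ⟨a, j, by simp [hj], b⟩

/-- A probability measure carried by a set on which `G` is at most `w`. -/
def HasWidth {X : Type*} [MeasurableSpace X] (G : X → X → ℝ) (m : Measure X) (w : ℝ) : Prop :=
  IsProbabilityMeasure m ∧
    ∃ E : Set X, m Eᶜ = 0 ∧ ∀ x ∈ E, ∀ y ∈ E, G x y ≤ w

lemma list_sum_univ {X : Type*} [MeasurableSpace X] (L : List (Measure X))
    (h : ∀ m ∈ L, IsProbabilityMeasure m) : L.sum Set.univ = L.length := by
  induction L with
  | nil => simp
  | cons a L ih =>
    have := h a (by simp)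
    rw [List.sum_cons, Measure.add_apply, ih fun m hm => h m (by simp [hm])]
    simp [add_comm]

lemma exists_list_width_le {X : Type*} [MeasurableSpace X] (G : X → X → ℝ) {F : Set X}
    {A D : ℝ} (hA : 0 ≤ A) (hD : 0 ≤ D) {q : ℕ} (hq : 1 ≤ q)
    (hG : ∀ x ∈ F, ∀ y ∈ F, G x y ≤ D)
    (hcover : ∀ k : ℕ, ∃ (s : Finset X) (E : X → Set X), (s.card : ℝ) ≤ A * (2 ^ k) ^ (q + 1) ∧
      (∀ i, MeasurableSet (E i)) ∧ F ⊆ ⋃ i ∈ s, E i ∧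
      ∀ i ∈ s, ∀ x ∈ E i, ∀ y ∈ E i, G x y ≤ D / 2 ^ k)
    (k m : ℕ) (ν : Measure X) (hm : ν Set.univ = m) (hν : ν Fᶜ = 0) :
    ∃ L : List (Measure X × ℝ), (L.map Prod.fst).sum = ν ∧
      (∀ a ∈ L, HasWidth G a.1 a.2) ∧
      (L.map Prod.snd).sum ≤ D * m / 2 ^ k + 4 * A * D * (2 ^ k) ^ q := by
  induction k generalizing m ν with
  | zero =>
    refine ⟨List.replicate m ((m : ENNReal)⁻¹ • ν, D), ?_, ?_, ?_⟩
    · simp only [List.map_replicate, List.sum_replicate]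
      rcases eq_or_ne m 0 with rfl | h
      · simp only [Nat.cast_zero, Measure.measure_univ_eq_zero] at hm
        simp [hm]
      · rw [← Nat.cast_smul_eq_nsmul ENNReal, smul_smul,
          ENNReal.mul_inv_cancel (by simpa) (by simp), one_smul]
    · intro a ha
      obtain ⟨h, rfl⟩ := List.mem_replicate.1 ha
      exact ⟨⟨by rw [Measure.smul_apply, hm, smul_eq_mul,
        ENNReal.inv_mul_cancel (by simpa) (by simp)]⟩, F, by simp [hν], hG⟩
    · simp only [List.map_replicate, List.sum_replicate, nsmul_eq_mul]
      have : 0 ≤ 4 * A * D := by positivity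
      simp
      linarith
  | succ k ih =>
    obtain ⟨s, E, hs, hE, hF, hw⟩ := hcover (k + 1)
    have : IsFiniteMeasure ν := ⟨by simp [hm]⟩
    obtain ⟨L, ν', h₁, h₂, h₃⟩ := exists_list_add_of_cover E hE s ν
      (measure_mono_null (Set.compl_subset_compl.2 hF) hν)
    have hlen := list_sum_univ L fun m hm => (h₃ m hm).1
    have htot : (m : ENNReal) = L.length + ν' Set.univ := by
      rw [← hm, h₁, Measure.add_apply, hlen]
    have hpm : L.length ≤ m := by
      have : (L.length : ENNReal) ≤ m := by rw [htot]; exact le_self_add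
      exact_mod_cast this
    have hν'm : ν' Set.univ = (m - L.length : ℕ) := by
      rw [ENNReal.natCast_sub, htot, ENNReal.add_sub_cancel_left (by simp)]
    obtain ⟨L', g₁, g₂, g₃⟩ := ih (m - L.length) ν' hν'm (by
      rw [h₁, Measure.add_apply] at hν
      exact (add_eq_zero.1 hν).2)
    refine ⟨L.map (fun a => (a, D / 2 ^ (k + 1))) ++ L', ?_, ?_, ?_⟩
    · rw [List.map_append, List.sum_append, g₁, h₁]
      simp [Function.comp_def]
    · intro a ha
      rcases List.mem_append.1 ha with ha | ha
      · obtain ⟨b, hb, rfl⟩ := List.mem_map.1 ha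
        obtain ⟨hp, i, hi, h0⟩ := h₃ b hb
        exact ⟨hp, E i, h0, hw i hi⟩
      · exact g₂ a ha
    · rw [List.map_append, List.sum_append]
      have hc : ((m - L.length : ℕ) : ℝ) ≤ A * (2 ^ (k + 1)) ^ (q + 1) := by
        refine le_trans ?_ hs
        have : ((m - L.length : ℕ) : ENNReal) ≤ s.card := hν'm ▸ h₂
        exact_mod_cast this
      have e1 : ((L.map (fun a => (a, D / 2 ^ (k + 1)))).map Prod.snd).sum
          ≤ D * m / 2 ^ (k + 1) := by
        simp only [List.map_map, Function.comp_def, List.map_const', List.sum_replicate,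
          nsmul_eq_mul]
        have : (L.length : ℝ) ≤ m := by exact_mod_cast hpm
        calc (L.length : ℝ) * (D / 2 ^ (k + 1)) ≤ m * (D / 2 ^ (k + 1)) := by gcongr
          _ = _ := by ring
      have e2 : D * ((m - L.length : ℕ) : ℝ) / 2 ^ k ≤ 2 * A * D * (2 ^ (k + 1)) ^ q := by
        calc D * ((m - L.length : ℕ) : ℝ) / 2 ^ k
            ≤ D * (A * (2 ^ (k + 1)) ^ (q + 1)) / 2 ^ k := by gcongr
          _ = _ := by
            rw [pow_succ _ q]
            nth_rewrite 2 [pow_succ 2 k]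
            field_simp
      have e3 : 2 * ((2 : ℝ) ^ k) ^ q ≤ (2 ^ (k + 1)) ^ q := by
        rw [pow_succ 2 k, mul_pow, mul_comm]
        gcongr
        calc (2 : ℝ) = 2 ^ 1 := by norm_num
          _ ≤ 2 ^ q := pow_le_pow_right₀ (by norm_num) hq
      have e4 := mul_le_mul_of_nonneg_left e3 (show 0 ≤ 2 * A * D by positivity)
      linarith

/-- The gauge of `p⁻¹∘q` whose closed balls are the translates `p∘B_ρ`. -/
def boxDist {n : ℕ} (p q : Heis n) : ℝ :=
  max (znorm (Hmul (Hinv p) q).1) (Real.sqrt |(Hmul (Hinv p) q).2|)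

lemma znorm_eq_norm {n : ℕ} (z : Fin n → ℂ) : znorm z = ‖WithLp.toLp 2 z‖ := by
  rw [EuclideanSpace.norm_eq]; rfl

lemma znorm_nonneg {n : ℕ} (z : Fin n → ℂ) : 0 ≤ znorm z := Real.sqrt_nonneg _

lemma znorm_neg {n : ℕ} (z : Fin n → ℂ) : znorm (-z) = znorm z := by simp [znorm]

lemma znorm_add_le {n : ℕ} (z w : Fin n → ℂ) : znorm (z + w) ≤ znorm z + znorm w := by
  simp only [znorm_eq_norm, WithLp.toLp_add]
  exact norm_add_le _ _

lemma abs_im_sum_mul_conj_le {n : ℕ} (z w : Fin n → ℂ) :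
    |(∑ j, z j * (starRingEnd ℂ) (w j)).im| ≤ znorm z * znorm w := by
  have h := norm_inner_le_norm (𝕜 := ℂ) (WithLp.toLp 2 w) (WithLp.toLp 2 z)
  rw [← znorm_eq_norm, ← znorm_eq_norm, mul_comm] at h
  refine (Complex.abs_im_le_norm _).trans (le_trans (le_of_eq ?_) h)
  congr 1

lemma Hmul_Hinv_mul {n : ℕ} (p x y : Heis n) :
    Hmul (Hmul (Hinv p) x) (Hmul (Hinv x) y) = Hmul (Hinv p) y := by
  refine Prod.ext ?_ ?_
  · simp only [Hmul, Hinv]; abel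
  · simp only [Hmul, Hinv, Complex.im_sum, Pi.add_apply, Pi.neg_apply, map_add, map_neg]
    have key : ∀ j, ((-p.1 j + x.1 j) * (-(starRingEnd ℂ) (x.1 j) + (starRingEnd ℂ) (y.1 j))).im
        = (-p.1 j * (starRingEnd ℂ) (y.1 j)).im - (-p.1 j * (starRingEnd ℂ) (x.1 j)).im
          - (-x.1 j * (starRingEnd ℂ) (y.1 j)).im := by
      intro j
      simp only [Complex.mul_im, Complex.add_im, Complex.add_re, Complex.neg_im, Complex.neg_re,
        Complex.conj_im, Complex.conj_re]
      ring
    simp only [key, Finset.sum_sub_distrib]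
    ring

lemma Hmul_Hinv_comm {n : ℕ} (x y : Heis n) :
    Hmul (Hinv y) x = Hinv (Hmul (Hinv x) y) := by
  refine Prod.ext ?_ ?_
  · simp only [Hmul, Hinv]; abel
  · simp only [Hmul, Hinv, Complex.im_sum, Pi.neg_apply]
    have key : ∀ j, (-y.1 j * (starRingEnd ℂ) (x.1 j)).im
        = -(-x.1 j * (starRingEnd ℂ) (y.1 j)).im := by
      intro j
      simp only [Complex.mul_im, Complex.neg_im, Complex.neg_re,
        Complex.conj_im, Complex.conj_re]
      ring
    simp only [key, Finset.sum_neg_distrib]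
    ring

lemma boxDist_comm {n : ℕ} (x y : Heis n) : boxDist y x = boxDist x y := by
  rw [boxDist, Hmul_Hinv_comm x y]
  simp only [boxDist, Hinv, znorm_neg, abs_neg]

lemma boxDist_nonneg {n : ℕ} (x y : Heis n) : 0 ≤ boxDist x y :=
  (Real.sqrt_nonneg _).trans (le_max_right _ _)

lemma boxDist_self {n : ℕ} (x : Heis n) : boxDist x x = 0 := by
  simp [boxDist, Hmul, Hinv, znorm, Complex.mul_im, mul_comm]

lemma boxDist_le_iff {n : ℕ} {p q : Heis n} {ρ : ℝ} (hρ : 0 ≤ ρ) :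
    boxDist p q ≤ ρ ↔ q ∈ Htranslate p (Hbox n ρ) := by
  rw [boxDist, max_le_iff, Real.sqrt_le_left hρ]
  rfl

lemma boxDist_triangle {n : ℕ} (p x y : Heis n) :
    boxDist p y ≤ boxDist p x + boxDist x y := by
  have ha := boxDist_nonneg p x
  have hb := boxDist_nonneg x y
  obtain ⟨h1, h2⟩ := (boxDist_le_iff ha).1 le_rfl
  obtain ⟨h3, h4⟩ := (boxDist_le_iff hb).1 le_rfl
  rw [boxDist_le_iff (by positivity)]
  change Hmul (Hinv p) y ∈ Hbox n _
  rw [← Hmul_Hinv_mul p x y]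
  refine ⟨(znorm_add_le _ _).trans (add_le_add h1 h3), ?_⟩
  set u := Hmul (Hinv p) x
  set v := Hmul (Hinv x) y
  have h5 := abs_im_sum_mul_conj_le u.1 v.1
  have h6 : znorm u.1 * znorm v.1 ≤ boxDist p x * boxDist x y :=
    mul_le_mul h1 h3 (znorm_nonneg _) ha
  simp only [Hmul]
  rw [abs_le] at *
  constructor <;> nlinarith [mul_nonneg ha hb]

lemma boxDist_le_Hdist {n : ℕ} (x y : Heis n) : boxDist x y ≤ Hdist x y := by
  rw [boxDist, Hdist, koranyi]
  set u := Hmul (Hinv x) y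
  have h0 := znorm_nonneg u.1
  refine max_le ?_ ?_
  · rw [one_div, Real.le_rpow_inv_iff_of_pos h0 (by positivity) (by norm_num)]
    have : znorm u.1 ^ (4 : ℝ) = znorm u.1 ^ 4 := by exact_mod_cast Real.rpow_natCast _ 4
    rw [this]
    nlinarith [sq_nonneg u.2]
  · rw [one_div, Real.le_rpow_inv_iff_of_pos (by positivity) (by positivity) (by norm_num)]
    have : √|u.2| ^ (4 : ℝ) = √|u.2| ^ 4 := by exact_mod_cast Real.rpow_natCast _ 4
    rw [this, show √|u.2| ^ 4 = (√|u.2| ^ 2) ^ 2 by ring, Real.sq_sqrt (abs_nonneg _), sq_abs]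
    have : 0 ≤ znorm u.1 ^ 4 := by positivity
    linarith

lemma measurable_boxDist {n : ℕ} : Measurable fun a : Heis n × Heis n => boxDist a.1 a.2 := by
  unfold boxDist znorm Hmul Hinv
  refine Continuous.measurable ?_
  fun_prop

lemma measurableSet_boxDist_lt {n : ℕ} (p : Heis n) (r : ℝ) :
    MeasurableSet {q | boxDist p q < r} := by
  have h : Measurable (boxDist p) :=
    Measurable.comp (g := fun a : Heis n × Heis n => boxDist a.1 a.2) (f := Prod.mk p)
      measurable_boxDist measurable_prodMk_left
  exact measurableSet_lt h measurable_const

lemma Hdist_nonneg {n : ℕ} (x y : Heis n) : 0 ≤ Hdist x y :=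
  (boxDist_nonneg x y).trans (boxDist_le_Hdist x y)

/-- Packing bound: a maximal `r`-separated subset of `F` gives a finite cover by `r`-balls. -/
lemma exists_finset_cover {n : ℕ} {F : Set (Heis n)} {μ : Measure (Heis n)} (hμ : μ Set.univ = 1)
    {r v : ℝ} (hr : 0 < r) (hv : 0 < v)
    (hball : ∀ p ∈ F, ENNReal.ofReal v ≤ μ {q | boxDist p q < r / 2}) :
    ∃ s : Finset (Heis n), s.card * v ≤ 1 ∧ F ⊆ ⋃ i ∈ s, {q | boxDist i q < r} := by
  classical
  let P : Finset (Heis n) → Prop := fun s =>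
    (∀ x ∈ s, x ∈ F) ∧ ∀ x ∈ s, ∀ y ∈ s, x ≠ y → r ≤ boxDist x y
  have hcard : ∀ s, P s → s.card * v ≤ 1 := by
    rintro s ⟨hs, hsep⟩
    have hdisj : (s : Set (Heis n)).PairwiseDisjoint fun p => {q | boxDist p q < r / 2} := by
      intro x hx y hy hxy
      refine Set.disjoint_left.2 fun z hz hz' => ?_
      simp only [Set.mem_ofPred_eq] at hz hz'
      have h1 := hsep x hx y hy hxy
      have h2 := boxDist_triangle x z y
      rw [boxDist_comm y z] at h2
      linarith
    have hmeas : ∀ p ∈ s, MeasurableSet {q | boxDist p q < r / 2} := fun p _ =>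
      measurableSet_boxDist_lt p _
    have h := measure_biUnion_finset (μ := μ) hdisj hmeas
    have h' : (s.card : ENNReal) * ENNReal.ofReal v ≤ 1 := by
      rw [← nsmul_eq_mul, ← hμ]
      calc s.card • ENNReal.ofReal v ≤ ∑ p ∈ s, μ {q | boxDist p q < r / 2} :=
            Finset.card_nsmul_le_sum _ _ _ fun p hp => hball p (hs p hp)
        _ ≤ _ := h ▸ measure_mono (Set.subset_univ _)
    rwa [← ENNReal.ofReal_natCast, ← ENNReal.ofReal_mul (by positivity),
      ENNReal.ofReal_le_one] at h'
  have hbdd : BddAbove (Finset.card '' {s | P s}) := by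
    refine ⟨⌊v⁻¹⌋₊, ?_⟩
    rintro _ ⟨s, hs, rfl⟩
    refine Nat.le_floor ?_
    rw [← one_div, le_div_iff₀ hv]
    exact hcard s hs
  obtain ⟨s, hs, hmax⟩ := Nat.sSup_mem (⟨0, ∅, by simp [P], rfl⟩ :
    (Finset.card '' {s | P s}).Nonempty) hbdd
  refine ⟨s, hcard s hs, fun x hx => ?_⟩
  by_contra hcon
  simp only [Set.mem_iUnion, Set.mem_ofPred_eq, exists_prop, not_exists, not_and, not_lt] at hcon
  have hxs : x ∉ s := fun h => by
    have := hcon x h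
    rw [boxDist_self] at this
    linarith
  have hins : P (insert x s) := by
    refine ⟨fun y hy => ?_, fun y hy z hz hyz => ?_⟩
    · rcases Finset.mem_insert.1 hy with rfl | hy
      exacts [hx, hs.1 y hy]
    · rcases Finset.mem_insert.1 hy with rfl | hy' <;> rcases Finset.mem_insert.1 hz with rfl | hz'
      · exact absurd rfl hyz
      · rw [boxDist_comm]; exact hcon z hz'
      · exact hcon y hy'
      · exact hs.2 y hy' z hz' hyz
  have := le_csSup hbdd ⟨_, hins, rfl⟩
  rw [Finset.card_insert_of_notMem hxs] at this
  omega

open ProbabilityTheory in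
lemma variance_indicator_one {X : Type*} [MeasurableSpace X] (m : Measure X)
    [IsProbabilityMeasure m] {S : Set X} (hS : MeasurableSet S) :
    Var[S.indicator fun _ => (1 : ℝ); m] = (m S).toReal - (m S).toReal ^ 2 := by
  rw [variance_eq_sub (memLp_indicator_const 2 hS 1 (Or.inr (measure_ne_top _ _)))]
  have : (S.indicator fun _ => (1 : ℝ)) ^ 2 = S.indicator fun _ => (1 : ℝ) := by
    ext x
    by_cases h : x ∈ S <;> simp [h]
  rw [this, integral_indicator_const _ hS, smul_eq_mul, mul_one, Measure.real]

lemma toReal_sub_sq_eq_zero {X : Type*} [MeasurableSpace X] (m : Measure X)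
    [IsProbabilityMeasure m] {S E : Set X} (hS : MeasurableSet S) (hE : m Eᶜ = 0)
    (h : E ⊆ S ∨ E ⊆ Sᶜ) : (m S).toReal - (m S).toReal ^ 2 = 0 := by
  rcases h with h | h
  · have := measure_mono_null (Set.compl_subset_compl.2 h) hE
    rw [prob_compl_eq_zero_iff hS] at this
    simp [this]
  · have := measure_mono_null (Set.subset_compl_comm.1 h) hE
    simp [this]

/-- Integrated over the radius, the variance of the indicator of a ball is at most the width. -/
lemma lintegral_toReal_sub_sq_le {X : Type*} [MeasurableSpace X] {G : X → X → ℝ}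
    (htri : ∀ p x y, G p y ≤ G p x + G x y) (p : X) (hp : Measurable (G p))
    {m : Measure X} {w : ℝ} (hm : HasWidth G m w) :
    ∫⁻ ρ : ℝ, ENNReal.ofReal ((m {x | G p x ≤ ρ}).toReal - (m {x | G p x ≤ ρ}).toReal ^ 2)
      ≤ ENNReal.ofReal w := by
  obtain ⟨hprob, E, hE, hw⟩ := hm
  set T : Set ℝ := {ρ | (∃ x ∈ E, G p x ≤ ρ) ∧ ∃ y ∈ E, ρ < G p y}
  have hT : ∀ ρ, ENNReal.ofReal ((m {x | G p x ≤ ρ}).toReal - (m {x | G p x ≤ ρ}).toReal ^ 2)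
      ≤ T.indicator (fun _ => 1) ρ := by
    intro ρ
    by_cases h : ρ ∈ T
    · rw [Set.indicator_of_mem h, ENNReal.ofReal_le_one]
      have : (m {x | G p x ≤ ρ}).toReal ≤ 1 := measureReal_le_one
      nlinarith [sq_nonneg (m {x | G p x ≤ ρ}).toReal]
    · rw [toReal_sub_sq_eq_zero m (measurableSet_le hp measurable_const) hE]
      · simp
      · by_contra! hcon
        simp only [Set.not_subset] at hcon
        obtain ⟨⟨y, hy, hy'⟩, x, hx, hx'⟩ := hcon
        exact h ⟨⟨x, hx, not_not.1 hx'⟩, y, hy, not_le.1 hy'⟩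
  calc _ ≤ ∫⁻ ρ, T.indicator (fun _ => 1) ρ := lintegral_mono hT
    _ ≤ 1 * volume T := lintegral_indicator_const_le _ _
    _ ≤ Metric.ediam T := by rw [one_mul]; exact Real.volume_le_diam T
    _ ≤ ENNReal.ofReal w := by
      have key : ∀ a ∈ T, ∀ b ∈ T, a - b ≤ w := by
        rintro a ⟨-, y, hy, hay⟩ b ⟨⟨x, hx, hxb⟩, -⟩
        linarith [hw x hx y hy, htri p x y]
      refine Metric.ediam_le fun a ha b hb => ?_
      rw [edist_dist, Real.dist_eq]
      refine ENNReal.ofReal_le_ofReal (abs_le.2 ⟨?_, ?_⟩)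
      · linarith [key b hb a ha]
      · exact key a ha b hb

open ProbabilityTheory in
lemma lintegral_sum_indicator_sub_sq {X ι : Type*} [MeasurableSpace X] [Fintype ι]
    (m : ι → Measure X) [∀ j, IsProbabilityMeasure (m j)] {S : Set X} (hS : MeasurableSet S) :
    ∫⁻ x, ‖∑ j, S.indicator (fun _ => (1 : ℝ)) (x j) - ∑ j, (m j S).toReal‖ₑ ^ 2
        ∂(Measure.pi m)
      = ∑ j, ENNReal.ofReal ((m j S).toReal - (m j S).toReal ^ 2) := by
  simp only [← variance_indicator_one (m _) hS]
  have hmem : ∀ j, MemLp (S.indicator fun _ => (1 : ℝ)) 2 (m j) := fun j =>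
    memLp_indicator_const 2 hS 1 (Or.inr (measure_ne_top _ _))
  have hmem' : ∀ j, MemLp (fun x : ι → X => S.indicator (fun _ => (1 : ℝ)) (x j)) 2
      (Measure.pi m) := fun j =>
    (hmem j).comp_measurePreserving (measurePreserving_eval m j)
  have hsum := variance_sum_pi hmem
  rw [← ENNReal.ofReal_sum_of_nonneg fun j _ => variance_nonneg _ _, ← hsum,
    ofReal_variance (memLp_finsetSum' _ fun j _ => hmem' j), evariance]
  have hmean : (Measure.pi m)[∑ j, fun x : ι → X => S.indicator (fun _ => (1 : ℝ)) (x j)]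
      = ∑ j, (m j S).toReal := by
    simp only [Finset.sum_apply]
    rw [integral_finsetSum _ fun j _ => (hmem' j).integrable (by norm_num)]
    refine Finset.sum_congr rfl fun j _ => ?_
    rw [integral_comp_eval (μ := m) (i := j) (hmem j).aestronglyMeasurable,
      integral_indicator_const _ hS]
    simp [Measure.real]
  rw [hmean]
  simp only [Finset.sum_apply]

/-- Some choice of points, the `j`-th one drawn from `m j`, has averaged quadratic discrepancy
at most the sum of the widths. -/
lemma exists_points_lintegral_le {X : Type*} [MeasurableSpace X] {G : X → X → ℝ}
    (hG : Measurable fun a : X × X => G a.1 a.2) (htri : ∀ p x y, G p y ≤ G p x + G x y)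
    {N : ℕ} (m : Fin N → Measure X) (w : Fin N → ℝ) (hm : ∀ j, HasWidth G (m j) (w j))
    (κ : Measure X) [IsProbabilityMeasure κ] (I : Set ℝ) :
    ∃ pts : Fin N → X, ∫⁻ ρ in I, ∫⁻ p, ‖∑ j, {x | G p x ≤ ρ}.indicator (fun _ => (1 : ℝ)) (pts j)
        - ∑ j, (m j {x | G p x ≤ ρ}).toReal‖ₑ ^ 2 ∂κ ≤ ∑ j, ENNReal.ofReal (w j) := by
  have hprob : ∀ j, IsProbabilityMeasure (m j) := fun j => (hm j).1
  have hG1 : ∀ p, Measurable (G p) := fun p => hG.comp measurable_prodMk_left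
  have hmeas : ∀ j, Measurable fun a : ℝ × X => (m j {x | G a.2 x ≤ a.1}).toReal := fun j => by
    have hset : MeasurableSet {b : (ℝ × X) × X | G b.1.2 b.2 ≤ b.1.1} :=
      measurableSet_le (hG.comp (by fun_prop : Measurable fun b : (ℝ × X) × X => (b.1.2, b.2)))
        (by fun_prop)
    exact (measurable_measure_prodMk_left (ν := m j) hset).ennreal_toReal
  have hind : ∀ j : Fin N, Measurable fun b : (Fin N → X) × (ℝ × X) =>
      {x | G b.2.2 x ≤ b.2.1}.indicator (fun _ => (1 : ℝ)) (b.1 j) := fun j => by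
    have hset : MeasurableSet {b : (Fin N → X) × (ℝ × X) | G b.2.2 (b.1 j) ≤ b.2.1} :=
      measurableSet_le (hG.comp (by fun_prop :
        Measurable fun b : (Fin N → X) × (ℝ × X) => (b.2.2, b.1 j))) (by fun_prop)
    exact (measurable_const (a := (1 : ℝ))).indicator hset
  set Φ : (Fin N → X) × (ℝ × X) → ENNReal := fun b =>
    ‖∑ j, {x | G b.2.2 x ≤ b.2.1}.indicator (fun _ => (1 : ℝ)) (b.1 j)
        - ∑ j, (m j {x | G b.2.2 x ≤ b.2.1}).toReal‖ₑ ^ 2 with hΦ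
  have hΦm : Measurable Φ := by
    refine Measurable.pow_const (Measurable.enorm (Measurable.sub ?_ ?_)) 2
    · exact Finset.measurable_fun_sum _ fun j _ => hind j
    · exact Finset.measurable_fun_sum _ fun j _ => (hmeas j).comp measurable_snd
  set P := (volume.restrict I).prod κ
  obtain ⟨pts, hpts⟩ := exists_le_lintegral (μ := Measure.pi m)
    (f := fun pts => ∫⁻ a, Φ (pts, a) ∂P) (hΦm.lintegral_prod_right' (ν := P)).aemeasurable
  refine ⟨pts, ?_⟩
  calc _ = ∫⁻ a, Φ (pts, a) ∂P :=
        (lintegral_prod _ (hΦm.comp measurable_prodMk_left).aemeasurable).symm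
    _ ≤ ∫⁻ x, ∫⁻ a, Φ (x, a) ∂P ∂(Measure.pi m) := hpts
    _ = ∫⁻ a, ∫⁻ x, Φ (x, a) ∂(Measure.pi m) ∂P := lintegral_lintegral_swap hΦm.aemeasurable
    _ = ∫⁻ a : ℝ × X, ∑ j, ENNReal.ofReal
          ((m j {x | G a.2 x ≤ a.1}).toReal - (m j {x | G a.2 x ≤ a.1}).toReal ^ 2) ∂P := by
        refine lintegral_congr fun a => ?_
        have hS : MeasurableSet {x | G a.2 x ≤ a.1} := measurableSet_le (hG1 a.2) measurable_const
        simp only [hΦ]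
        rw [lintegral_sum_indicator_sub_sq m hS]
    _ = ∑ j, ∫⁻ a : ℝ × X, ENNReal.ofReal
          ((m j {x | G a.2 x ≤ a.1}).toReal - (m j {x | G a.2 x ≤ a.1}).toReal ^ 2) ∂P :=
        lintegral_finsetSum _ fun j _ => ((hmeas j).sub ((hmeas j).pow_const 2)).ennreal_ofReal
    _ ≤ _ := Finset.sum_le_sum fun j _ => by
        have hvar : Measurable fun a : ℝ × X => ENNReal.ofReal
            ((m j {x | G a.2 x ≤ a.1}).toReal - (m j {x | G a.2 x ≤ a.1}).toReal ^ 2) :=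
          ((hmeas j).sub ((hmeas j).pow_const 2)).ennreal_ofReal
        rw [lintegral_prod_symm' _ hvar]
        calc _ ≤ ∫⁻ _ : X, ENNReal.ofReal (w j) ∂κ := lintegral_mono fun p =>
              (setLIntegral_le_lintegral _ _).trans
                (lintegral_toReal_sub_sq_le htri p (hG1 p) (hm j))
          _ = _ := by simp

lemma exists_pow_bounds {x : ℝ} (hx : 1 ≤ x) {D B : ℝ} (hD : 0 ≤ D) (hB : 0 ≤ B) (q : ℕ) :
    ∃ k : ℕ, D * x ^ (q + 1) / 2 ^ k + B * (2 ^ k) ^ q ≤ (2 * D + B) * x ^ q := by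
  obtain ⟨k, h1, h2⟩ := exists_nat_pow_near hx one_lt_two
  refine ⟨k, ?_⟩
  have e1 : D * x ^ (q + 1) / 2 ^ k ≤ 2 * D * x ^ q := by
    rw [div_le_iff₀ (by positivity)]
    rw [pow_succ] at h2
    have : D * x ^ q * x ≤ D * x ^ q * (2 ^ k * 2) := by gcongr
    calc D * x ^ (q + 1) = D * x ^ q * x := by ring
      _ ≤ _ := this
      _ = _ := by ring
  have e2 : B * (2 ^ k) ^ q ≤ B * x ^ q := by gcongr
  linarith

/-- Upper bound for the minimal quadratic discrepancy: if `F ⊆ ℍⁿ`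
has Lebesgue measure `1` and the restriction `μ` of Lebesgue measure to `F` is
lower and upper Ahlfors regular on balls centered in `F` of radius `< diam F`,
then there is `C > 0` such that for all sufficiently large `N` there exist `N`
points with `∫₀^{diam F} ∫_F |D_N(z,t;ρ)|² dz dt dρ ≤ C·N^{1 − 1/Q}`, `Q = 2n+2`. -/
theorem quadratic_discrepancy_upper_bound
    (n : ℕ) (hn : 1 ≤ n) (F : Set (Heis n)) (hF : MeasurableSet F)
    (hvol : volume F = 1) (c₁ c₂ : ℝ) (hc₁ : 0 < c₁) (hc₂ : 0 < c₂)
    (hAhlfors : ∀ p ∈ F, ∀ r : ℝ, 0 < r → r < Hdiam F →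
      ENNReal.ofReal (c₁ * r ^ (2 * n + 2)) ≤ (volume.restrict F) (Hball p r) ∧
        (volume.restrict F) (Hball p r) ≤ ENNReal.ofReal (c₂ * r ^ (2 * n + 2))) :
    ∃ C > (0 : ℝ), ∃ N₀ : ℕ, ∀ N : ℕ, N₀ ≤ N → ∃ pts : Fin N → Heis n,
      (∫ ρ in (0 : ℝ)..(Hdiam F),
          ∫ p in F, (disc (volume.restrict F) pts p ρ) ^ 2) ≤
        C * (N : ℝ) ^ ((1 : ℝ) - 1 / (2 * (n : ℝ) + 2)) := by
  rcases eq_or_ne (Hdiam F) 0 with hd0 | hd0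
  · refine ⟨1, one_pos, 0, fun N _ => ⟨fun _ => 0, ?_⟩⟩
    rw [hd0, intervalIntegral.integral_same]
    positivity
  have hbdd : BddAbove (Set.image2 Hdist F F) := by
    by_contra h
    exact hd0 (Real.sSup_of_not_bddAbove h)
  have hd : 0 < Hdiam F := lt_of_le_of_ne (Real.sSup_nonneg (by
    rintro _ ⟨x, -, y, -, rfl⟩
    exact Hdist_nonneg x y)) hd0.symm
  set d := Hdiam F
  set μ := (volume : Measure (Heis n)).restrict F with hμdef
  have hμ : μ Set.univ = 1 := by rw [Measure.restrict_apply_univ, hvol]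
  have hμprob : IsProbabilityMeasure μ := ⟨hμ⟩
  set A : ℝ := (c₁ * (d / 2) ^ (2 * n + 1 + 1))⁻¹ with hA
  have hA0 : 0 < A := by positivity
  have hcover : ∀ k : ℕ, ∃ (s : Finset (Heis n)) (E : Heis n → Set (Heis n)),
      (s.card : ℝ) ≤ A * (2 ^ k) ^ (2 * n + 1 + 1) ∧
      (∀ i, MeasurableSet (E i)) ∧ F ⊆ ⋃ i ∈ s, E i ∧
      ∀ i ∈ s, ∀ x ∈ E i, ∀ y ∈ E i, boxDist x y ≤ 2 * d / 2 ^ k := by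
    intro k
    obtain ⟨s, hs, hF⟩ := exists_finset_cover hμ (F := F) (r := d / 2 ^ k)
      (v := c₁ * (d / 2 ^ k / 2) ^ (2 * n + 2)) (by positivity) (by positivity) (by
        intro p hp
        refine (hAhlfors p hp (d / 2 ^ k / 2) (by positivity) ?_).1.trans
          (measure_mono fun q hq => (boxDist_le_Hdist p q).trans_lt hq)
        calc d / 2 ^ k / 2 ≤ d / 1 / 2 := by
              gcongr
              exact one_le_pow₀ one_le_two
          _ < d := by linarith)
    refine ⟨s, fun i => {q | boxDist i q < d / 2 ^ k}, ?_, fun i => ?_, hF, ?_⟩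
    · rw [hA, inv_mul_eq_div, le_div_iff₀ (by positivity)]
      calc s.card * (c₁ * (d / 2) ^ (2 * n + 1 + 1))
          = s.card * (c₁ * (d / 2 ^ k / 2) ^ (2 * n + 2)) * (2 ^ k) ^ (2 * n + 1 + 1) := by
            rw [show d / 2 = d / 2 ^ k / 2 * 2 ^ k by field_simp, mul_pow]
            ring
        _ ≤ 1 * (2 ^ k) ^ (2 * n + 1 + 1) := by gcongr
        _ = _ := one_mul _
    · exact measurableSet_boxDist_lt i _
    · intro i _ x hx y hy
      simp only [Set.mem_ofPred_eq] at hx hy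
      have := boxDist_triangle x i y
      rw [boxDist_comm i x] at this
      calc boxDist x y ≤ d / 2 ^ k + d / 2 ^ k := by linarith
        _ = _ := by ring
  refine ⟨2 * (2 * d) + 4 * A * (2 * d), by positivity, 1, fun N hN => ?_⟩
  have hN1 : (1 : ℝ) ≤ N := by exact_mod_cast hN
  have hN0 : (0 : ℝ) < N := by linarith
  set x : ℝ := (N : ℝ) ^ (1 / (2 * (n : ℝ) + 2)) with hx
  have hx1 : 1 ≤ x := Real.one_le_rpow hN1 (by positivity)
  have hxQ : x ^ (2 * n + 1 + 1) = N := by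
    rw [hx, ← Real.rpow_mul_natCast hN0.le]
    push_cast
    rw [show 1 / (2 * (n : ℝ) + 2) * (2 * n + 1 + 1) = 1 by field_simp; ring, Real.rpow_one]
  have hxq : x ^ (2 * n + 1) = (N : ℝ) ^ ((1 : ℝ) - 1 / (2 * (n : ℝ) + 2)) := by
    rw [hx, ← Real.rpow_mul_natCast hN0.le]
    push_cast
    congr 1
    field_simp
    ring
  obtain ⟨k, hk⟩ := exists_pow_bounds hx1 (D := 2 * d) (B := 4 * A * (2 * d)) (by positivity)
    (by positivity) (2 * n + 1)
  rw [hxQ, hxq] at hk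
  obtain ⟨L, hL1, hL2, hL3⟩ := exists_list_width_le boxDist hA0.le (D := 2 * d) (by positivity)
    (q := 2 * n + 1) (by omega) (fun x hx y hy => (boxDist_le_Hdist x y).trans
      ((le_csSup hbdd ⟨x, hx, y, hy, rfl⟩).trans (by linarith : d ≤ 2 * d))) hcover k N (N • μ)
    (by simp) (by simp [hμdef, Measure.restrict_apply' hF])
  have hlen : L.length = N := by
    have h := list_sum_univ (L.map Prod.fst) (by
      intro m hm
      obtain ⟨a, ha, rfl⟩ := List.mem_map.1 hm
      exact (hL2 a ha).1)
    rw [hL1, List.length_map] at h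
    simp only [Measure.smul_apply, measure_univ, nsmul_eq_mul, mul_one] at h
    exact_mod_cast h.symm
  obtain ⟨f, rfl⟩ : ∃ f : Fin N → Measure (Heis n) × ℝ, L = List.ofFn f := by
    subst hlen
    exact ⟨L.get, (List.ofFn_get L).symm⟩
  simp only [List.map_ofFn, List.sum_ofFn, Function.comp_apply] at hL1 hL3
  have hf : ∀ j, HasWidth boxDist (f j).1 (f j).2 := fun j => hL2 _ (by simp)
  have hf0 : ∀ j, 0 ≤ (f j).2 := fun j => by
    obtain ⟨hp, E, hE, hw⟩ := hf j
    have : E.Nonempty := by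
      by_contra h
      rw [Set.not_nonempty_iff_eq_empty.1 h] at hE
      simp at hE
    obtain ⟨y, hy⟩ := this
    exact (boxDist_nonneg y y).trans (hw y hy y hy)
  obtain ⟨pts, hpts⟩ := exists_points_lintegral_le measurable_boxDist boxDist_triangle
    (fun j => (f j).1) (fun j => (f j).2) hf μ (Set.Ioc 0 d)
  refine ⟨pts, ?_⟩
  rw [← ENNReal.ofReal_sum_of_nonneg fun j _ => hf0 j] at hpts
  have hdisc : ∀ ρ ∈ Set.Ioc 0 d, ∀ p, disc μ pts p ρ
      = ∑ j, {x | boxDist p x ≤ ρ}.indicator (fun _ => (1 : ℝ)) (pts j)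
        - ∑ j, ((f j).1 {x | boxDist p x ≤ ρ}).toReal := by
    intro ρ hρ p
    have hset : Htranslate p (Hbox n ρ) = {x | boxDist p x ≤ ρ} :=
      Set.ext fun q => (boxDist_le_iff hρ.1.le).symm
    have hprob : ∀ j, IsProbabilityMeasure (f j).1 := fun j => (hf j).1
    rw [disc, hset, ← ENNReal.toReal_sum fun j _ => measure_ne_top _ _,
      ← Measure.finsetSum_apply, hL1]
    simp
  have hmain : ∫ ρ in (0 : ℝ)..d, ∫ p, (disc μ pts p ρ) ^ 2 ∂μ ≤ ∑ j, (f j).2 := by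
    have h0 : 0 ≤ ∑ j, (f j).2 := Finset.sum_nonneg fun j _ => hf0 j
    rw [intervalIntegral.integral_of_le hd.le]
    refine (Real.le_norm_self _).trans ?_
    rw [← ENNReal.ofReal_le_ofReal_iff h0, ofReal_norm]
    calc _ ≤ ∫⁻ ρ in Set.Ioc 0 d, ‖∫ p, (disc μ pts p ρ) ^ 2 ∂μ‖ₑ :=
          enorm_integral_le_lintegral_enorm _
      _ ≤ _ := by
        refine le_trans (setLIntegral_mono' measurableSet_Ioc fun ρ hρ => ?_) hpts
        refine (enorm_integral_le_lintegral_enorm _).trans (lintegral_mono fun p => ?_)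
        rw [hdisc ρ hρ p, enorm_pow]
  linarith
end
end
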